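/- Let n ≥ 1 and p > 1. If there exists a positive classical solution of ∂ₜu = Δu + u^p on ℝⁿ×ℝ, then there exists a positive classical solution v of the same equation on ℝⁿ×ℝ satisfying v(x,t) ≤ 1 for all (x,t) ∈ ℝⁿ×ℝ. -/

import Mathlib

open scoped BigOperators

/-- The Laplacian of `f : ℝⁿ → ℝ` at `x`, as the sum of the second partial
derivatives in the coordinate directions. -/
noncomputable def lap {n : ℕ} (f : EuclideanSpace ℝ (Fin n) → ℝ)
    (x : EuclideanSpace ℝ (Fin n)) : ℝ :=
  ∑ i : Fin n,
    fderiv ℝ (fun y => fderiv ℝ f y (EuclideanSpace.single i 1)) x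
      (EuclideanSpace.single i 1)

/-- `u` is a positive classical solution of `∂ₜ u = Δu + u^p` on `ℝⁿ × ℝ`. -/
def IsPosSol (n : ℕ) (p : ℝ) (u : EuclideanSpace ℝ (Fin n) × ℝ → ℝ) : Prop :=
  (∀ t, ContDiff ℝ 2 fun x => u (x, t)) ∧
  (∀ x, ContDiff ℝ 1 fun t => u (x, t)) ∧
  (∀ x t, 0 < u (x, t)) ∧
  (∀ x t, deriv (fun s => u (x, s)) t = lap (fun y => u (y, t)) x + u (x, t) ^ p)

section BoundedSolutions

open MeasureTheory Set Filter Topology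

/-- Euclidean space of dimension `n`. -/
abbrev Eu (n : ℕ) := EuclideanSpace ℝ (Fin n)

section Laplacian

variable {n : ℕ}

lemma contDiff_fderiv_apply {f : Eu n → ℝ} (hf : ContDiff ℝ 2 f) (v : Eu n) :
    ContDiff ℝ 1 fun y => fderiv ℝ f y v :=
  (hf.fderiv_right (m := 1) (by norm_num)).clm_apply contDiff_const

lemma continuous_lap {f : Eu n → ℝ} (hf : ContDiff ℝ 2 f) : Continuous (lap f) := by
  unfold lap
  refine continuous_finsetSum _ fun i _ => ?_
  exact (((contDiff_fderiv_apply hf _).fderiv_right (m := 0) (by norm_num)).clm_apply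
    contDiff_const).continuous

lemma lap_affine {f : Eu n → ℝ} (hf : ContDiff ℝ 2 f) (a : Eu n) (c : ℝ) (y : Eu n) :
    lap (fun z => f (a + c • z)) y = c ^ 2 * lap f (a + c • y) := by
  have key : ∀ {g : Eu n → ℝ}, ContDiff ℝ 1 g → ∀ z v : Eu n,
      fderiv ℝ (fun z => g (a + c • z)) z v = c * fderiv ℝ g (a + c • z) v := by
    intro g hg z v
    have h1 : HasFDerivAt g (fderiv ℝ g (a + c • z)) (a + c • z) :=
      (hg.differentiable (by norm_num) _).hasFDerivAt
    have h2 : HasFDerivAt (fun z : Eu n => a + c • z)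
        (c • ContinuousLinearMap.id ℝ (Eu n)) z :=
      ((hasFDerivAt_id z).const_smul c).const_add a
    have h3 : HasFDerivAt (fun z : Eu n => g (a + c • z)) _ z := h1.comp z h2
    rw [h3.fderiv]
    simp
  unfold lap
  rw [Finset.mul_sum]
  refine Finset.sum_congr rfl fun i _ => ?_
  have h1 := contDiff_fderiv_apply hf (EuclideanSpace.single i 1)
  have : (fun z => fderiv ℝ (fun z => f (a + c • z)) z (EuclideanSpace.single i 1))
      = fun z => c * fderiv ℝ f (a + c • z) (EuclideanSpace.single i 1) := by
    funext z
    exact key (hf.of_le (by norm_num)) z _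
  rw [this]
  have hd : DifferentiableAt ℝ
      (fun z => fderiv ℝ f (a + c • z) (EuclideanSpace.single i (1 : ℝ))) y := by
    have h3 : ContDiff ℝ 1 (fun z : Eu n => a + c • z) := by fun_prop
    exact ((h1.comp h3).differentiable (by norm_num)) y
  rw [fderiv_const_mul hd]
  simp only [_root_.smul_apply, smul_eq_mul]
  rw [key h1 y]
  ring

lemma lap_add {f g : Eu n → ℝ} (hf : ContDiff ℝ 2 f) (hg : ContDiff ℝ 2 g) (y : Eu n) :
    lap (fun z => f z + g z) y = lap f y + lap g y := by
  unfold lap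
  rw [← Finset.sum_add_distrib]
  refine Finset.sum_congr rfl fun i _ => ?_
  have h0 : (fun z => fderiv ℝ (fun z => f z + g z) z (EuclideanSpace.single i 1))
      = fun z => fderiv ℝ f z (EuclideanSpace.single i 1)
        + fderiv ℝ g z (EuclideanSpace.single i 1) := by
    funext z
    rw [fderiv_fun_add (hf.differentiable (by norm_num) z) (hg.differentiable (by norm_num) z)]
    rfl
  rw [h0, fderiv_fun_add
    ((contDiff_fderiv_apply hf _).differentiable (by norm_num) y)
    ((contDiff_fderiv_apply hg _).differentiable (by norm_num) y)]
  rfl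

lemma lap_zero (y : Eu n) : lap (fun _ : Eu n => (0 : ℝ)) y = 0 := by
  simp [lap]

lemma lap_finset_sum {ι : Type*} (s : Finset ι) {f : ι → Eu n → ℝ}
    (hf : ∀ i ∈ s, ContDiff ℝ 2 (f i)) (y : Eu n) :
    lap (fun z => ∑ i ∈ s, f i z) y = ∑ i ∈ s, lap (f i) y := by
  classical
  induction s using Finset.induction_on with
  | empty => simpa using lap_zero y
  | insert a s ha ih =>
    have h1 : ∀ i ∈ s, ContDiff ℝ 2 (f i) := fun i hi => hf i (Finset.mem_insert_of_mem hi)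
    simp only [Finset.sum_insert ha]
    rw [lap_add (hf a (Finset.mem_insert_self a s)) (ContDiff.sum h1), ih h1]

lemma lap_eq_zero_of_notMem {f : Eu n → ℝ} {y : Eu n} (hy : y ∉ tsupport f) :
    lap f y = 0 := by
  unfold lap
  refine Finset.sum_eq_zero fun i _ => ?_
  have h1 : (fun z => fderiv ℝ f z (EuclideanSpace.single i 1)) =ᶠ[𝓝 y] fun _ => 0 := by
    have h2 : f =ᶠ[𝓝 y] fun _ => 0 := notMem_tsupport_iff_eventuallyEq.mp hy
    filter_upwards [h2.fderiv (𝕜 := ℝ)] with z hz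
    rw [hz]; simp
  rw [h1.fderiv_eq]
  simp

lemma sum_single_sq (y : Eu n) : ∑ i : Fin n, y i ^ 2 = ‖y‖ ^ 2 := by
  rw [EuclideanSpace.real_norm_sq_eq]

lemma hasFDerivAt_radial {F F' : ℝ → ℝ} (h1 : ∀ q, HasDerivAt F (F' q) q) (y : Eu n) :
    HasFDerivAt (fun z : Eu n => F (‖z‖ ^ 2)) (F' (‖y‖ ^ 2) • (2 • innerSL ℝ y)) y := by
  have h := (hasStrictFDerivAt_norm_sq y).hasFDerivAt
  exact (h1 (‖y‖ ^ 2)).comp_hasFDerivAt y h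

lemma lap_radial {F F' F'' : ℝ → ℝ} (h1 : ∀ q, HasDerivAt F (F' q) q)
    (h2 : ∀ q, HasDerivAt F' (F'' q) q) (y : Eu n) :
    lap (fun z : Eu n => F (‖z‖ ^ 2)) y
      = 2 * n * F' (‖y‖ ^ 2) + 4 * ‖y‖ ^ 2 * F'' (‖y‖ ^ 2) := by
  have e1 : ∀ i : Fin n, (fun z => fderiv ℝ (fun z : Eu n => F (‖z‖ ^ 2)) z
      (EuclideanSpace.single i 1)) = fun z => F' (‖z‖ ^ 2) * (2 * z i) := by
    intro i
    funext z
    rw [(hasFDerivAt_radial h1 z).fderiv]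
    simp [EuclideanSpace.inner_single_right]
  have e2 : ∀ i : Fin n, fderiv ℝ (fun z : Eu n => F' (‖z‖ ^ 2) * (2 * z i)) y
      (EuclideanSpace.single i 1) = 2 * F' (‖y‖ ^ 2) + 4 * F'' (‖y‖ ^ 2) * y i ^ 2 := by
    intro i
    have h3 : HasFDerivAt (fun z : Eu n => 2 * z i)
        ((2 : ℝ) • (EuclideanSpace.proj i : Eu n →L[ℝ] ℝ)) y :=
      ((EuclideanSpace.proj i : Eu n →L[ℝ] ℝ).hasFDerivAt).const_mul 2
    rw [((hasFDerivAt_radial h2 y).fun_mul h3).fderiv]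
    simp [EuclideanSpace.inner_single_right]
    ring
  unfold lap
  simp only [e1, e2]
  rw [Finset.sum_add_distrib, ← Finset.mul_sum, ← Finset.mul_sum, sum_single_sq]
  simp
  ring

lemma contDiff_radial {F : ℝ → ℝ} (hF : ContDiff ℝ 2 F) :
    ContDiff ℝ 2 fun z : Eu n => F (‖z‖ ^ 2) :=
  hF.comp (contDiff_norm_sq ℝ)

/-- Green's identity for a compactly supported test function. -/
lemma integral_mul_lap_comm {u φ : Eu n → ℝ} (hu : ContDiff ℝ 2 u) (hφ : ContDiff ℝ 2 φ)
    (hc : HasCompactSupport φ) :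
    ∫ y, u y * lap φ y = ∫ y, lap u y * φ y := by
  have key : ∀ i : Fin n,
      ∫ y, u y * fderiv ℝ (fun z => fderiv ℝ φ z (EuclideanSpace.single i 1)) y
          (EuclideanSpace.single i 1)
        = ∫ y, fderiv ℝ (fun z => fderiv ℝ u z (EuclideanSpace.single i 1)) y
          (EuclideanSpace.single i 1) * φ y := by
    intro i
    set v : Eu n := EuclideanSpace.single i 1
    have du := contDiff_fderiv_apply hu v
    have dφ := contDiff_fderiv_apply hφ v
    have cdφ : HasCompactSupport fun z => fderiv ℝ φ z v := hc.fderiv_apply (𝕜 := ℝ) v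
    have cddφ : HasCompactSupport fun y => fderiv ℝ (fun z => fderiv ℝ φ z v) y v :=
      cdφ.fderiv_apply (𝕜 := ℝ) v
    have c1 : Continuous fun y => fderiv ℝ (fun z => fderiv ℝ φ z v) y v :=
      ((dφ.fderiv_right (m := 0) (by norm_num)).clm_apply contDiff_const).continuous
    have c2 : Continuous fun y => fderiv ℝ (fun z => fderiv ℝ u z v) y v :=
      ((du.fderiv_right (m := 0) (by norm_num)).clm_apply contDiff_const).continuous
    rw [integral_mul_fderiv_eq_neg_fderiv_mul_of_integrable
      ((du.continuous.mul dφ.continuous).integrable_of_hasCompactSupport cdφ.mul_left)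
      ((hu.continuous.mul c1).integrable_of_hasCompactSupport cddφ.mul_left)
      ((hu.continuous.mul dφ.continuous).integrable_of_hasCompactSupport cdφ.mul_left)
      (fun x _ => hu.differentiable (by norm_num) x) (fun x _ => dφ.differentiable (by norm_num) x),
      integral_mul_fderiv_eq_neg_fderiv_mul_of_integrable
      ((c2.mul hφ.continuous).integrable_of_hasCompactSupport hc.mul_left)
      ((du.continuous.mul dφ.continuous).integrable_of_hasCompactSupport cdφ.mul_left)
      ((du.continuous.mul hφ.continuous).integrable_of_hasCompactSupport hc.mul_left)
      (fun x _ => du.differentiable (by norm_num) x) (fun x _ => hφ.differentiable (by norm_num) x), neg_neg]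
  unfold lap
  simp only [Finset.mul_sum, Finset.sum_mul]
  rw [integral_finsetSum, integral_finsetSum]
  · exact Finset.sum_congr rfl fun i _ => key i
  · intro i _
    have du := contDiff_fderiv_apply hu (EuclideanSpace.single i 1)
    exact ((((du.fderiv_right (m := 0) (by norm_num)).clm_apply
      contDiff_const).continuous).mul hφ.continuous).integrable_of_hasCompactSupport hc.mul_left
  · intro i _
    have dφ := contDiff_fderiv_apply hφ (EuclideanSpace.single i 1)
    exact (hu.continuous.mul ((dφ.fderiv_right (m := 0) (by norm_num)).clm_apply
      contDiff_const).continuous).integrable_of_hasCompactSupport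
      (((hc.fderiv_apply (𝕜 := ℝ) _).fderiv_apply (𝕜 := ℝ) _).mul_left)

end Laplacian

section Gaussian

variable {n : ℕ}

/-- The heat kernel at time `σ`, as a function of the squared distance `q`. -/
noncomputable def heatK (n : ℕ) (σ q : ℝ) : ℝ :=
  (4 * Real.pi * σ) ^ (-(n : ℝ) / 2) * Real.exp (-(q / (4 * σ)))

lemma heatK_pos {σ : ℝ} (hσ : 0 < σ) (q : ℝ) : 0 < heatK n σ q := by
  unfold heatK
  have := Real.pi_pos
  positivity

lemma continuous_heatK (σ : ℝ) : Continuous (heatK n σ) := by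
  unfold heatK; fun_prop

lemma hasDerivAt_heatK_right (σ q : ℝ) :
    HasDerivAt (heatK n σ) (-(1 / (4 * σ)) * heatK n σ q) q := by
  unfold heatK
  have h : HasDerivAt (fun q : ℝ => -(q / (4 * σ))) (-(1 / (4 * σ))) q :=
    ((hasDerivAt_id q).div_const (4 * σ)).neg
  refine (h.exp.const_mul ((4 * Real.pi * σ) ^ (-(n : ℝ) / 2))).congr_deriv ?_
  ring

lemma hasDerivAt_heatK_left {σ : ℝ} (hσ : 0 < σ) (q : ℝ) :
    HasDerivAt (fun s => heatK n s q)
      ((-(n : ℝ) / (2 * σ) + q / (4 * σ ^ 2)) * heatK n σ q) σ := by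
  unfold heatK
  have hpi := Real.pi_pos
  have h0 : 0 < 4 * Real.pi * σ := by positivity
  have h1 : HasDerivAt (fun s : ℝ => 4 * Real.pi * s) (4 * Real.pi) σ := by
    simpa using (hasDerivAt_id σ).const_mul (4 * Real.pi)
  have h2 := h1.rpow_const (p := -(n : ℝ) / 2) (Or.inl h0.ne')
  have h3 : HasDerivAt (fun s : ℝ => -(q / (4 * s))) (q / (4 * σ ^ 2)) σ := by
    have h4 : HasDerivAt (fun s : ℝ => 4 * s) 4 σ := by
      simpa using (hasDerivAt_id σ).const_mul (4 : ℝ)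
    have h5 := ((hasDerivAt_const σ q).fun_div h4 (by positivity)).neg
    refine h5.congr_deriv ?_
    field_simp
    ring
  refine (h2.mul h3.exp).congr_deriv ?_
  rw [Real.rpow_sub_one h0.ne']
  field_simp

lemma integrable_exp_neg_mul_norm_sq {b : ℝ} (hb : 0 < b) :
    Integrable fun z : Eu n => Real.exp (-b * ‖z‖ ^ 2) := by
  by_contra h
  have h1 := GaussianFourier.integral_rexp_neg_mul_sq_norm (V := Eu n) hb
  rw [integral_undef h] at h1
  have := Real.pi_pos
  have : 0 < (Real.pi / b) ^ (Module.finrank ℝ (Eu n) / 2 : ℝ) := by positivity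
  linarith

lemma integral_heatK {σ : ℝ} (hσ : 0 < σ) : ∫ z : Eu n, heatK n σ (‖z‖ ^ 2) = 1 := by
  have hpi := Real.pi_pos
  have hb : (0 : ℝ) < 1 / (4 * σ) := by positivity
  have h1 := GaussianFourier.integral_rexp_neg_mul_sq_norm (V := Eu n) hb
  unfold heatK
  rw [integral_const_mul]
  have : ∀ z : Eu n, Real.exp (-(‖z‖ ^ 2 / (4 * σ))) = Real.exp (-(1 / (4 * σ)) * ‖z‖ ^ 2) := by
    intro z; congr 1; ring
  simp only [this, h1]
  have e : Real.pi / (1 / (4 * σ)) = 4 * Real.pi * σ := by field_simp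
  rw [e, ← Real.rpow_add (by positivity), finrank_euclideanSpace_fin]
  rw [show -(n : ℝ) / 2 + n / 2 = 0 by ring, Real.rpow_zero]

lemma pow_le_exp_mul (k : ℕ) {c x : ℝ} (hc : 0 < c) (hx : 0 ≤ x) :
    x ^ k ≤ (k.factorial / c ^ k) * Real.exp (c * x) := by
  have h := Real.pow_div_factorial_le_exp (c * x) (by positivity) k
  rw [div_le_iff₀ (by positivity), mul_pow] at h
  rw [div_mul_eq_mul_div, le_div_iff₀ (by positivity)]
  linarith

lemma integrable_norm_pow_mul_exp (k : ℕ) {b : ℝ} (hb : 0 < b) :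
    Integrable fun z : Eu n => ‖z‖ ^ k * Real.exp (-b * ‖z‖ ^ 2) := by
  have hi := (integrable_exp_neg_mul_norm_sq (n := n) (b := b / 2) (by positivity)).const_mul
    (1 + k.factorial / (b / 2) ^ k)
  refine hi.mono' (by fun_prop) (Eventually.of_forall fun z => ?_)
  rw [Real.norm_of_nonneg (by positivity)]
  have h1 := pow_le_exp_mul k (c := b / 2) (x := ‖z‖ ^ 2) (by positivity) (by positivity)
  have h2 : ‖z‖ ^ k ≤ 1 + (‖z‖ ^ 2) ^ k := by
    have : (‖z‖ ^ 2) ^ k = (‖z‖ ^ k) ^ 2 := by ring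
    rw [this]; nlinarith [sq_nonneg (‖z‖ ^ k - 1)]
  have h3 : (1 : ℝ) ≤ Real.exp (b / 2 * ‖z‖ ^ 2) := Real.one_le_exp (by positivity)
  have e : Real.exp (-b * ‖z‖ ^ 2)
      = Real.exp (-(b / 2) * ‖z‖ ^ 2) * Real.exp (-(b / 2 * ‖z‖ ^ 2)) := by
    rw [← Real.exp_add]; ring_nf
  have e2 : Real.exp (b / 2 * ‖z‖ ^ 2) * Real.exp (-(b / 2 * ‖z‖ ^ 2)) = 1 := by
    rw [← Real.exp_add]; simp
  have h4 : ‖z‖ ^ k ≤ (1 + k.factorial / (b / 2) ^ k) * Real.exp (b / 2 * ‖z‖ ^ 2) := by linarith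
  calc ‖z‖ ^ k * Real.exp (-b * ‖z‖ ^ 2)
      ≤ (1 + k.factorial / (b / 2) ^ k) * Real.exp (b / 2 * ‖z‖ ^ 2)
        * Real.exp (-b * ‖z‖ ^ 2) := by gcongr
    _ = (1 + k.factorial / (b / 2) ^ k) * Real.exp (-(b / 2) * ‖z‖ ^ 2)
        * (Real.exp (b / 2 * ‖z‖ ^ 2) * Real.exp (-(b / 2 * ‖z‖ ^ 2))) := by rw [e]; ring
    _ = _ := by rw [e2, mul_one]

/-- The heat kernel at time `1` as a measure on Euclidean space. -/
noncomputable def gam (n : ℕ) : Measure (Eu n) :=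
  volume.withDensity fun z => ENNReal.ofReal (heatK n 1 (‖z‖ ^ 2))

lemma continuous_heatK_norm (σ : ℝ) : Continuous fun z : Eu n => heatK n σ (‖z‖ ^ 2) :=
  (continuous_heatK σ).comp (by fun_prop)

lemma integral_gam {F : Type*} [NormedAddCommGroup F] [NormedSpace ℝ F] (f : Eu n → F) :
    ∫ z, f z ∂(gam n) = ∫ z, heatK n 1 (‖z‖ ^ 2) • f z := by
  unfold gam
  rw [integral_withDensity_eq_integral_toReal_smul
    (by exact (continuous_heatK_norm 1).measurable.ennreal_ofReal) (by simp)]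
  simp [ENNReal.toReal_ofReal (heatK_pos one_pos _).le]

lemma integrable_gam_iff {F : Type*} [NormedAddCommGroup F] [NormedSpace ℝ F] {f : Eu n → F} :
    Integrable f (gam n) ↔ Integrable fun z => heatK n 1 (‖z‖ ^ 2) • f z := by
  unfold gam
  rw [integrable_withDensity_iff_integrable_smul'
    (by exact (continuous_heatK_norm 1).measurable.ennreal_ofReal) (by simp)]
  simp [ENNReal.toReal_ofReal (heatK_pos one_pos _).le]

lemma integrable_heatK {σ : ℝ} (hσ : 0 < σ) :
    Integrable fun z : Eu n => heatK n σ (‖z‖ ^ 2) := by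
  by_contra h
  have := integral_heatK (n := n) hσ
  rw [integral_undef h] at this
  norm_num at this

instance : IsProbabilityMeasure (gam n) := by
  constructor
  unfold gam
  rw [withDensity_apply _ MeasurableSet.univ, Measure.restrict_univ,
    ← ofReal_integral_eq_lintegral_ofReal (integrable_heatK one_pos)
      (Eventually.of_forall fun z => (heatK_pos one_pos _).le), integral_heatK one_pos]
  simp

lemma integrable_norm_pow_gam (k : ℕ) : Integrable (fun z : Eu n => ‖z‖ ^ k) (gam n) := by
  rw [integrable_gam_iff]
  have := (integrable_norm_pow_mul_exp (n := n) k (b := 1 / 4) (by norm_num)).const_mul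
    ((4 * Real.pi * 1) ^ (-(n : ℝ) / 2))
  refine this.congr (Eventually.of_forall fun z => ?_)
  simp only [heatK, smul_eq_mul]
  rw [show -(‖z‖ ^ 2 / (4 * 1)) = -(1 / 4) * ‖z‖ ^ 2 by ring]
  ring

lemma heatK_scale {σ : ℝ} (hσ : 0 < σ) (q : ℝ) :
    heatK n σ (σ * q) = (√σ ^ n)⁻¹ * heatK n 1 q := by
  have hpi := Real.pi_pos
  unfold heatK
  rw [Real.mul_rpow (by positivity) hσ.le, mul_one, mul_one]
  have e : σ ^ (-(n : ℝ) / 2) = (√σ ^ n)⁻¹ := by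
    rw [Real.sqrt_eq_rpow, ← Real.rpow_natCast, ← Real.rpow_mul hσ.le, ← Real.rpow_neg hσ.le]
    congr 1; ring
  rw [e]
  have : σ * q / (4 * σ) = q / 4 := by field_simp
  rw [this]; ring

lemma integral_heatK_mul {σ : ℝ} (hσ : 0 < σ) (f : Eu n → ℝ) :
    ∫ y : Eu n, heatK n σ (‖y‖ ^ 2) * f y = ∫ z, f (√σ • z) ∂(gam n) := by
  have h := Measure.integral_comp_smul (μ := (volume : Measure (Eu n)))
    (fun y : Eu n => heatK n σ (‖y‖ ^ 2) * f y) (√σ)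
  have hs : 0 < √σ := Real.sqrt_pos.2 hσ
  rw [integral_gam]
  have e : ∀ z : Eu n, heatK n σ (‖√σ • z‖ ^ 2) * f (√σ • z)
      = (√σ ^ n)⁻¹ * (heatK n 1 (‖z‖ ^ 2) * f (√σ • z)) := by
    intro z
    rw [norm_smul, mul_pow, Real.norm_of_nonneg hs.le, Real.sq_sqrt hσ.le, heatK_scale hσ, mul_assoc]
  simp only [e] at h
  rw [integral_const_mul, finrank_euclideanSpace_fin, abs_of_pos (by positivity), smul_eq_mul] at h
  have := mul_left_cancel₀ (by positivity) h
  simpa [smul_eq_mul] using this.symm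

end Gaussian

section WeakSolutions

variable {n : ℕ}

/-- `w` is a bounded weak solution of `∂ₜ w = Δ w + f` on the cylinder with base
`closedBall 0 R` and time interval `[t₀, t₁]`. -/
structure WeakCyl (w f : Eu n → ℝ → ℝ) (R t₀ t₁ : ℝ) : Prop where
  contx : ∀ t, Continuous fun y => w y t
  contt : ∀ y, Continuous (w y)
  contf : ∀ t, Continuous fun y => f y t
  bdd : ∃ M, ∀ y ∈ Metric.closedBall (0 : Eu n) R, ∀ t ∈ Icc t₀ t₁, |w y t| ≤ M
  bddf : ∃ M, ∀ y ∈ Metric.closedBall (0 : Eu n) R, ∀ t ∈ Icc t₀ t₁, |f y t| ≤ M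
  weak : ∀ t ∈ Ioo t₀ t₁, ∀ φ : Eu n → ℝ, ContDiff ℝ 2 φ →
    tsupport φ ⊆ Metric.closedBall 0 R →
    HasDerivAt (fun s => ∫ y, w y s * φ y) (∫ y, (w y t * lap φ y + f y t * φ y)) t

lemma WeakCyl.mono {w f : Eu n → ℝ → ℝ} {R t₀ t₁ R' s₀ s₁ : ℝ} (h : WeakCyl w f R t₀ t₁)
    (hR : R' ≤ R) (h0 : t₀ ≤ s₀) (h1 : s₁ ≤ t₁) : WeakCyl w f R' s₀ s₁ := by
  have hb : Metric.closedBall (0 : Eu n) R' ⊆ Metric.closedBall 0 R :=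
    Metric.closedBall_subset_closedBall hR
  refine ⟨h.contx, h.contt, h.contf, ?_, ?_, ?_⟩
  · obtain ⟨M, hM⟩ := h.bdd
    exact ⟨M, fun y hy t ht => hM y (hb hy) t ⟨h0.trans ht.1, ht.2.trans h1⟩⟩
  · obtain ⟨M, hM⟩ := h.bddf
    exact ⟨M, fun y hy t ht => hM y (hb hy) t ⟨h0.trans ht.1, ht.2.trans h1⟩⟩
  · exact fun t ht φ hφ hs => h.weak t ⟨h0.trans_lt ht.1, ht.2.trans_le h1⟩ φ hφ (hs.trans hb)

/-- A `C²` radial cutoff profile, as a function of the squared distance, vanishing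
beyond radius `R`. -/
structure Profile (Θ Θ' Θ'' : ℝ → ℝ) (R : ℝ) : Prop where
  d1 : ∀ q, HasDerivAt Θ (Θ' q) q
  d2 : ∀ q, HasDerivAt Θ' (Θ'' q) q
  cont : Continuous Θ''
  z0 : ∀ q, R ^ 2 ≤ q → Θ q = 0
  z1 : ∀ q, R ^ 2 ≤ q → Θ' q = 0
  z2 : ∀ q, R ^ 2 ≤ q → Θ'' q = 0

namespace Profile

variable {Θ Θ' Θ'' : ℝ → ℝ} {R : ℝ}

lemma cont0 (h : Profile Θ Θ' Θ'' R) : Continuous Θ :=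
  continuous_iff_continuousAt.2 fun q => (h.d1 q).continuousAt

lemma cont1 (h : Profile Θ Θ' Θ'' R) : Continuous Θ' :=
  continuous_iff_continuousAt.2 fun q => (h.d2 q).continuousAt

lemma contDiff (h : Profile Θ Θ' Θ'' R) : ContDiff ℝ 2 Θ := by
  have e1 : deriv Θ = Θ' := funext fun q => (h.d1 q).deriv
  have e2 : deriv Θ' = Θ'' := funext fun q => (h.d2 q).deriv
  have h1 : ContDiff ℝ 1 Θ' :=
    contDiff_one_iff_deriv.2 ⟨fun q => (h.d2 q).differentiableAt, e2 ▸ h.cont⟩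
  rw [show (2 : WithTop ℕ∞) = 1 + 1 by norm_num, contDiff_succ_iff_deriv]
  exact ⟨fun q => (h.d1 q).differentiableAt, by simp, e1 ▸ h1⟩

end Profile

lemma sq_le_norm_sq_of_notMem {y : Eu n} {R : ℝ} (hR : 0 ≤ R)
    (hy : y ∉ Metric.closedBall (0 : Eu n) R) : R ^ 2 ≤ ‖y‖ ^ 2 := by
  rw [mem_closedBall_zero_iff, not_le] at hy
  gcongr

lemma tsupport_subset_closedBall {φ : Eu n → ℝ} {R : ℝ}
    (h : ∀ y, y ∉ Metric.closedBall (0 : Eu n) R → φ y = 0) :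
    tsupport φ ⊆ Metric.closedBall 0 R :=
  closure_minimal (fun y hy => by by_contra hn; exact hy (h y hn)) Metric.isClosed_closedBall

/-- Differentiating `∫ w(·,t) ψ(·,t)` for a time dependent test function. -/
lemma hasDerivAt_integral_mul {w : Eu n → ℝ → ℝ} {ψ ψ' : ℝ → Eu n → ℝ} {R t₀ t₁ r M C L : ℝ}
    (hr : r ∈ Ioo t₀ t₁) (hcx : ∀ t, Continuous fun y => w y t) (hct : ∀ y, Continuous (w y))
    (hM : ∀ y ∈ Metric.closedBall (0 : Eu n) R, ∀ t ∈ Icc t₀ t₁, |w y t| ≤ M)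
    (hψ : ∀ s, Continuous (ψ s))
    (hz : ∀ s y, y ∉ Metric.closedBall (0 : Eu n) R → ψ s y = 0)
    (hd : ∀ y, ∀ s ∈ Icc t₀ t₁, HasDerivAt (fun s => ψ s y) (ψ' s y) s)
    (hC : ∀ y ∈ Metric.closedBall (0 : Eu n) R, ∀ s ∈ Icc t₀ t₁, |ψ' s y| ≤ C)
    (hL : HasDerivAt (fun s => ∫ y, w y s * ψ r y) L r) :
    HasDerivAt (fun s => ∫ y, w y s * ψ s y) (L + ∫ y, w y r * ψ' r y) r := by
  have hri : r ∈ Icc t₀ t₁ := Ioo_subset_Icc_self hr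
  have hnear : ∀ᶠ s in 𝓝 r, s ∈ Icc t₀ t₁ := Icc_mem_nhds hr.1 hr.2
  have hlip : ∀ y ∈ Metric.closedBall (0 : Eu n) R, ∀ s ∈ Icc t₀ t₁,
      |ψ s y - ψ r y| ≤ C * |s - r| := by
    intro y hy s hs
    exact (convex_Icc t₀ t₁).norm_image_sub_le_of_norm_hasDerivWithin_le
      (f := fun s => ψ s y) (f' := fun s => ψ' s y)
      (fun x hx => (hd y x hx).hasDerivWithinAt) (fun x hx => hC y hy x hx) hri hs
  have hinteg : ∀ s ∈ Icc t₀ t₁, ∀ s', Integrable fun y => w y s * ψ s' y := by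
    intro s hs s'
    have : HasCompactSupport (fun y => w y s * ψ s' y) := by
      refine HasCompactSupport.intro (isCompact_closedBall (0 : Eu n) R) fun y hy => ?_
      rw [hz s' y hy, mul_zero]
    exact ((hcx s).mul (hψ s')).integrable_of_hasCompactSupport this
  have hD : HasDerivAt (fun s => ∫ y, w y s * (ψ s y - ψ r y)) (∫ y, w y r * ψ' r y) r := by
    rw [hasDerivAt_iff_tendsto_slope]
    have hsl : ∀ s, slope (fun s => ∫ y, w y s * (ψ s y - ψ r y)) r s
        = ∫ y, w y s * ((s - r)⁻¹ * (ψ s y - ψ r y)) := by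
      intro s
      rw [slope_def_field]
      simp only [sub_self, mul_zero, integral_zero, sub_zero]
      rw [div_eq_inv_mul, ← integral_const_mul]
      congr 1; funext y; ring
    rw [tendsto_congr hsl]
    refine tendsto_integral_filter_of_dominated_convergence
      ((Metric.closedBall (0 : Eu n) R).indicator fun _ => M * C) ?_ ?_ ?_ ?_
    · exact Eventually.of_forall fun s =>
        ((hcx s).mul (continuous_const.mul ((hψ s).sub (hψ r)))).aestronglyMeasurable
    · filter_upwards [nhdsWithin_le_nhds hnear, self_mem_nhdsWithin] with s hs hne
      refine Eventually.of_forall fun y => ?_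
      by_cases hy : y ∈ Metric.closedBall (0 : Eu n) R
      · rw [indicator_of_mem hy, norm_mul]
        have hne' : 0 < |s - r| := abs_pos.2 (sub_ne_zero.2 hne)
        have h2 : ‖(s - r)⁻¹ * (ψ s y - ψ r y)‖ ≤ C := by
          rw [norm_mul, norm_inv, Real.norm_eq_abs, Real.norm_eq_abs, inv_mul_le_iff₀ hne']
          linarith [hlip y hy s hs]
        have h3 : ‖w y s‖ ≤ M := hM y hy s hs
        exact mul_le_mul h3 h2 (norm_nonneg _) ((norm_nonneg _).trans h3)
      · rw [indicator_of_notMem hy, hz s y hy, hz r y hy]; simp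
    · exact (integrable_indicator_iff Metric.isClosed_closedBall.measurableSet).2
        (integrableOn_const measure_closedBall_lt_top.ne)
    · refine Eventually.of_forall fun y => ?_
      refine (((hct y).tendsto r).mono_left nhdsWithin_le_nhds).mul ?_
      have := hasDerivAt_iff_tendsto_slope.1 (hd y r hri)
      refine this.congr fun s => ?_
      rw [slope_def_field, div_eq_inv_mul]
  refine (hL.add hD).congr_of_eventuallyEq ?_
  filter_upwards [hnear] with s hs
  simp only [Pi.add_apply]
  rw [← integral_add (hinteg s hs r)]
  · congr 1; funext y; ring
  · simp only [mul_sub]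
    exact (hinteg s hs s).sub (hinteg s hs r)

lemma continuousOn_integral_mul {w : Eu n → ℝ → ℝ} {ψ : ℝ → Eu n → ℝ} {R t₀ t₁ M C : ℝ}
    (hcx : ∀ t, Continuous fun y => w y t) (hct : ∀ y, Continuous (w y))
    (hM : ∀ y ∈ Metric.closedBall (0 : Eu n) R, ∀ t ∈ Icc t₀ t₁, |w y t| ≤ M)
    (hψ : ∀ s, Continuous (ψ s))
    (hz : ∀ s y, y ∉ Metric.closedBall (0 : Eu n) R → ψ s y = 0)
    (hd : ∀ y, ContinuousOn (fun s => ψ s y) (Icc t₀ t₁))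
    (hC : ∀ y ∈ Metric.closedBall (0 : Eu n) R, ∀ s ∈ Icc t₀ t₁, |ψ s y| ≤ C) :
    ContinuousOn (fun s => ∫ y, w y s * ψ s y) (Icc t₀ t₁) := by
  refine continuousOn_of_dominated (bound := (Metric.closedBall (0 : Eu n) R).indicator
    fun _ => M * C) ?_ ?_ ?_ ?_
  · exact fun s _ => ((hcx s).mul (hψ s)).aestronglyMeasurable
  · intro s hs
    refine Eventually.of_forall fun y => ?_
    by_cases hy : y ∈ Metric.closedBall (0 : Eu n) R
    · rw [indicator_of_mem hy, norm_mul]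
      have h3 : ‖w y s‖ ≤ M := hM y hy s hs
      exact mul_le_mul h3 (hC y hy s hs) (norm_nonneg _) ((norm_nonneg _).trans h3)
    · rw [indicator_of_notMem hy, hz s y hy]; simp
  · exact (integrable_indicator_iff Metric.isClosed_closedBall.measurableSet).2
      (integrableOn_const measure_closedBall_lt_top.ne)
  · exact Eventually.of_forall fun y => ((hct y).continuousOn).mul (hd y)

/-- The localized, exponentially weighted backward heat kernel with pole at time `T`. -/
noncomputable def testK (n : ℕ) (μ T : ℝ) (Θ : ℝ → ℝ) (s q : ℝ) : ℝ :=
  Real.exp (μ * s) * heatK n (T - s) q * Θ q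

lemma continuousOn_heatK_sub {T t₁ : ℝ} (hT : t₁ < T) (S : Set ℝ) :
    ContinuousOn (fun z : ℝ × ℝ => heatK n (T - z.1) z.2) (Iic t₁ ×ˢ S) := by
  have hpi := Real.pi_pos
  unfold heatK
  refine ContinuousOn.mul ?_ ?_
  · refine ContinuousOn.rpow_const (by fun_prop) fun z hz => Or.inl ?_
    have : 0 < T - z.1 := by have := hz.1; simp only [mem_Iic] at this; linarith
    positivity
  · refine Real.continuous_exp.comp_continuousOn (ContinuousOn.neg ?_)
    refine ContinuousOn.div (by fun_prop) (by fun_prop) fun z hz => ?_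
    have : 0 < T - z.1 := by have := hz.1; simp only [mem_Iic] at this; linarith
    positivity

lemma hasDerivAt_testK_left {μ T s q : ℝ} {Θ : ℝ → ℝ} (hs : s < T) :
    HasDerivAt (fun s => testK n μ T Θ s q)
      (testK n μ T Θ s q * (μ + n / (2 * (T - s)) - q / (4 * (T - s) ^ 2))) s := by
  have hσ : 0 < T - s := by linarith
  have h1 : HasDerivAt (fun s : ℝ => Real.exp (μ * s)) (Real.exp (μ * s) * μ) s := by
    have : HasDerivAt (fun s : ℝ => μ * s) μ s := by simpa using (hasDerivAt_id s).const_mul μ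
    exact this.exp
  have h2 : HasDerivAt (fun s : ℝ => T - s) (-1) s := by simpa using (hasDerivAt_id s).const_sub T
  have h3 := (hasDerivAt_heatK_left (n := n) hσ q).comp s h2
  have h4 := (h1.mul h3).mul_const (Θ q)
  refine h4.congr_deriv ?_
  simp only [testK, Function.comp]
  ring

lemma exists_bound_testK {Θ Θ' Θ'' : ℝ → ℝ} {R μ T t₀ t₁ : ℝ} (hΘ : Profile Θ Θ' Θ'' R)
    (hT : t₁ < T) : ∃ C, ∀ y ∈ Metric.closedBall (0 : Eu n) R, ∀ s ∈ Icc t₀ t₁,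
      |testK n μ T Θ s (‖y‖ ^ 2)| ≤ C ∧
      |testK n μ T Θ s (‖y‖ ^ 2) * (μ + n / (2 * (T - s)) - ‖y‖ ^ 2 / (4 * (T - s) ^ 2))| ≤ C := by
  have hK : IsCompact (Icc t₀ t₁ ×ˢ Icc (0 : ℝ) (R ^ 2)) := isCompact_Icc.prod isCompact_Icc
  have hsub : (Icc t₀ t₁ ×ˢ Icc (0 : ℝ) (R ^ 2)) ⊆ Iic t₁ ×ˢ Icc (0 : ℝ) (R ^ 2) :=
    prod_mono Icc_subset_Iic_self le_rfl
  have hc : ContinuousOn (fun z : ℝ × ℝ => testK n μ T Θ z.1 z.2)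
      (Icc t₀ t₁ ×ˢ Icc (0 : ℝ) (R ^ 2)) := by
    unfold testK
    refine (ContinuousOn.mul (by fun_prop) ((continuousOn_heatK_sub hT _).mono hsub)).mul ?_
    exact (hΘ.cont0.comp continuous_snd).continuousOn
  have hpos : ∀ z ∈ (Icc t₀ t₁ ×ˢ Icc (0 : ℝ) (R ^ 2)), 0 < T - z.1 := fun z hz => by
    linarith [hz.1.2]
  have hc2 : ContinuousOn (fun z : ℝ × ℝ => testK n μ T Θ z.1 z.2 *
      (μ + n / (2 * (T - z.1)) - z.2 / (4 * (T - z.1) ^ 2)))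
      (Icc t₀ t₁ ×ˢ Icc (0 : ℝ) (R ^ 2)) := by
    refine hc.mul ((continuousOn_const.add (ContinuousOn.div (by fun_prop) (by fun_prop) ?_)).sub
      (ContinuousOn.div (by fun_prop) (by fun_prop) ?_))
    · intro z hz; have := hpos z hz; positivity
    · intro z hz; have := hpos z hz; positivity
  obtain ⟨C1, h1⟩ := hK.exists_bound_of_continuousOn hc
  obtain ⟨C2, h2⟩ := hK.exists_bound_of_continuousOn hc2
  refine ⟨max C1 C2, fun y hy s hs => ?_⟩
  have hy' : ‖y‖ ^ 2 ∈ Icc (0 : ℝ) (R ^ 2) := by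
    rw [mem_closedBall_zero_iff] at hy
    exact ⟨by positivity, by gcongr⟩
  exact ⟨(h1 (s, ‖y‖ ^ 2) ⟨hs, hy'⟩).trans (le_max_left _ _),
    (h2 (s, ‖y‖ ^ 2) ⟨hs, hy'⟩).trans (le_max_right _ _)⟩

lemma continuous_testK {Θ : ℝ → ℝ} (hΘ : Continuous Θ) (μ T s : ℝ) :
    Continuous fun y : Eu n => testK n μ T Θ s (‖y‖ ^ 2) := by
  unfold testK
  exact (continuous_const.mul (continuous_heatK_norm _)).mul (hΘ.comp (by fun_prop))

lemma testK_derivs {Θ Θ' Θ'' : ℝ → ℝ} {R : ℝ} (hΘ : Profile Θ Θ' Θ'' R) (μ T s : ℝ) :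
    (∀ q, HasDerivAt (testK n μ T Θ s) (Real.exp (μ * s) * heatK n (T - s) q *
      (Θ' q - 1 / (4 * (T - s)) * Θ q)) q) ∧
    (∀ q, HasDerivAt (fun q => Real.exp (μ * s) * heatK n (T - s) q *
      (Θ' q - 1 / (4 * (T - s)) * Θ q)) (Real.exp (μ * s) * heatK n (T - s) q *
      (Θ'' q - 2 * (1 / (4 * (T - s))) * Θ' q + (1 / (4 * (T - s))) ^ 2 * Θ q)) q) := by
  constructor
  · intro q
    have := ((hasDerivAt_heatK_right (n := n) (T - s) q).const_mul (Real.exp (μ * s))).mul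
      (hΘ.d1 q)
    refine this.congr_deriv ?_
    ring
  · intro q
    have := ((hasDerivAt_heatK_right (n := n) (T - s) q).const_mul (Real.exp (μ * s))).fun_mul
      ((hΘ.d2 q).sub ((hΘ.d1 q).const_mul (1 / (4 * (T - s)))))
    refine this.congr_deriv ?_
    simp only [Pi.sub_apply]
    ring

lemma contDiff_testK {Θ Θ' Θ'' : ℝ → ℝ} {R : ℝ} (hΘ : Profile Θ Θ' Θ'' R) (μ T s : ℝ) :
    ContDiff ℝ 2 (testK n μ T Θ s) := by
  have : ContDiff ℝ 2 (heatK n (T - s)) := by unfold heatK; fun_prop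
  exact (contDiff_const.mul this).mul hΘ.contDiff

/-- The localized energy `∫ w(·,r) ψ(·,r)`. -/
noncomputable def energy (w : Eu n → ℝ → ℝ) (μ T : ℝ) (Θ : ℝ → ℝ) (r : ℝ) : ℝ :=
  ∫ y, w y r * testK n μ T Θ r (‖y‖ ^ 2)

/-- The density of the derivative of the localized energy, without the kernel. -/
noncomputable def dens (n : ℕ) (w f : ℝ) (μ σ : ℝ) (Θ Θ' Θ'' q : ℝ) : ℝ :=
  w * (μ * Θ + 2 * n * Θ' + 4 * q * Θ'' - 2 * (q / σ) * Θ') + f * Θ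

lemma WeakCyl.hasDerivAt_energy {w f : Eu n → ℝ → ℝ} {R t₀ t₁ T μ r : ℝ} {Θ Θ' Θ'' : ℝ → ℝ}
    (h : WeakCyl w f R t₀ t₁) (hR : 0 ≤ R) (hΘ : Profile Θ Θ' Θ'' R) (hT : t₁ < T)
    (hr : r ∈ Ioo t₀ t₁) :
    HasDerivAt (energy w μ T Θ)
      (∫ y : Eu n, Real.exp (μ * r) * heatK n (T - r) (‖y‖ ^ 2) *
        dens n (w y r) (f y r) μ (T - r) (Θ (‖y‖ ^ 2)) (Θ' (‖y‖ ^ 2)) (Θ'' (‖y‖ ^ 2)) (‖y‖ ^ 2))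
      r := by
  obtain ⟨M, hM⟩ := h.bdd
  obtain ⟨C, hC⟩ := exists_bound_testK (n := n) (t₀ := t₀) (μ := μ) hΘ hT
  have hσ : 0 < T - r := by linarith [hr.2]
  have hz : ∀ s (y : Eu n), y ∉ Metric.closedBall (0 : Eu n) R → testK n μ T Θ s (‖y‖ ^ 2) = 0 :=
    fun s y hy => by
      rw [testK, hΘ.z0 _ (sq_le_norm_sq_of_notMem hR hy), mul_zero]
  have hcd := contDiff_radial (n := n) (contDiff_testK (n := n) hΘ μ T r)
  have hs := tsupport_subset_closedBall (hz r)
  have hL := h.weak r hr _ hcd hs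
  have key := hasDerivAt_integral_mul (ψ := fun s y => testK n μ T Θ s (‖y‖ ^ 2))
    (ψ' := fun s y => testK n μ T Θ s (‖y‖ ^ 2) *
      (μ + n / (2 * (T - s)) - ‖y‖ ^ 2 / (4 * (T - s) ^ 2))) (C := C)
    hr h.contx h.contt hM (fun s => continuous_testK hΘ.cont0 μ T s) hz
    (fun y s hs => hasDerivAt_testK_left (hs.2.trans_lt hT))
    (fun y hy s hs => (hC y hy s hs).2) hL
  refine key.congr_deriv ?_
  have hcs : HasCompactSupport fun y : Eu n => testK n μ T Θ r (‖y‖ ^ 2) :=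
    HasCompactSupport.intro (isCompact_closedBall (0 : Eu n) R) (hz r)
  have hi1 : Integrable fun y : Eu n => w y r * lap (fun y => testK n μ T Θ r (‖y‖ ^ 2)) y
      + f y r * testK n μ T Θ r (‖y‖ ^ 2) := by
    refine Integrable.add ?_ ?_
    · refine ((h.contx r).mul (continuous_lap hcd)).integrable_of_hasCompactSupport ?_
      refine HasCompactSupport.intro (isCompact_closedBall (0 : Eu n) R) fun y hy => ?_
      rw [Pi.mul_apply, lap_eq_zero_of_notMem fun hy' => hy (hs hy'), mul_zero]
    · exact ((h.contf r).mul (continuous_testK hΘ.cont0 μ T r)).integrable_of_hasCompactSupport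
        hcs.mul_left
  have hi2 : Integrable fun y : Eu n => w y r * (testK n μ T Θ r (‖y‖ ^ 2) *
      (μ + n / (2 * (T - r)) - ‖y‖ ^ 2 / (4 * (T - r) ^ 2))) := by
    refine Continuous.integrable_of_hasCompactSupport ?_ (hcs.mul_right.mul_left)
    exact (h.contx r).mul ((continuous_testK hΘ.cont0 μ T r).mul (by fun_prop))
  rw [← integral_add hi1 hi2]
  congr 1
  funext y
  rw [lap_radial (testK_derivs hΘ μ T r).1 (testK_derivs hΘ μ T r).2]
  simp only [testK, dens]
  field_simp
  ring

lemma WeakCyl.continuousOn_energy {w f : Eu n → ℝ → ℝ} {R t₀ t₁ T μ : ℝ} {Θ Θ' Θ'' : ℝ → ℝ}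
    (h : WeakCyl w f R t₀ t₁) (hR : 0 ≤ R) (hΘ : Profile Θ Θ' Θ'' R) (hT : t₁ < T) :
    ContinuousOn (energy w μ T Θ) (Icc t₀ t₁) := by
  obtain ⟨M, hM⟩ := h.bdd
  obtain ⟨C, hC⟩ := exists_bound_testK (n := n) (t₀ := t₀) (μ := μ) hΘ hT
  refine continuousOn_integral_mul (ψ := fun s y => testK n μ T Θ s (‖y‖ ^ 2)) (C := C)
    h.contx h.contt hM (fun s => continuous_testK hΘ.cont0 μ T s) ?_ ?_
    (fun y hy s hs => (hC y hy s hs).1)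
  · intro s y hy
    rw [testK, hΘ.z0 _ (sq_le_norm_sq_of_notMem hR hy), mul_zero]
  · exact fun y s hs =>
      (hasDerivAt_testK_left (hs.2.trans_lt hT)).continuousAt.continuousWithinAt

end WeakSolutions

section Estimates

variable {n : ℕ}

lemma norm_sqrt_smul_sq {σ : ℝ} (hσ : 0 ≤ σ) (z : Eu n) : ‖√σ • z‖ ^ 2 = σ * ‖z‖ ^ 2 := by
  rw [norm_smul, mul_pow, Real.norm_of_nonneg (Real.sqrt_nonneg _), Real.sq_sqrt hσ]

lemma energy_eq {w : Eu n → ℝ → ℝ} {μ T r : ℝ} {Θ : ℝ → ℝ} (hr : r < T) :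
    energy w μ T Θ r = Real.exp (μ * r) *
      ∫ z, w (√(T - r) • z) r * Θ ((T - r) * ‖z‖ ^ 2) ∂(gam n) := by
  have hσ : 0 < T - r := by linarith
  have h := integral_heatK_mul (n := n) hσ (fun y => w y r * Θ (‖y‖ ^ 2))
  simp only [norm_sqrt_smul_sq hσ.le] at h
  rw [← h, ← integral_const_mul, energy]
  congr 1; funext y; simp only [testK]; ring

lemma WeakCyl.hasDerivAt_energy' {w f : Eu n → ℝ → ℝ} {R t₀ t₁ T μ r : ℝ} {Θ Θ' Θ'' : ℝ → ℝ}
    (h : WeakCyl w f R t₀ t₁) (hR : 0 ≤ R) (hΘ : Profile Θ Θ' Θ'' R) (hT : t₁ < T)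
    (hr : r ∈ Ioo t₀ t₁) :
    HasDerivAt (energy w μ T Θ) (Real.exp (μ * r) * ∫ z : Eu n,
      dens n (w (√(T - r) • z) r) (f (√(T - r) • z) r) μ (T - r)
        (Θ ((T - r) * ‖z‖ ^ 2)) (Θ' ((T - r) * ‖z‖ ^ 2)) (Θ'' ((T - r) * ‖z‖ ^ 2))
        ((T - r) * ‖z‖ ^ 2) ∂(gam n)) r := by
  have hσ : 0 < T - r := by linarith [hr.2]
  refine (h.hasDerivAt_energy hR hΘ hT hr).congr_deriv ?_
  have h := integral_heatK_mul (n := n) hσ (fun y => dens n (w y r) (f y r) μ (T - r)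
    (Θ (‖y‖ ^ 2)) (Θ' (‖y‖ ^ 2)) (Θ'' (‖y‖ ^ 2)) (‖y‖ ^ 2))
  simp only [norm_sqrt_smul_sq hσ.le] at h
  rw [← h, ← integral_const_mul]
  congr 1; funext y; ring

/-- The value of a localized integral against the heat kernel tends to the value of the
integrand when the width of the kernel does. -/
lemma tendsto_integral_gam {g : Eu n → ℝ} (hg : Continuous g) {M : ℝ} (hM : ∀ y, |g y| ≤ M)
    {σ₀ : ℝ} (s : Set ℝ) :
    Tendsto (fun σ : ℝ => ∫ z, g (√σ • z) ∂(gam n)) (𝓝[s] σ₀)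
      (𝓝 (∫ z, g (√σ₀ • z) ∂(gam n))) := by
  refine tendsto_integral_filter_of_dominated_convergence (fun _ => M) ?_ ?_
    (integrable_const M) ?_
  · exact Eventually.of_forall fun σ => (hg.comp (by fun_prop)).aestronglyMeasurable
  · exact Eventually.of_forall fun σ => Eventually.of_forall fun z => hM _
  · refine Eventually.of_forall fun z => ?_
    have : Continuous fun σ : ℝ => g (√σ • z) := hg.comp (by fun_prop)
    exact (this.tendsto σ₀).mono_left nhdsWithin_le_nhds

lemma exists_bound_mul_profile {w : Eu n → ℝ → ℝ} {R t₀ t₁ M : ℝ} {Θ Θ' Θ'' : ℝ → ℝ}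
    (hR : 0 ≤ R) (hΘ : Profile Θ Θ' Θ'' R) (hM : ∀ y ∈ Metric.closedBall (0 : Eu n) R,
      ∀ t ∈ Icc t₀ t₁, |w y t| ≤ M) {t : ℝ} (ht : t ∈ Icc t₀ t₁) :
    ∃ C, ∀ y : Eu n, |w y t * Θ (‖y‖ ^ 2)| ≤ C := by
  obtain ⟨C, hC⟩ := isCompact_Icc.exists_bound_of_continuousOn
    (s := Icc 0 (R ^ 2)) hΘ.cont0.continuousOn
  have hM0 : 0 ≤ M := (abs_nonneg _).trans (hM 0 (by simpa using hR) t ht)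
  have hC0 : 0 ≤ C := (norm_nonneg _).trans (hC 0 ⟨le_rfl, by positivity⟩)
  refine ⟨M * C, fun y => ?_⟩
  by_cases hy : y ∈ Metric.closedBall (0 : Eu n) R
  · have h1 := hM y hy t ht
    rw [mem_closedBall_zero_iff] at hy
    have h2 := hC (‖y‖ ^ 2) ⟨by positivity, by gcongr⟩
    rw [abs_mul]
    exact mul_le_mul h1 h2 (abs_nonneg _) hM0
  · rw [hΘ.z0 _ (sq_le_norm_sq_of_notMem hR hy)]
    simpa using mul_nonneg hM0 hC0

lemma WeakCyl.tendsto_energy {w f : Eu n → ℝ → ℝ} {R t₀ t₁ μ : ℝ} {Θ Θ' Θ'' : ℝ → ℝ}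
    (h : WeakCyl w f R t₀ t₁) (hR : 0 ≤ R) (h01 : t₀ ≤ t₁) (hΘ : Profile Θ Θ' Θ'' R) :
    Tendsto (fun T => energy w μ T Θ t₁) (𝓝[>] t₁) (𝓝 (Real.exp (μ * t₁) * (w 0 t₁ * Θ 0))) := by
  obtain ⟨M, hM⟩ := h.bdd
  obtain ⟨C, hC⟩ := exists_bound_mul_profile hR hΘ hM (right_mem_Icc.2 h01)
  have hg : Continuous fun y : Eu n => w y t₁ * Θ (‖y‖ ^ 2) :=
    (h.contx t₁).mul (hΘ.cont0.comp (by fun_prop))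
  have h1 := tendsto_integral_gam hg hC (σ₀ := 0) (Ioi 0)
  have h2 : Tendsto (fun T => T - t₁) (𝓝[>] t₁) (𝓝[>] 0) := by
    refine tendsto_nhdsWithin_iff.2 ⟨?_, ?_⟩
    · have : Continuous fun T : ℝ => T - t₁ := by fun_prop
      simpa using (this.tendsto t₁).mono_left nhdsWithin_le_nhds
    · filter_upwards [self_mem_nhdsWithin] with T hT
      simpa using hT
  have h3 := (h1.comp h2).const_mul (Real.exp (μ * t₁))
  simp only [Real.sqrt_zero, zero_smul, norm_zero, ne_eq, OfNat.ofNat_ne_zero, not_false_eq_true,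
    zero_pow, integral_const, probReal_univ, smul_eq_mul, one_mul] at h3
  refine h3.congr' ?_
  filter_upwards [self_mem_nhdsWithin] with T hT
  rw [energy_eq hT]
  simp only [Function.comp]
  have : 0 ≤ T - t₁ := by have := mem_Ioi.1 hT; linarith
  simp only [norm_sqrt_smul_sq this]

/-! ### The polynomial cutoff -/

/-- Powers of the positive part. -/
noncomputable def pp (k : ℕ) (x : ℝ) : ℝ := max x 0 ^ k

lemma continuous_pp (k : ℕ) : Continuous (pp k) := by unfold pp; fun_prop

lemma pp_nonneg (k : ℕ) (x : ℝ) : 0 ≤ pp k x := by unfold pp; positivity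

lemma pp_eq_zero {k : ℕ} (hk : k ≠ 0) {x : ℝ} (hx : x ≤ 0) : pp k x = 0 := by
  simp [pp, hx, hk]

lemma hasDerivAt_pp (k : ℕ) (x : ℝ) : HasDerivAt (pp (k + 2)) ((k + 2) * pp (k + 1) x) x := by
  rcases lt_trichotomy x 0 with hx | hx | hx
  · rw [pp_eq_zero (by omega) hx.le, mul_zero]
    refine (hasDerivAt_const x (0 : ℝ)).congr_of_eventuallyEq ?_
    filter_upwards [Iio_mem_nhds hx] with y hy
    exact pp_eq_zero (by omega) (le_of_lt hy)
  · subst hx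
    rw [pp_eq_zero (by omega) le_rfl, mul_zero, hasDerivAt_iff_isLittleO]
    have h0 : pp (k + 2) 0 = 0 := pp_eq_zero (by omega) le_rfl
    simp only [h0, sub_zero, smul_zero]
    have h1 : (pp (k + 2)) =O[𝓝 0] fun x : ℝ => x ^ 2 := by
      refine Asymptotics.IsBigO.of_bound 1 ?_
      filter_upwards [Metric.ball_mem_nhds (0 : ℝ) one_pos] with y hy
      rw [Metric.mem_ball, dist_zero_right, Real.norm_eq_abs] at hy
      rw [Real.norm_of_nonneg (pp_nonneg _ _), Real.norm_of_nonneg (sq_nonneg y), one_mul, pp,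
        pow_add, ← sq_abs y]
      have h2 : max y 0 ≤ |y| := max_le (le_abs_self y) (abs_nonneg y)
      have h3 : (0 : ℝ) ≤ max y 0 := le_max_right _ _
      have h4 : max y 0 ^ k ≤ 1 := pow_le_one₀ h3 (h2.trans hy.le)
      calc max y 0 ^ k * max y 0 ^ 2 ≤ 1 * |y| ^ 2 := by gcongr
        _ = _ := one_mul _
    refine h1.trans_isLittleO ?_
    exact Asymptotics.isLittleO_pow_id one_lt_two
  · have h1 : HasDerivAt (fun y : ℝ => y ^ (k + 2)) ((k + 2) * x ^ (k + 1)) x := by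
      simpa using hasDerivAt_pow (k + 2) x
    have h2 : pp (k + 1) x = x ^ (k + 1) := by rw [pp, max_eq_left hx.le]
    rw [h2]
    refine h1.congr_of_eventuallyEq ?_
    filter_upwards [Ioi_mem_nhds hx] with y hy
    rw [pp, max_eq_left (le_of_lt hy)]

/-- The polynomial cutoff profile of radius `R`. -/
noncomputable def cut (R q : ℝ) : ℝ := pp 4 (1 - q / R ^ 2)

/-- The derivative of the polynomial cutoff profile. -/
noncomputable def cut' (R q : ℝ) : ℝ := -(4 / R ^ 2) * pp 3 (1 - q / R ^ 2)

/-- The second derivative of the polynomial cutoff profile. -/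
noncomputable def cut'' (R q : ℝ) : ℝ := 12 / R ^ 4 * pp 2 (1 - q / R ^ 2)

lemma profile_cut {R : ℝ} (hR : 0 < R) : Profile (cut R) (cut' R) (cut'' R) R := by
  have hin : ∀ q, HasDerivAt (fun q : ℝ => 1 - q / R ^ 2) (-(1 / R ^ 2)) q := fun q =>
    ((hasDerivAt_id q).div_const (R ^ 2)).const_sub 1
  have hle : ∀ q, R ^ 2 ≤ q → 1 - q / R ^ 2 ≤ 0 := fun q hq => by
    rw [sub_nonpos, le_div_iff₀ (by positivity)]; linarith
  refine ⟨fun q => ?_, fun q => ?_, ?_, fun q hq => ?_, fun q hq => ?_, fun q hq => ?_⟩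
  · refine ((hasDerivAt_pp 2 (1 - q / R ^ 2)).comp q (hin q)).congr_deriv ?_
    simp only [cut']; push_cast; ring
  · refine (((hasDerivAt_pp 1 (1 - q / R ^ 2)).comp q (hin q)).const_mul (-(4 / R ^ 2))).congr_deriv
      ?_
    simp only [cut'']; push_cast; field_simp; ring
  · unfold cut''
    exact continuous_const.mul ((continuous_pp 2).comp (by fun_prop))
  · exact pp_eq_zero (by norm_num) (hle q hq)
  · rw [cut', pp_eq_zero (by norm_num) (hle q hq), mul_zero]
  · rw [cut'', pp_eq_zero (by norm_num) (hle q hq), mul_zero]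

lemma pp_le_one {k : ℕ} {x : ℝ} (hx : x ≤ 1) : pp k x ≤ 1 :=
  pow_le_one₀ (le_max_right _ _) (max_le hx zero_le_one)

lemma one_sub_le_one {R q : ℝ} (hq : 0 ≤ q) : 1 - q / R ^ 2 ≤ 1 := by
  have : 0 ≤ q / R ^ 2 := by positivity
  linarith

lemma cut_nonneg (R q : ℝ) : 0 ≤ cut R q := pp_nonneg _ _

lemma cut_le_one {R q : ℝ} (hq : 0 ≤ q) : cut R q ≤ 1 := pp_le_one (one_sub_le_one hq)

lemma cut_zero (R : ℝ) : cut R 0 = 1 := by simp [cut, pp]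

lemma cut'_nonpos (R q : ℝ) : cut' R q ≤ 0 := by
  have := pp_nonneg 3 (1 - q / R ^ 2)
  rw [cut', neg_mul, neg_nonpos]; positivity

lemma abs_cut'_le {R q : ℝ} (hq : 0 ≤ q) : |cut' R q| ≤ 4 / R ^ 2 := by
  rw [cut', abs_mul, abs_neg, abs_of_nonneg (by positivity : (0 : ℝ) ≤ 4 / R ^ 2),
    abs_of_nonneg (pp_nonneg _ _)]
  exact mul_le_of_le_one_right (by positivity) (pp_le_one (one_sub_le_one hq))

lemma abs_mul_cut''_le {R q : ℝ} (hR : 0 < R) (hq : 0 ≤ q) : |q * cut'' R q| ≤ 12 / R ^ 2 := by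
  have h0 := pp_nonneg 2 (1 - q / R ^ 2)
  rw [cut'', abs_of_nonneg (by positivity)]
  rcases le_total (R ^ 2) q with h | h
  · rw [pp_eq_zero (by norm_num) (by rw [sub_nonpos, le_div_iff₀ (by positivity)]; linarith)]
    simp; positivity
  · have h1 := pp_le_one (k := 2) (one_sub_le_one (R := R) hq)
    calc q * (12 / R ^ 4 * pp 2 (1 - q / R ^ 2)) ≤ R ^ 2 * (12 / R ^ 4 * 1) := by gcongr
      _ = _ := by field_simp

lemma one_sub_cut_le {R q : ℝ} (hq : 0 ≤ q) : 1 - cut R q ≤ 4 * q / R ^ 2 := by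
  have h1 : 0 ≤ q / R ^ 2 := by positivity
  rw [mul_div_assoc, cut, pp]
  set s := q / R ^ 2
  rcases le_total s 1 with h | h
  · have h2 := one_add_mul_le_pow (by linarith : -2 ≤ -s) 4
    rw [max_eq_left (by linarith), sub_eq_add_neg]
    push_cast at h2
    linarith
  · have h3 : (0 : ℝ) ≤ max (1 - s) 0 ^ 4 := by positivity
    linarith

end Estimates

section Estimates

variable {n : ℕ}

lemma dens_cut_nonneg {R q σ w f : ℝ} (hR : 0 < R) (hq : 0 ≤ q) (hσ : 0 < σ) (hw : 0 ≤ w)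
    (hf : 0 ≤ f) :
    0 ≤ dens n w f ((n + 6) ^ 2 / (3 * R ^ 2)) σ (cut R q) (cut' R q) (cut'' R q) q := by
  unfold dens
  have h1 : 0 ≤ f * cut R q := mul_nonneg hf (cut_nonneg R q)
  have h2 : 0 ≤ -(2 * (q / σ) * cut' R q) := by
    rw [← mul_neg]
    exact mul_nonneg (by positivity) (neg_nonneg.2 (cut'_nonpos R q))
  have h3 : 0 ≤ (n + 6) ^ 2 / (3 * R ^ 2) * cut R q + 2 * n * cut' R q + 4 * q * cut'' R q := by
    unfold cut cut' cut''
    rcases le_total (R ^ 2) q with h | h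
    · have : 1 - q / R ^ 2 ≤ 0 := by rw [sub_nonpos, le_div_iff₀ (by positivity)]; linarith
      rw [pp_eq_zero (by norm_num) this, pp_eq_zero (by norm_num) this,
        pp_eq_zero (by norm_num) this]
      simp
    · have h4 : 0 ≤ 1 - q / R ^ 2 := by rw [sub_nonneg, div_le_one (by positivity)]; exact h
      simp only [pp, max_eq_left h4]
      obtain ⟨s, hs⟩ : ∃ s, s = 1 - q / R ^ 2 := ⟨_, rfl⟩
      have hq' : q = R ^ 2 * (1 - s) := by rw [hs]; field_simp; ring
      rw [← hs, hq']
      have : (n + 6) ^ 2 / (3 * R ^ 2) * s ^ 4 + 2 * n * (-(4 / R ^ 2) * s ^ 3)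
          + 4 * (R ^ 2 * (1 - s)) * (12 / R ^ 4 * s ^ 2)
          = s ^ 2 / (3 * R ^ 2) * (((n : ℝ) + 6) * s - 12) ^ 2 := by
        field_simp; ring
      rw [this]; positivity
  have h4 := mul_nonneg hw (add_nonneg h3 h2)
  rw [← sub_eq_add_neg] at h4
  linarith

lemma WeakCyl.energy_mono {w f : Eu n → ℝ → ℝ} {R t₀ t₁ T : ℝ}
    (h : WeakCyl w f R t₀ t₁) (hR : 0 < R) (hT : t₁ < T) (h01 : t₀ ≤ t₁)
    (hw : ∀ y t, 0 ≤ w y t) (hf : ∀ y t, 0 ≤ f y t) :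
    energy w ((n + 6) ^ 2 / (3 * R ^ 2)) T (cut R) t₀
      ≤ energy w ((n + 6) ^ 2 / (3 * R ^ 2)) T (cut R) t₁ := by
  have hd := fun r hr => h.hasDerivAt_energy' (μ := (n + 6) ^ 2 / (3 * R ^ 2)) hR.le
    (profile_cut hR) hT (r := r) hr
  refine monotoneOn_of_deriv_nonneg (convex_Icc t₀ t₁)
    (h.continuousOn_energy hR.le (profile_cut hR) hT) ?_ ?_ (left_mem_Icc.2 h01)
    (right_mem_Icc.2 h01) h01
  · rw [interior_Icc]
    exact fun r hr => (hd r hr).differentiableAt.differentiableWithinAt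
  · rw [interior_Icc]
    intro r hr
    rw [(hd r hr).deriv]
    have hσ : 0 < T - r := by linarith [hr.2]
    refine mul_nonneg (Real.exp_pos _).le (integral_nonneg fun z => ?_)
    exact dens_cut_nonneg hR (by positivity) hσ (hw _ _) (hf _ _)

lemma heatK_lower {τ σ q Q : ℝ} (hτ : 0 < τ) (hσ : τ ≤ σ) (hσ2 : σ ≤ 2) (hQ : 0 ≤ Q)
    (hq : q ≤ Q) :
    (8 * Real.pi) ^ (-(n : ℝ) / 2) * Real.exp (-(Q / (4 * τ))) ≤ heatK n σ q := by
  have hpi := Real.pi_pos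
  have hσ0 : 0 < σ := hτ.trans_le hσ
  unfold heatK
  refine mul_le_mul ?_ ?_ (Real.exp_pos _).le (by positivity)
  · refine Real.rpow_le_rpow_of_nonpos (by positivity) (by nlinarith) ?_
    have : (0 : ℝ) ≤ n := Nat.cast_nonneg n
    linarith
  · refine Real.exp_le_exp.2 (neg_le_neg ?_)
    calc q / (4 * σ) ≤ Q / (4 * σ) := by gcongr
      _ ≤ Q / (4 * τ) := by gcongr

lemma heatK_le_one {σ q : ℝ} (hσ : 1 / 4 ≤ σ) (hq : 0 ≤ q) : heatK n σ q ≤ 1 := by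
  have hpi := Real.pi_gt_three
  unfold heatK
  have h1 : (4 * Real.pi * σ) ^ (-(n : ℝ) / 2) ≤ 1 := by
    refine Real.rpow_le_one_of_one_le_of_nonpos (by nlinarith) ?_
    have : (0 : ℝ) ≤ n := Nat.cast_nonneg n
    linarith
  have h2 : Real.exp (-(q / (4 * σ))) ≤ 1 := by
    rw [Real.exp_le_one_iff, neg_nonpos]; positivity
  exact mul_le_one₀ h1 (Real.exp_pos _).le h2

lemma le_cut {R q : ℝ} (hR : 0 < R) (hq : q ≤ R ^ 2 / 2) : 1 / 16 ≤ cut R q := by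
  have h : 1 / 2 ≤ 1 - q / R ^ 2 := by
    have : q / R ^ 2 ≤ 1 / 2 := by rw [div_le_iff₀ (by positivity)]; linarith
    linarith
  unfold cut pp
  calc (1 / 16 : ℝ) = (1 / 2) ^ 4 := by norm_num
    _ ≤ _ := by gcongr; exact h.trans (le_max_left _ _)

lemma integrable_energy {w : Eu n → ℝ → ℝ} {R μ T r : ℝ} {Θ Θ' Θ'' : ℝ → ℝ}
    (hw : Continuous fun y => w y r) (hR : 0 ≤ R) (hΘ : Profile Θ Θ' Θ'' R) :
    Integrable fun y : Eu n => w y r * testK n μ T Θ r (‖y‖ ^ 2) := by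
  refine (hw.mul (continuous_testK hΘ.cont0 μ T r)).integrable_of_hasCompactSupport ?_
  refine HasCompactSupport.intro (isCompact_closedBall (0 : Eu n) R) fun y hy => ?_
  simp [testK, hΘ.z0 _ (sq_le_norm_sq_of_notMem hR hy)]

lemma integrableOn_closedBall {g : Eu n → ℝ} (hg : Continuous g) (r : ℝ) :
    IntegrableOn g (Metric.closedBall 0 r) :=
  hg.continuousOn.integrableOn_compact (isCompact_closedBall _ _)

lemma le_energy {w : Eu n → ℝ → ℝ} {R μ T r τ r₀ : ℝ} (hw : Continuous fun y => w y r)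
    (hw0 : ∀ y t, 0 ≤ w y t) (hR : 0 < R) (hτ : 0 < τ) (h1 : τ ≤ T - r) (h2 : T - r ≤ 2)
    (hr₀ : r₀ ^ 2 ≤ R ^ 2 / 2) :
    Real.exp (μ * r) * ((8 * Real.pi) ^ (-(n : ℝ) / 2) * Real.exp (-(r₀ ^ 2 / (4 * τ)))) * (1 / 16)
      * ∫ y in Metric.closedBall (0 : Eu n) r₀, w y r ≤ energy w μ T (cut R) r := by
  have hpi := Real.pi_pos
  rw [← integral_const_mul]
  have hσ : 0 < T - r := hτ.trans_le h1
  refine (setIntegral_mono_on ((integrableOn_closedBall hw r₀).const_mul _)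
    (integrable_energy (μ := μ) (T := T) hw hR.le (profile_cut hR)).integrableOn
    Metric.isClosed_closedBall.measurableSet fun y hy => ?_).trans
    (setIntegral_le_integral (integrable_energy hw hR.le (profile_cut hR))
      (Eventually.of_forall fun y => ?_))
  · rw [mem_closedBall_zero_iff] at hy
    have hy2 : ‖y‖ ^ 2 ≤ r₀ ^ 2 := by gcongr
    rw [mul_comm]
    refine mul_le_mul_of_nonneg_left ?_ (hw0 y r)
    unfold testK
    have a1 := heatK_lower (n := n) hτ h1 h2 (by positivity) hy2
    have a2 := le_cut hR (hy2.trans hr₀)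
    have a3 : 0 ≤ Real.exp (μ * r) * heatK n (T - r) (‖y‖ ^ 2) :=
      mul_nonneg (Real.exp_pos _).le (heatK_pos hσ _).le
    gcongr
  · exact mul_nonneg (hw0 y r) (mul_nonneg (mul_nonneg (Real.exp_pos _).le (heatK_pos hσ _).le)
      (cut_nonneg _ _))

/-- A pointwise lower bound of supersolutions by earlier averages. -/
lemma exists_integral_le_point (n : ℕ) : ∃ C : ℝ, 0 < C ∧ ∀ w f : Eu n → ℝ → ℝ,
    (∀ y t, 0 ≤ w y t) → (∀ y t, 0 ≤ f y t) → WeakCyl w f 10 0 (1 / 4) →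
    ∫ y in Metric.closedBall (0 : Eu n) 3, w y 0 ≤ C * w 0 (1 / 4) := by
  have hpi := Real.pi_pos
  set μ : ℝ := (n + 6) ^ 2 / (3 * 10 ^ 2) with hμ
  set c : ℝ := Real.exp (μ * 0) * ((8 * Real.pi) ^ (-(n : ℝ) / 2) *
    Real.exp (-(3 ^ 2 / (4 * (1 / 4))))) * (1 / 16) with hc
  have hc0 : 0 < c := by positivity
  refine ⟨c⁻¹ * Real.exp (μ * (1 / 4)), by positivity, fun w f hw hf h => ?_⟩
  have h1 : ∀ᶠ T in 𝓝[>] (1 / 4 : ℝ), c * ∫ y in Metric.closedBall (0 : Eu n) 3, w y 0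
      ≤ energy w μ T (cut 10) (1 / 4) := by
    have : Ioo (1 / 4 : ℝ) 1 ∈ 𝓝[>] (1 / 4 : ℝ) := Ioo_mem_nhdsGT (by norm_num)
    filter_upwards [this] with T hT
    refine le_trans ?_ (h.energy_mono (by norm_num) hT.1 (by norm_num) hw hf)
    exact le_energy (h.contx 0) hw (by norm_num) (by norm_num) (by linarith [hT.1])
      (by linarith [hT.2]) (by norm_num)
  have h2 := h.tendsto_energy (μ := μ) (by norm_num) (by norm_num) (profile_cut (by norm_num))
  have h3 := ge_of_tendsto h2 h1
  rw [cut_zero, mul_one] at h3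
  rw [mul_assoc, ← div_eq_inv_mul, le_div_iff₀ hc0]
  linarith

/-- A lower bound of averages of supersolutions by earlier averages. -/
lemma exists_integral_le_integral (n : ℕ) : ∃ C : ℝ, 0 < C ∧ ∀ (w f : Eu n → ℝ → ℝ) (r b : ℝ),
    r ≤ b → b ≤ r + 1 / 2 → (∀ y t, 0 ≤ w y t) → (∀ y t, 0 ≤ f y t) → WeakCyl w f 1 r b →
    ∫ y in Metric.closedBall (0 : Eu n) (1 / 2), w y r
      ≤ C * ∫ y in Metric.closedBall (0 : Eu n) 1, w y b := by
  have hpi := Real.pi_pos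
  set μ : ℝ := (n + 6) ^ 2 / (3 * 1 ^ 2) with hμ
  set c : ℝ := ((8 * Real.pi) ^ (-(n : ℝ) / 2) *
    Real.exp (-((1 / 2) ^ 2 / (4 * 1)))) * (1 / 16) with hc
  have hc0 : 0 < c := by positivity
  have hμ0 : 0 ≤ μ := by positivity
  refine ⟨c⁻¹ * Real.exp (μ * (1 / 2)), by positivity, fun w f r b hrb hbr hw hf h => ?_⟩
  have h1 := h.energy_mono (T := b + 1) (by norm_num) (by norm_num) hrb hw hf
  have h2 := le_energy (μ := μ) (T := b + 1) (r₀ := 1 / 2) (τ := 1) (R := 1) (h.contx r) hw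
    (by norm_num) (by norm_num) (by linarith) (by linarith) (by norm_num)
  have h3 : energy w μ (b + 1) (cut 1) b
      ≤ Real.exp (μ * b) * ∫ y in Metric.closedBall (0 : Eu n) 1, w y b := by
    rw [← integral_const_mul, ← integral_indicator Metric.isClosed_closedBall.measurableSet]
    refine integral_mono (integrable_energy (h.contx b) zero_le_one (profile_cut one_pos))
      ((integrable_indicator_iff Metric.isClosed_closedBall.measurableSet).2
        ((integrableOn_closedBall (h.contx b) 1).const_mul _)) fun y => ?_
    by_cases hy : y ∈ Metric.closedBall (0 : Eu n) 1
    · simp only [indicator_of_mem hy, testK, add_sub_cancel_left]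
      have a1 : heatK n 1 (‖y‖ ^ 2) ≤ 1 := heatK_le_one (by norm_num) (by positivity)
      have a2 : cut 1 (‖y‖ ^ 2) ≤ 1 := cut_le_one (by positivity)
      have a3 : heatK n 1 (‖y‖ ^ 2) * cut 1 (‖y‖ ^ 2) ≤ 1 :=
        mul_le_one₀ a1 (cut_nonneg _ _) a2
      calc w y b * (Real.exp (μ * b) * heatK n 1 (‖y‖ ^ 2) * cut 1 (‖y‖ ^ 2))
          = (Real.exp (μ * b) * w y b) * (heatK n 1 (‖y‖ ^ 2) * cut 1 (‖y‖ ^ 2)) := by ring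
        _ ≤ (Real.exp (μ * b) * w y b) * 1 :=
          mul_le_mul_of_nonneg_left a3 (mul_nonneg (Real.exp_pos _).le (hw y b))
        _ = _ := mul_one _
    · simp [indicator_of_notMem hy, testK,
        (profile_cut one_pos).z0 _ (sq_le_norm_sq_of_notMem zero_le_one hy)]
  have h4 := (h2.trans h1).trans h3
  set A := ∫ y in Metric.closedBall (0 : Eu n) (1 / 2), w y r
  set B := ∫ y in Metric.closedBall (0 : Eu n) 1, w y b
  have hB : 0 ≤ B := integral_nonneg fun y => hw y b
  have e1 : Real.exp (μ * b) ≤ Real.exp (μ * r) * Real.exp (μ * (1 / 2)) := by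
    rw [← Real.exp_add]; exact Real.exp_le_exp.2 (by nlinarith)
  have h5 : Real.exp (μ * r) * (c * A) ≤ Real.exp (μ * r) * (Real.exp (μ * (1 / 2)) * B) := by
    calc Real.exp (μ * r) * (c * A) ≤ Real.exp (μ * b) * B := by
          refine le_trans (le_of_eq ?_) h4
          rw [hc]; ring
      _ ≤ Real.exp (μ * r) * Real.exp (μ * (1 / 2)) * B := by gcongr
      _ = _ := by ring
  have h6 := le_of_mul_le_mul_left h5 (Real.exp_pos _)
  rw [mul_assoc, ← div_eq_inv_mul, le_div_iff₀ hc0]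
  linarith

end Estimates

section Estimates

variable {n : ℕ}

lemma exists_plateau : ∃ (Θ Θ' Θ'' : ℝ → ℝ) (C : ℝ), Profile Θ Θ' Θ'' (1 / 2) ∧ Θ 0 = 1 ∧
    (∀ q, 0 ≤ Θ q ∧ Θ q ≤ 1) ∧ 0 ≤ C ∧ (∀ q, 0 ≤ q → |Θ' q| ≤ C ∧ |Θ'' q| ≤ C) ∧
    ∀ q < 1 / 10, Θ' q = 0 ∧ Θ'' q = 0 := by
  set Θ : ℝ → ℝ := fun q => Real.smoothTransition (2 - 10 * q) with hΘ
  have hs : ContDiff ℝ 2 Θ :=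
    (Real.smoothTransition.contDiff (n := (2 : ℕ∞))).comp (by fun_prop)
  have hs1 : ContDiff ℝ 1 (deriv Θ) := by
    have := hs
    rw [show (2 : WithTop ℕ∞) = 1 + 1 by norm_num, contDiff_succ_iff_deriv] at this
    exact this.2.2
  have hs2 : Continuous (deriv (deriv Θ)) := (contDiff_one_iff_deriv.1 hs1).2
  have e1 : ∀ q ∈ Iio (1 / 10 : ℝ), Θ q = 1 := fun q hq =>
    Real.smoothTransition.one_of_one_le (by have := mem_Iio.1 hq; linarith)
  have e2 : ∀ q ∈ Ioi (1 / 5 : ℝ), Θ q = 0 := fun q hq =>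
    Real.smoothTransition.zero_of_nonpos (by have := mem_Ioi.1 hq; linarith)
  have aux : ∀ (g : ℝ → ℝ) (c : ℝ) (U : Set ℝ), IsOpen U → (∀ q ∈ U, g q = c) →
      ∀ q ∈ U, deriv g q = 0 := by
    intro g c U hU hg q hq
    have : g =ᶠ[𝓝 q] fun _ => c := by
      filter_upwards [hU.mem_nhds hq] with x hx using hg x hx
    rw [this.deriv_eq, deriv_const]
  have d1 := aux Θ 1 _ isOpen_Iio e1
  have d2 := aux _ 0 _ isOpen_Iio d1
  have d3 := aux Θ 0 _ isOpen_Ioi e2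
  have d4 := aux _ 0 _ isOpen_Ioi d3
  obtain ⟨C1, h1⟩ := (isCompact_Icc (a := (0 : ℝ)) (b := 1)).exists_bound_of_continuousOn
    hs1.continuous.continuousOn
  obtain ⟨C2, h2⟩ := (isCompact_Icc (a := (0 : ℝ)) (b := 1)).exists_bound_of_continuousOn
    hs2.continuousOn
  have hC1 : 0 ≤ C1 := (norm_nonneg _).trans (h1 0 (by simp))
  have hlt : ∀ q : ℝ, (1 / 2) ^ 2 ≤ q → q ∈ Ioi (1 / 5 : ℝ) := fun q hq => by
    rw [mem_Ioi]; norm_num at hq; linarith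
  refine ⟨Θ, deriv Θ, deriv (deriv Θ), max C1 C2, ⟨?_, ?_, hs2, fun q hq => e2 q (hlt q hq),
    fun q hq => d3 q (hlt q hq), fun q hq => d4 q (hlt q hq)⟩, e1 0 (by norm_num), ?_,
    le_max_of_le_left hC1, ?_, fun q hq => ⟨d1 q hq, d2 q hq⟩⟩
  · exact fun q => (hs.differentiable (by norm_num) q).hasDerivAt
  · exact fun q => (hs1.differentiable (by norm_num) q).hasDerivAt
  · exact fun q => ⟨Real.smoothTransition.nonneg _, Real.smoothTransition.le_one _⟩
  · intro q hq
    by_cases h : q ≤ 1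
    · exact ⟨(h1 q ⟨hq, h⟩).trans (le_max_left _ _), (h2 q ⟨hq, h⟩).trans (le_max_right _ _)⟩
    · have : q ∈ Ioi (1 / 5 : ℝ) := by rw [mem_Ioi]; linarith
      rw [d3 q this, d4 q this, abs_zero]
      exact ⟨le_max_of_le_left hC1, le_max_of_le_left hC1⟩

lemma exists_heatK_bound_away (n : ℕ) : ∃ C : ℝ, 0 < C ∧ ∀ σ q : ℝ, 0 < σ → 1 / 10 ≤ q →
    heatK n σ q * (1 + 1 / σ) ≤ C := by
  refine ⟨(n + 1).factorial / (1 / 40) ^ (n + 1) * Real.exp (1 / 40), by positivity,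
    fun σ q hσ hq => ?_⟩
  have hpi := Real.pi_gt_three
  set x := 1 / σ with hx
  have hx0 : 0 < x := by positivity
  have h1 : (4 * Real.pi * σ) ^ (-(n : ℝ) / 2) ≤ (1 + x) ^ n := by
    have e : (4 * Real.pi * σ) ^ (-(n : ℝ) / 2) = (x / (4 * Real.pi)) ^ ((n : ℝ) / 2) := by
      rw [neg_div, Real.rpow_neg (by positivity), ← Real.inv_rpow (by positivity)]
      congr 1; rw [hx]; field_simp
    have h2 : x / (4 * Real.pi) ≤ 1 + x := by
      rw [div_le_iff₀ (by positivity)]; nlinarith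
    rw [e]
    have hn : (0 : ℝ) ≤ n := Nat.cast_nonneg n
    calc (x / (4 * Real.pi)) ^ ((n : ℝ) / 2) ≤ (1 + x) ^ ((n : ℝ) / 2) := by gcongr
      _ ≤ (1 + x) ^ (n : ℝ) := Real.rpow_le_rpow_of_exponent_le (by linarith) (by linarith)
      _ = _ := Real.rpow_natCast _ _
  have h2 : Real.exp (-(q / (4 * σ))) ≤ Real.exp (-(1 / 40 * x)) := by
    refine Real.exp_le_exp.2 (neg_le_neg ?_)
    rw [hx]
    calc 1 / 40 * (1 / σ) = (1 / 10) / (4 * σ) := by field_simp; norm_num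
      _ ≤ _ := by gcongr
  have h3 := pow_le_exp_mul (n + 1) (c := 1 / 40) (x := 1 + x) (by norm_num) (by positivity)
  calc heatK n σ q * (1 + x) ≤ (1 + x) ^ n * Real.exp (-(1 / 40 * x)) * (1 + x) := by
        unfold heatK; gcongr
    _ = (1 + x) ^ (n + 1) * Real.exp (-(1 / 40 * x)) := by ring
    _ ≤ ((n + 1).factorial / (1 / 40) ^ (n + 1) * Real.exp (1 / 40 * (1 + x)))
        * Real.exp (-(1 / 40 * x)) := by gcongr
    _ = _ := by
      rw [mul_assoc, ← Real.exp_add]; ring_nf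

/-- Local boundedness of subsolutions in terms of averages. -/
lemma exists_point_le_integral (n : ℕ) (Λ : ℝ) (hΛ : 0 ≤ Λ) : ∃ C : ℝ, 0 < C ∧
    ∀ (w f : Eu n → ℝ → ℝ) (A : ℝ), (∀ y t, 0 ≤ w y t) →
    (∀ y ∈ Metric.closedBall (0 : Eu n) (1 / 2), ∀ t ∈ Icc (-1 / 4 : ℝ) 0, f y t ≤ Λ * w y t) →
    WeakCyl w f (1 / 2) (-1 / 4) 0 →
    (∀ r ∈ Icc (-1 / 4 : ℝ) 0, ∫ y in Metric.closedBall (0 : Eu n) (1 / 2), w y r ≤ A) →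
    w 0 0 ≤ C * A := by
  obtain ⟨Θ, Θ', Θ'', C₁, hΘ, hΘ0, hΘ1, hC₁, hΘC, hpl⟩ := exists_plateau
  obtain ⟨C₂, hC₂, hK⟩ := exists_heatK_bound_away n
  set E := Real.exp (Λ / 4) with hE
  set D := E * (C₁ * (2 * n + 2) * C₂) with hD
  refine ⟨E + D / 4, by positivity, fun w f A hw hf h hA => ?_⟩
  have hR : (0 : ℝ) ≤ 1 / 2 := by norm_num
  have hexp : ∀ r ∈ Icc (-1 / 4 : ℝ) 0, Real.exp (-Λ * r) ≤ E := fun r hr =>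
    Real.exp_le_exp.2 (by nlinarith [hr.1, hr.2])
  have hmeas := (Metric.isClosed_closedBall (x := (0 : Eu n)) (ε := 1 / 2)).measurableSet
  have hA0 : 0 ≤ A := (integral_nonneg fun y => hw y 0).trans (hA 0 (by norm_num))
  have hbound : ∀ (g : Eu n → ℝ) (c r : ℝ), r ∈ Icc (-1 / 4 : ℝ) 0 → 0 ≤ c →
      (∀ y ∈ Metric.closedBall (0 : Eu n) (1 / 2), g y ≤ c * w y r) →
      (∀ y, y ∉ Metric.closedBall (0 : Eu n) (1 / 2) → g y = 0) → ∫ y, g y ≤ c * A := by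
    intro g c r hr hc h1 h2
    by_cases hg : Integrable g
    · calc ∫ y, g y ≤ ∫ y in Metric.closedBall (0 : Eu n) (1 / 2), c * w y r := by
            rw [← integral_indicator hmeas]
            refine integral_mono hg ((integrable_indicator_iff hmeas).2
              ((integrableOn_closedBall (h.contx r) _).const_mul _)) fun y => ?_
            by_cases hy : y ∈ Metric.closedBall (0 : Eu n) (1 / 2)
            · simp only [indicator_of_mem hy]; exact h1 y hy
            · simp only [indicator_of_notMem hy]; exact (h2 y hy).le
        _ = c * ∫ y in Metric.closedBall (0 : Eu n) (1 / 2), w y r := integral_const_mul _ _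
        _ ≤ c * A := by gcongr; exact hA r hr
    · rw [integral_undef hg]; positivity
  have key : ∀ T ∈ Ioo (0 : ℝ) 1, energy w (-Λ) T Θ 0 ≤ (E + D / 4) * A := by
    intro T hT
    have hd := fun r hr => h.hasDerivAt_energy (μ := -Λ) hR hΘ hT.1 (r := r) hr
    have h0 : energy w (-Λ) T Θ (-1 / 4) ≤ E * A := by
      refine hbound _ E (-1 / 4) (by norm_num) (Real.exp_pos _).le (fun y hy => ?_) fun y hy => ?_
      · rw [mul_comm E]
        refine mul_le_mul_of_nonneg_left ?_ (hw y _)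
        have a1 : heatK n (T - -1 / 4) (‖y‖ ^ 2) ≤ 1 :=
          heatK_le_one (by linarith [hT.1]) (by positivity)
        have a3 := hexp (-1 / 4) (by norm_num)
        have a4 : 0 ≤ heatK n (T - -1 / 4) (‖y‖ ^ 2) := (heatK_pos (by linarith [hT.1]) _).le
        calc testK n (-Λ) T Θ (-1 / 4) (‖y‖ ^ 2) ≤ E * 1 * 1 := by
              unfold testK
              have := hΘ1 (‖y‖ ^ 2)
              exact mul_le_mul (mul_le_mul a3 a1 a4 (Real.exp_pos _).le) this.2 this.1
                (by positivity)
          _ = E := by ring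
      · simp [testK, hΘ.z0 _ (sq_le_norm_sq_of_notMem hR hy)]
    have h1 : energy w (-Λ) T Θ 0 - energy w (-Λ) T Θ (-1 / 4) ≤ D * A * (0 - (-1 / 4)) := by
      refine Convex.image_sub_le_mul_sub_of_deriv_le (convex_Icc (-1 / 4 : ℝ) 0)
        (h.continuousOn_energy hR hΘ hT.1) ?_ ?_ (-1 / 4) (by norm_num) 0 (by norm_num)
        (by norm_num)
      · rw [interior_Icc]
        exact fun r hr => (hd r hr).differentiableAt.differentiableWithinAt
      · rw [interior_Icc]
        intro r hr
        rw [(hd r hr).deriv]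
        have hσ : 0 < T - r := by linarith [hr.2, hT.1]
        have hri := Ioo_subset_Icc_self hr
        refine hbound _ D r hri (by positivity) (fun y hy => ?_) fun y hy => ?_
        · have hKp := heatK_pos (n := n) hσ (‖y‖ ^ 2)
          have hq0 : 0 ≤ ‖y‖ ^ 2 := by positivity
          have hq1 : ‖y‖ ^ 2 ≤ 1 := by
            rw [mem_closedBall_zero_iff] at hy
            calc ‖y‖ ^ 2 ≤ (1 / 2) ^ 2 := by gcongr
              _ ≤ 1 := by norm_num
          set q := ‖y‖ ^ 2
          have h2 : dens n (w y r) (f y r) (-Λ) (T - r) (Θ q) (Θ' q) (Θ'' q) q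
              ≤ w y r * (2 * n * Θ' q + 4 * q * Θ'' q - 2 * (q / (T - r)) * Θ' q) := by
            have := mul_le_mul_of_nonneg_right (hf y hy r hri) (hΘ1 q).1
            unfold dens; linarith
          have h3 : heatK n (T - r) q * (2 * n * Θ' q + 4 * q * Θ'' q - 2 * (q / (T - r)) * Θ' q)
              ≤ C₁ * (2 * n + 2) * (C₂ * 2) / 1 / 1 - C₁ * (2 * n + 2) * C₂ := by
            rcases lt_or_ge q (1 / 10) with hq | hq
            · rw [(hpl q hq).1, (hpl q hq).2]
              simp only [mul_zero, add_zero, sub_zero, div_one]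
              have : 0 ≤ C₁ * (2 * n + 2) * C₂ := by positivity
              linarith
            · have b := hΘC q hq0
              have b1 : 2 * n * Θ' q ≤ 2 * n * C₁ := by gcongr; exact (le_abs_self _).trans b.1
              have b2 : 4 * q * Θ'' q ≤ 4 * (1 / 4) * C₁ := by
                have hq4 : q ≤ 1 / 4 := by
                  rw [mem_closedBall_zero_iff] at hy
                  calc q ≤ (1 / 2) ^ 2 := by simp only [q]; gcongr
                    _ = 1 / 4 := by norm_num
                calc 4 * q * Θ'' q ≤ 4 * q * C₁ := by gcongr; exact (le_abs_self _).trans b.2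
                  _ ≤ _ := by gcongr
              have b3 : -(2 * (q / (T - r)) * Θ' q) ≤ 2 * (1 / (T - r)) * C₁ := by
                rw [← mul_neg]
                calc 2 * (q / (T - r)) * -Θ' q ≤ 2 * (q / (T - r)) * C₁ := by
                      gcongr; exact (neg_le_abs _).trans b.1
                  _ ≤ _ := by gcongr
              have b4 : 2 * n * Θ' q + 4 * q * Θ'' q - 2 * (q / (T - r)) * Θ' q
                  ≤ C₁ * (2 * n + 2) * (1 + 1 / (T - r)) := by
                have hx : 0 < 1 / (T - r) := by positivity
                have : 0 ≤ C₁ * (2 * n) * (1 / (T - r)) := by positivity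
                nlinarith
              have b5 := hK (T - r) q hσ hq
              calc _ ≤ heatK n (T - r) q * (C₁ * (2 * n + 2) * (1 + 1 / (T - r))) := by gcongr
                _ = C₁ * (2 * n + 2) * (heatK n (T - r) q * (1 + 1 / (T - r))) := by ring
                _ ≤ C₁ * (2 * n + 2) * C₂ := by gcongr
                _ = _ := by ring
          have h4 : heatK n (T - r) q * (2 * n * Θ' q + 4 * q * Θ'' q
              - 2 * (q / (T - r)) * Θ' q) ≤ C₁ * (2 * n + 2) * C₂ := by linarith
          have hwy := hw y r
          have hex := hexp r hri
          calc Real.exp (-Λ * r) * heatK n (T - r) q * dens n (w y r) (f y r) (-Λ) (T - r)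
                (Θ q) (Θ' q) (Θ'' q) q
              ≤ Real.exp (-Λ * r) * heatK n (T - r) q *
                (w y r * (2 * n * Θ' q + 4 * q * Θ'' q - 2 * (q / (T - r)) * Θ' q)) := by gcongr
            _ = Real.exp (-Λ * r) * (w y r * (heatK n (T - r) q *
                (2 * n * Θ' q + 4 * q * Θ'' q - 2 * (q / (T - r)) * Θ' q))) := by ring
            _ ≤ Real.exp (-Λ * r) * (w y r * (C₁ * (2 * n + 2) * C₂)) := by gcongr
            _ ≤ E * (w y r * (C₁ * (2 * n + 2) * C₂)) := by gcongr
            _ = _ := by rw [hD]; ring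
        · have := sq_le_norm_sq_of_notMem hR hy
          rw [hΘ.z0 _ this, hΘ.z1 _ this, hΘ.z2 _ this]
          simp [dens]
    linarith
  have h2 := h.tendsto_energy (μ := -Λ) hR (by norm_num) hΘ
  have h3 := le_of_tendsto h2 (by
    filter_upwards [Ioo_mem_nhdsGT (zero_lt_one (α := ℝ))] with T hT using key T hT)
  simpa [hΘ0] using h3

end Estimates

section Approximation

variable {n : ℕ}

/-- The constant in the estimates of the localization error. -/
noncomputable def errc (n : ℕ) : ℝ := ∫ z : Eu n, (8 * n + 48 + 8 * ‖z‖ ^ 2) ∂(gam n)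

lemma integrable_errc (c : ℝ) :
    Integrable (fun z : Eu n => c * (8 * n + 48 + 8 * ‖z‖ ^ 2)) (gam n) :=
  ((integrable_const _).add ((integrable_norm_pow_gam 2).const_mul 8)).const_mul c

lemma errc_nonneg : 0 ≤ errc n := integral_nonneg fun z => by positivity

lemma abs_dens_cut_sub_le {R Q σ w f M : ℝ} (hR : 0 < R) (hQ : 0 ≤ Q) (hσ : 0 < σ) (hM0 : 0 ≤ M)
    (hM : σ * Q < R ^ 2 → |w| ≤ M) :
    |dens n w f 0 σ (cut R (σ * Q)) (cut' R (σ * Q)) (cut'' R (σ * Q)) (σ * Q)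
      - f * cut R (σ * Q)| ≤ M / R ^ 2 * (8 * n + 48 + 8 * Q) := by
  have hq : 0 ≤ σ * Q := by positivity
  rcases lt_or_ge (σ * Q) (R ^ 2) with h | h
  · have h1 := abs_cut'_le (R := R) hq
    have h2 := abs_mul_cut''_le hR hq
    have h3 : dens n w f 0 σ (cut R (σ * Q)) (cut' R (σ * Q)) (cut'' R (σ * Q)) (σ * Q)
      - f * cut R (σ * Q) = w * (2 * n * cut' R (σ * Q) + 4 * (σ * Q * cut'' R (σ * Q))
        - 2 * Q * cut' R (σ * Q)) := by
      unfold dens; field_simp; ring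
    have hn : (0 : ℝ) ≤ n := Nat.cast_nonneg n
    rw [h3, abs_mul, div_mul_eq_mul_div, mul_div_assoc]
    refine mul_le_mul (hM h) ?_ (abs_nonneg _) hM0
    calc |2 * n * cut' R (σ * Q) + 4 * (σ * Q * cut'' R (σ * Q)) - 2 * Q * cut' R (σ * Q)|
        ≤ 2 * n * |cut' R (σ * Q)| + 4 * |σ * Q * cut'' R (σ * Q)|
          + 2 * Q * |cut' R (σ * Q)| := by
          refine (abs_sub _ _).trans (add_le_add ((abs_add_le _ _).trans ?_) ?_)
          · rw [abs_mul (2 * (n : ℝ)), abs_mul 4, abs_of_nonneg (by positivity : (0:ℝ) ≤ 2 * n),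
              abs_of_nonneg (by norm_num : (0:ℝ) ≤ 4)]
          · rw [abs_mul (2 * Q), abs_of_nonneg (by positivity : (0:ℝ) ≤ 2 * Q)]
      _ ≤ 2 * n * (4 / R ^ 2) + 4 * (12 / R ^ 2) + 2 * Q * (4 / R ^ 2) := by gcongr
      _ = _ := by ring
  · have hp := profile_cut hR
    rw [hp.z0 _ h, hp.z1 _ h, hp.z2 _ h]
    unfold dens
    simp only [mul_zero, add_zero, sub_zero, abs_zero]
    positivity

lemma mem_closedBall_of_mul_lt {R σ : ℝ} {z : Eu n} (hR : 0 ≤ R) (hσ : 0 ≤ σ)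
    (h : σ * ‖z‖ ^ 2 < R ^ 2) :
    √σ • z ∈ Metric.closedBall (0 : Eu n) R := by
  rw [mem_closedBall_zero_iff]
  rw [← norm_sqrt_smul_sq hσ] at h
  exact (lt_of_pow_lt_pow_left₀ 2 hR h).le

/-- A weak solution with vanishing initial value grows at most linearly in time. -/
lemma WeakCyl.abs_le_of_initial_zero {w f : Eu n → ℝ → ℝ} {R a s M F : ℝ}
    (h : WeakCyl w f R a s) (hR : 0 < R) (has : a ≤ s)
    (hM : ∀ y ∈ Metric.closedBall (0 : Eu n) R, ∀ t ∈ Icc a s, |w y t| ≤ M)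
    (hF : ∀ y ∈ Metric.closedBall (0 : Eu n) R, ∀ t ∈ Icc a s, |f y t| ≤ F)
    (h0 : ∀ y ∈ Metric.closedBall (0 : Eu n) R, w y a = 0) :
    |w 0 s| ≤ (M / R ^ 2 * errc n + F) * (s - a) := by
  have hM0 : 0 ≤ M := (abs_nonneg _).trans (hM 0 (by simpa using hR.le) a ⟨le_rfl, has⟩)
  have hF0 : 0 ≤ F := (abs_nonneg _).trans (hF 0 (by simpa using hR.le) a ⟨le_rfl, has⟩)
  have key : ∀ T, s < T → |energy w 0 T (cut R) s| ≤ (M / R ^ 2 * errc n + F) * (s - a) := by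
    intro T hT
    have h1 : energy w 0 T (cut R) a = 0 := by
      rw [energy]
      refine integral_eq_zero_of_ae (Eventually.of_forall fun y => ?_)
      by_cases hy : y ∈ Metric.closedBall (0 : Eu n) R
      · simp [h0 y hy]
      · simp [testK, (profile_cut hR).z0 _ (sq_le_norm_sq_of_notMem hR.le hy)]
    have hB : 0 ≤ M / R ^ 2 * errc n + F := by have := errc_nonneg (n := n); positivity
    rcases has.eq_or_lt with rfl | has'
    · rw [h1, abs_zero, sub_self, mul_zero]
    obtain ⟨c, hc, he⟩ := exists_hasDerivAt_eq_slope _ _ has'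
      (h.continuousOn_energy hR.le (profile_cut hR) hT)
      (fun r hr => h.hasDerivAt_energy' (μ := 0) hR.le (profile_cut hR) hT (r := r) hr)
    rw [h1, sub_zero, eq_div_iff (by linarith), zero_mul, Real.exp_zero, one_mul] at he
    rw [← he, abs_mul, abs_of_pos (by linarith : 0 < s - a)]
    refine mul_le_mul_of_nonneg_right ?_ (by linarith)
    have hσ : 0 < T - c := by linarith [hc.2]
    have hci : c ∈ Icc a s := Ioo_subset_Icc_self hc
    have hcs : M / R ^ 2 * errc n + F
        = ∫ z : Eu n, (M / R ^ 2 * (8 * n + 48 + 8 * ‖z‖ ^ 2) + F) ∂(gam n) := by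
      rw [integral_add (integrable_errc _) (integrable_const F), integral_const_mul]
      simp [errc]
    rw [hcs, ← Real.norm_eq_abs]
    refine norm_integral_le_of_norm_le ((integrable_errc _).add (integrable_const F))
      (Eventually.of_forall fun z => ?_)
    have h3 := abs_dens_cut_sub_le (n := n) (f := f (√(T - c) • z) c) hR (sq_nonneg ‖z‖) hσ hM0
      (fun hlt => hM _ (mem_closedBall_of_mul_lt hR.le hσ.le hlt) c hci)
    have h4 : |f (√(T - c) • z) c * cut R ((T - c) * ‖z‖ ^ 2)| ≤ F := by
      rcases lt_or_ge ((T - c) * ‖z‖ ^ 2) (R ^ 2) with hlt | hge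
      · rw [abs_mul, abs_of_nonneg (cut_nonneg _ _)]
        exact (mul_le_of_le_one_right (abs_nonneg _) (cut_le_one (by positivity))).trans
          (hF _ (mem_closedBall_of_mul_lt hR.le hσ.le hlt) c hci)
      · rwa [(profile_cut hR).z0 _ hge, mul_zero, abs_zero]
    rw [Real.norm_eq_abs]
    have h5 := abs_sub_abs_le_abs_sub (dens n (w (√(T - c) • z) c) (f (√(T - c) • z) c) 0 (T - c)
      (cut R ((T - c) * ‖z‖ ^ 2)) (cut' R ((T - c) * ‖z‖ ^ 2)) (cut'' R ((T - c) * ‖z‖ ^ 2))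
      ((T - c) * ‖z‖ ^ 2)) (f (√(T - c) • z) c * cut R ((T - c) * ‖z‖ ^ 2))
    linarith
  have ht := (h.tendsto_energy hR.le has (profile_cut hR) (μ := 0)).abs
  simp only [zero_mul, Real.exp_zero, one_mul, cut_zero, mul_one] at ht
  refine le_of_tendsto ht ?_
  filter_upwards [self_mem_nhdsWithin] with T hT using key T hT

lemma measurable_uncurry_gam {f : Eu n → ℝ → ℝ} (hfx : ∀ t, Continuous fun y => f y t)
    (hft : ∀ y, Continuous (f y)) (T : ℝ) :
    StronglyMeasurable (Function.uncurry fun r (z : Eu n) => f (√(T - r) • z) r) := by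
  have h1 : Measurable (Function.uncurry f) := by
    have h2 : Measurable (Function.uncurry fun (t : ℝ) (y : Eu n) => f y t) :=
      measurable_uncurry_of_continuous_of_measurable (fun y => hft y) fun t => (hfx t).measurable
    exact h2.comp measurable_swap
  have h2 : Measurable fun q : ℝ × Eu n => (√(T - q.1) • q.2, q.1) := by fun_prop
  exact (h1.comp h2).stronglyMeasurable

/-- Bounded weak solutions on large cylinders approximately satisfy Duhamel's formula. -/
lemma WeakCyl.approx_mild {w f : Eu n → ℝ → ℝ} {R t₀ t₁ M F : ℝ}
    (h : WeakCyl w f R t₀ t₁) (hR : 0 < R) (h01 : t₀ ≤ t₁) (hτ : t₁ ≤ t₀ + 1)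
    (hft : ∀ y, Continuous (f y)) (hM : ∀ y t, |w y t| ≤ M) (hF : ∀ y t, |f y t| ≤ F) :
    |w 0 t₁ - ∫ z, w (√(t₁ - t₀) • z) t₀ ∂(gam n)
      - ∫ r in t₀..t₁, ∫ z, f (√(t₁ - r) • z) r ∂(gam n)| ≤ 2 * ((M + F) / R ^ 2 * errc n) := by
  have hM0 : 0 ≤ M := (abs_nonneg _).trans (hM 0 0)
  have hF0 : 0 ≤ F := (abs_nonneg _).trans (hF 0 0)
  have hE := errc_nonneg (n := n)
  have hGm : ∀ T, StronglyMeasurable fun r => ∫ z, f (√(T - r) • z) r ∂(gam n) := fun T =>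
    (measurable_uncurry_gam h.contf hft T).integral_prod_right
  have hGb : ∀ T r, ‖∫ z, f (√(T - r) • z) r ∂(gam n)‖ ≤ F := fun T r => by
    refine (norm_integral_le_of_norm_le_const (μ := gam n)
      (Eventually.of_forall fun z : Eu n => hF (√(T - r) • z) r)).trans ?_
    simp
  have hGi : ∀ T, IntervalIntegrable (fun r => ∫ z, f (√(T - r) • z) r ∂(gam n)) volume t₀ t₁ :=
    fun T => (intervalIntegrable_const (c := F)).mono_fun (hGm T).aestronglyMeasurable
      (Eventually.of_forall fun r => (hGb T r).trans (le_abs_self F))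
  have key : ∀ T ∈ Ioo t₁ (t₁ + 1), |energy w 0 T (cut R) t₁
      - ∫ z, w (√(T - t₀) • z) t₀ ∂(gam n) - ∫ r in t₀..t₁, ∫ z, f (√(T - r) • z) r ∂(gam n)|
      ≤ 2 * ((M + F) / R ^ 2 * errc n) := by
    intro T hT
    have hcd := profile_cut hR
    -- the derivative of the energy
    have hder : ∀ r ∈ Ioo t₀ t₁, HasDerivAt (energy w 0 T (cut R))
        (deriv (energy w 0 T (cut R)) r) r ∧
        |deriv (energy w 0 T (cut R)) r - ∫ z, f (√(T - r) • z) r ∂(gam n)|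
          ≤ (M + F) / R ^ 2 * errc n := by
      intro r hr
      have hd := h.hasDerivAt_energy' (μ := 0) hR.le hcd hT.1 hr
      refine ⟨hd.differentiableAt.hasDerivAt, ?_⟩
      have hσ : 0 < T - r := by linarith [hr.2, hT.1]
      have hσ2 : T - r ≤ 2 := by linarith [hr.1, hT.2]
      rw [hd.deriv, zero_mul, Real.exp_zero, one_mul]
      have hpt : ∀ z : Eu n, |dens n (w (√(T - r) • z) r) (f (√(T - r) • z) r) 0 (T - r)
          (cut R ((T - r) * ‖z‖ ^ 2)) (cut' R ((T - r) * ‖z‖ ^ 2)) (cut'' R ((T - r) * ‖z‖ ^ 2))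
          ((T - r) * ‖z‖ ^ 2) - f (√(T - r) • z) r|
          ≤ (M + F) / R ^ 2 * (8 * n + 48 + 8 * ‖z‖ ^ 2) := by
        intro z
        have h3 := abs_dens_cut_sub_le (n := n) (f := f (√(T - r) • z) r) hR (sq_nonneg ‖z‖) hσ hM0
          (fun _ => hM (√(T - r) • z) r)
        have h4 : |f (√(T - r) • z) r * cut R ((T - r) * ‖z‖ ^ 2) - f (√(T - r) • z) r|
            ≤ F / R ^ 2 * (8 * n + 48 + 8 * ‖z‖ ^ 2) := by
          have h6 := one_sub_cut_le (R := R) (by positivity : 0 ≤ (T - r) * ‖z‖ ^ 2)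
          have h7 := cut_le_one (R := R) (by positivity : 0 ≤ (T - r) * ‖z‖ ^ 2)
          have h8 : f (√(T - r) • z) r * cut R ((T - r) * ‖z‖ ^ 2) - f (√(T - r) • z) r
            = -(f (√(T - r) • z) r * (1 - cut R ((T - r) * ‖z‖ ^ 2))) := by ring
          rw [h8, abs_neg, abs_mul, abs_of_nonneg (by linarith : 0 ≤ 1 - cut R ((T - r) * ‖z‖ ^ 2))]
          calc _ ≤ F * (4 * ((T - r) * ‖z‖ ^ 2) / R ^ 2) :=
                mul_le_mul (hF _ _) h6 (by linarith) hF0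
            _ ≤ F * (4 * (2 * ‖z‖ ^ 2) / R ^ 2) := by gcongr
            _ = F / R ^ 2 * (8 * ‖z‖ ^ 2) := by ring
            _ ≤ _ := by
              have hn : (0 : ℝ) ≤ n := Nat.cast_nonneg n
              gcongr; linarith
        refine (abs_sub_le _ (f (√(T - r) • z) r * cut R ((T - r) * ‖z‖ ^ 2)) _).trans ?_
        rw [add_div, add_mul]
        exact add_le_add h3 h4
      have hi1 : Integrable (fun z => f (√(T - r) • z) r) (gam n) :=
        (integrable_const F).mono' ((h.contf r).comp (by fun_prop)).aestronglyMeasurable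
          (Eventually.of_forall fun z => hF _ _)
      have hi2 : Integrable (fun z => dens n (w (√(T - r) • z) r) (f (√(T - r) • z) r) 0 (T - r)
          (cut R ((T - r) * ‖z‖ ^ 2)) (cut' R ((T - r) * ‖z‖ ^ 2)) (cut'' R ((T - r) * ‖z‖ ^ 2))
          ((T - r) * ‖z‖ ^ 2) - f (√(T - r) • z) r) (gam n) := by
        refine (integrable_errc _).mono' ?_ (Eventually.of_forall hpt)
        have c1 : Continuous fun z : Eu n => w (√(T - r) • z) r := (h.contx r).comp (by fun_prop)
        have c2 : Continuous fun z : Eu n => f (√(T - r) • z) r := (h.contf r).comp (by fun_prop)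
        have c3 : Continuous fun z : Eu n => cut R ((T - r) * ‖z‖ ^ 2) :=
          hcd.cont0.comp (by fun_prop)
        have c4 : Continuous fun z : Eu n => cut' R ((T - r) * ‖z‖ ^ 2) :=
          hcd.cont1.comp (by fun_prop)
        have c5 : Continuous fun z : Eu n => cut'' R ((T - r) * ‖z‖ ^ 2) :=
          hcd.cont.comp (by fun_prop)
        unfold dens
        have c7 : Continuous fun z : Eu n => (T - r) * ‖z‖ ^ 2 := by fun_prop
        exact (((c1.mul ((((continuous_const.mul c3).add (continuous_const.mul c4)).add
          ((continuous_const.mul c7).mul c5)).sub ((continuous_const.mul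
          (c7.div_const _)).mul c4))).add (c2.mul c3)).sub c2).aestronglyMeasurable
      have hi3 := hi2.add hi1
      simp only [Pi.add_def, sub_add_cancel] at hi3
      rw [← integral_sub hi3 hi1, errc, ← integral_const_mul, ← Real.norm_eq_abs]
      exact norm_integral_le_of_norm_le (integrable_errc _) (Eventually.of_forall hpt)
    have hne : ∀ᵐ r : ℝ, r ≠ t₁ := by simp [ae_iff, measure_singleton]
    have hDi : IntervalIntegrable (deriv (energy w 0 T (cut R))) volume t₀ t₁ := by
      refine (intervalIntegrable_const (c := (M + F) / R ^ 2 * errc n + F)).mono_fun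
        (measurable_deriv _).aestronglyMeasurable ?_
      refine (ae_restrict_iff' measurableSet_uIoc).2 ?_
      filter_upwards [hne] with r hr hr'
      rw [uIoc_of_le h01] at hr'
      have h1 := (hder r ⟨hr'.1, lt_of_le_of_ne hr'.2 hr⟩).2
      have h2 := abs_sub_abs_le_abs_sub (deriv (energy w 0 T (cut R)) r)
        (∫ z, f (√(T - r) • z) r ∂(gam n))
      have h3 := hGb T r
      rw [Real.norm_eq_abs] at h3
      rw [Real.norm_eq_abs, Real.norm_eq_abs]
      refine le_trans ?_ (le_abs_self _)
      linarith
    have hftc := intervalIntegral.integral_eq_sub_of_hasDerivAt_of_le h01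
      (h.continuousOn_energy hR.le hcd hT.1) (fun r hr => (hder r hr).1) hDi
    have h1 : |energy w 0 T (cut R) t₁ - energy w 0 T (cut R) t₀
        - ∫ r in t₀..t₁, ∫ z, f (√(T - r) • z) r ∂(gam n)| ≤ (M + F) / R ^ 2 * errc n := by
      rw [← hftc, ← intervalIntegral.integral_sub hDi (hGi T)]
      have hc0 : 0 ≤ (M + F) / R ^ 2 * errc n := by positivity
      rw [← Real.norm_eq_abs]
      refine (intervalIntegral.norm_integral_le_of_norm_le_const_ae
        (C := (M + F) / R ^ 2 * errc n) ?_).trans ?_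
      · filter_upwards [hne] with r hr hr'
        rw [uIoc_of_le h01] at hr'
        exact (hder r ⟨hr'.1, lt_of_le_of_ne hr'.2 hr⟩).2
      · rw [abs_of_nonneg (by linarith)]
        exact mul_le_of_le_one_right hc0 (by linarith)
    have h2 : |energy w 0 T (cut R) t₀ - ∫ z, w (√(T - t₀) • z) t₀ ∂(gam n)|
        ≤ (M + F) / R ^ 2 * errc n := by
      have hσ : 0 ≤ T - t₀ := by linarith [hT.1]
      have hσ2 : T - t₀ ≤ 2 := by linarith [hT.2]
      rw [energy_eq (h01.trans_lt hT.1), zero_mul, Real.exp_zero, one_mul]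
      have c1 : Continuous fun z : Eu n => w (√(T - t₀) • z) t₀ := (h.contx t₀).comp (by fun_prop)
      have c2 : Continuous fun z : Eu n => cut R ((T - t₀) * ‖z‖ ^ 2) :=
        hcd.cont0.comp (by fun_prop)
      have hq : ∀ z : Eu n, 0 ≤ (T - t₀) * ‖z‖ ^ 2 := fun z => by positivity
      have hi1 : Integrable (fun z => w (√(T - t₀) • z) t₀) (gam n) :=
        (integrable_const M).mono' c1.aestronglyMeasurable (Eventually.of_forall fun z => hM _ _)
      have hi2 : Integrable (fun z => w (√(T - t₀) • z) t₀ * cut R ((T - t₀) * ‖z‖ ^ 2))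
          (gam n) := by
        refine (integrable_const M).mono' (c1.mul c2).aestronglyMeasurable
          (Eventually.of_forall fun z => ?_)
        rw [norm_mul, Real.norm_of_nonneg (cut_nonneg _ _)]
        exact (mul_le_of_le_one_right (norm_nonneg _) (cut_le_one (hq z))).trans (hM _ _)
      rw [← integral_sub hi2 hi1, errc, ← integral_const_mul, ← Real.norm_eq_abs]
      refine norm_integral_le_of_norm_le (integrable_errc _) (Eventually.of_forall fun z => ?_)
      have h6 := one_sub_cut_le (R := R) (hq z)
      have h7 := cut_le_one (R := R) (hq z)
      have h8 : w (√(T - t₀) • z) t₀ * cut R ((T - t₀) * ‖z‖ ^ 2) - w (√(T - t₀) • z) t₀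
        = -(w (√(T - t₀) • z) t₀ * (1 - cut R ((T - t₀) * ‖z‖ ^ 2))) := by ring
      rw [h8, norm_neg, norm_mul,
        Real.norm_of_nonneg (by linarith : 0 ≤ 1 - cut R ((T - t₀) * ‖z‖ ^ 2))]
      calc _ ≤ M * (4 * ((T - t₀) * ‖z‖ ^ 2) / R ^ 2) :=
            mul_le_mul (hM _ _) h6 (by linarith) hM0
        _ ≤ M * (4 * (2 * ‖z‖ ^ 2) / R ^ 2) := by gcongr
        _ = M / R ^ 2 * (8 * ‖z‖ ^ 2) := by ring
        _ ≤ _ := by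
          have hn : (0 : ℝ) ≤ n := Nat.cast_nonneg n
          gcongr <;> linarith
    have h3 := abs_add_le (energy w 0 T (cut R) t₁ - energy w 0 T (cut R) t₀
        - ∫ r in t₀..t₁, ∫ z, f (√(T - r) • z) r ∂(gam n))
        (energy w 0 T (cut R) t₀ - ∫ z, w (√(T - t₀) • z) t₀ ∂(gam n))
    refine le_trans (le_of_eq ?_) (h3.trans ?_)
    · congr 1; ring
    · linarith
  have ht1 := h.tendsto_energy hR.le h01 (profile_cut hR) (μ := 0)
  simp only [zero_mul, Real.exp_zero, one_mul, cut_zero, mul_one] at ht1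
  have ht2 : Tendsto (fun T => ∫ z, w (√(T - t₀) • z) t₀ ∂(gam n)) (𝓝[>] t₁)
      (𝓝 (∫ z, w (√(t₁ - t₀) • z) t₀ ∂(gam n))) := by
    have h1 := tendsto_integral_gam (h.contx t₀) (fun y => hM y t₀) (σ₀ := t₁ - t₀) univ
    rw [nhdsWithin_univ] at h1
    have h2 : Tendsto (fun T : ℝ => T - t₀) (𝓝[>] t₁) (𝓝 (t₁ - t₀)) :=
      ((continuous_id.sub continuous_const).tendsto t₁).mono_left nhdsWithin_le_nhds
    exact h1.comp h2
  have ht3 : Tendsto (fun T => ∫ r in t₀..t₁, ∫ z, f (√(T - r) • z) r ∂(gam n)) (𝓝[>] t₁)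
      (𝓝 (∫ r in t₀..t₁, ∫ z, f (√(t₁ - r) • z) r ∂(gam n))) := by
    refine intervalIntegral.tendsto_integral_filter_of_dominated_convergence (fun _ => F)
      (Eventually.of_forall fun T => (hGm T).aestronglyMeasurable)
      (Eventually.of_forall fun T => Eventually.of_forall fun r _ => hGb T r)
      intervalIntegrable_const (Eventually.of_forall fun r _ => ?_)
    have h1 := tendsto_integral_gam (h.contf r) (fun y => hF y r) (σ₀ := t₁ - r) univ
    rw [nhdsWithin_univ] at h1
    have h2 : Tendsto (fun T : ℝ => T - r) (𝓝[>] t₁) (𝓝 (t₁ - r)) :=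
      ((continuous_id.sub continuous_const).tendsto t₁).mono_left nhdsWithin_le_nhds
    exact h1.comp h2
  refine le_of_tendsto ((ht1.sub ht2).sub ht3).abs ?_
  filter_upwards [Ioo_mem_nhdsGT (lt_add_one t₁)] with T hT using key T hT

end Approximation

section HeatSemigroup

variable {n : ℕ} {E : Type*} [NormedAddCommGroup E] [NormedSpace ℝ E]

lemma integral_heatK_smul {σ : ℝ} (hσ : 0 < σ) (f : Eu n → E) (x : Eu n) :
    ∫ y : Eu n, heatK n σ (‖y - x‖ ^ 2) • f y = ∫ z, f (x + √σ • z) ∂(gam n) := by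
  rw [← integral_add_left_eq_self _ x]
  simp only [add_sub_cancel_left]
  have h := Measure.integral_comp_smul (μ := (volume : Measure (Eu n)))
    (fun y : Eu n => heatK n σ (‖y‖ ^ 2) • f (x + y)) (√σ)
  have hs : 0 < √σ := Real.sqrt_pos.2 hσ
  rw [integral_gam]
  have e : ∀ z : Eu n, heatK n σ (‖√σ • z‖ ^ 2) • f (x + √σ • z)
      = (√σ ^ n)⁻¹ • (heatK n 1 (‖z‖ ^ 2) • f (x + √σ • z)) := by
    intro z
    rw [norm_sqrt_smul_sq hσ.le, heatK_scale hσ, mul_smul]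
  simp only [e] at h
  rw [integral_smul, finrank_euclideanSpace_fin, abs_of_pos (by positivity)] at h
  have := smul_right_injective E (r := (√σ ^ n)⁻¹) (by positivity) h
  exact this.symm

/-- The constant in the local domination of the heat kernel. -/
noncomputable def domc (n : ℕ) (σ : ℝ) : ℝ :=
  (2 * Real.pi * σ) ^ (-(n : ℝ) / 2) * Real.exp (1 / (8 * σ))

lemma domc_nonneg {σ : ℝ} (hσ : 0 < σ) : 0 ≤ domc n σ := by
  have := Real.pi_pos
  unfold domc; positivity

lemma heatK_dom {σ σ' : ℝ} {x x' : Eu n} (hσ : 0 < σ) (h1 : σ / 2 ≤ σ') (h2 : σ' ≤ 2 * σ)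
    (hx : ‖x' - x‖ ≤ 1) (y : Eu n) :
    heatK n σ' (‖y - x'‖ ^ 2) ≤ domc n σ * Real.exp (-(1 / (16 * σ)) * ‖y - x‖ ^ 2) := by
  have hpi := Real.pi_pos
  have hσ' : 0 < σ' := by linarith
  have hq : ‖y - x‖ ^ 2 ≤ 2 * ‖y - x'‖ ^ 2 + 2 := by
    have h3 : ‖y - x‖ ≤ ‖y - x'‖ + ‖x' - x‖ := by
      rw [show y - x = (y - x') + (x' - x) by abel]; exact norm_add_le _ _
    have h4 := norm_nonneg (y - x)
    have h5 := norm_nonneg (y - x')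
    have h6 := norm_nonneg (x' - x)
    nlinarith [sq_nonneg (‖y - x'‖ - ‖x' - x‖)]
  unfold heatK domc
  rw [mul_assoc (_ ^ _) (Real.exp _), ← Real.exp_add]
  refine mul_le_mul ?_ (Real.exp_le_exp.2 ?_) (Real.exp_pos _).le (by positivity)
  · refine Real.rpow_le_rpow_of_nonpos (by positivity) (by nlinarith) ?_
    have : (0 : ℝ) ≤ n := Nat.cast_nonneg n
    linarith
  · have h7 : ‖y - x'‖ ^ 2 / (4 * (2 * σ)) ≤ ‖y - x'‖ ^ 2 / (4 * σ') := by gcongr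
    have h8 : ‖y - x‖ ^ 2 / (16 * σ) ≤ (2 * ‖y - x'‖ ^ 2 + 2) / (16 * σ) := by gcongr
    have h9 : (2 * ‖y - x'‖ ^ 2 + 2) / (16 * σ) = ‖y - x'‖ ^ 2 / (4 * (2 * σ)) + 1 / (8 * σ) := by
      field_simp; ring
    have h10 : -(1 / (16 * σ)) * ‖y - x‖ ^ 2 = -(‖y - x‖ ^ 2 / (16 * σ)) := by ring
    rw [h10]; linarith

lemma integrable_pow_mul_exp_sub (k : ℕ) {b : ℝ} (hb : 0 < b) (x : Eu n) :
    Integrable fun y : Eu n => ‖y - x‖ ^ k * Real.exp (-b * ‖y - x‖ ^ 2) :=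
  (integrable_norm_pow_mul_exp (n := n) k hb).comp_sub_right x

lemma continuous_heatK_sub (σ : ℝ) (x : Eu n) :
    Continuous fun y : Eu n => heatK n σ (‖y - x‖ ^ 2) :=
  (continuous_heatK σ).comp (by fun_prop)

lemma tendsto_integral_abs_heatK_sub {σ : ℝ} (hσ : 0 < σ) (x : Eu n) :
    Tendsto (fun q : Eu n × ℝ =>
      ∫ y, |heatK n q.2 (‖y - q.1‖ ^ 2) - heatK n σ (‖y - x‖ ^ 2)|) (𝓝 (x, σ)) (𝓝 0) := by
  have key : Tendsto (fun q : Eu n × ℝ =>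
      ∫ y, |heatK n q.2 (‖y - q.1‖ ^ 2) - heatK n σ (‖y - x‖ ^ 2)|) (𝓝 (x, σ))
      (𝓝 (∫ _ : Eu n, (0 : ℝ))) := by
    have hev : ∀ᶠ q : Eu n × ℝ in 𝓝 (x, σ),
        ‖q.1 - x‖ ≤ 1 ∧ σ / 2 ≤ q.2 ∧ q.2 ≤ 2 * σ := by
      have e1 : ∀ᶠ q : Eu n × ℝ in 𝓝 (x, σ), ‖q.1 - x‖ < 1 := by
        have : Continuous fun q : Eu n × ℝ => ‖q.1 - x‖ := by fun_prop
        exact this.continuousAt.eventually_lt continuousAt_const (by simp)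
      have e2 : ∀ᶠ q : Eu n × ℝ in 𝓝 (x, σ), σ / 2 < q.2 :=
        continuousAt_const.eventually_lt continuous_snd.continuousAt (by simp [hσ])
      have e3 : ∀ᶠ q : Eu n × ℝ in 𝓝 (x, σ), q.2 < 2 * σ :=
        continuous_snd.continuousAt.eventually_lt continuousAt_const (by simp; linarith)
      filter_upwards [e1, e2, e3] with q a b c using ⟨a.le, b.le, c.le⟩
    have hi := (integrable_pow_mul_exp_sub (n := n) 0 (b := 1 / (16 * σ)) (by positivity) x).const_mul
      (2 * domc n σ)
    refine tendsto_integral_filter_of_dominated_convergence _ ?_ ?_ hi ?_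
    · exact Eventually.of_forall fun q =>
        ((continuous_heatK_sub _ _).sub (continuous_heatK_sub _ _)).abs.aestronglyMeasurable
    · filter_upwards [hev] with q hq
      refine Eventually.of_forall fun y => ?_
      have h1 := heatK_dom hσ hq.2.1 hq.2.2 hq.1 y
      have h2 := heatK_dom (n := n) (σ' := σ) hσ (by linarith) (by linarith)
        (x := x) (x' := x) (by simp) y
      have h3 := (heatK_pos (n := n) (by linarith [hq.2.1] : 0 < q.2) (‖y - q.1‖ ^ 2)).le
      have h4 := (heatK_pos (n := n) hσ (‖y - x‖ ^ 2)).le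
      rw [norm_abs_eq_norm, Real.norm_eq_abs, pow_zero, one_mul, abs_le]
      constructor <;> linarith
    · refine Eventually.of_forall fun y => ?_
      have hc : ContinuousAt (fun q : Eu n × ℝ => heatK n q.2 (‖y - q.1‖ ^ 2)) (x, σ) := by
        unfold heatK
        have hb : 4 * Real.pi * σ ≠ 0 := by have := Real.pi_pos; positivity
        refine ContinuousAt.mul (ContinuousAt.rpow_const (by fun_prop) (Or.inl hb)) ?_
        refine Real.continuous_exp.continuousAt.comp (ContinuousAt.neg ?_)
        exact ContinuousAt.div (by fun_prop) (by fun_prop) (by positivity)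
      have := (hc.sub (continuousAt_const (y := heatK n σ (‖y - x‖ ^ 2)))).abs
      simpa [ContinuousAt] using this
  simpa using key

/-- The gradient of the heat semigroup applied to `f`. -/
noncomputable def dS (n : ℕ) (σ : ℝ) (f : Eu n → E) (x : Eu n) : Eu n →L[ℝ] E :=
  ∫ z : Eu n, (1 / (2 * √σ)) • (innerSL ℝ z).smulRight (f (x + √σ • z)) ∂(gam n)

/-- The first absolute moment of the Gaussian measure. -/
noncomputable def mom (n : ℕ) : ℝ := ∫ z : Eu n, ‖z‖ ^ 1 ∂(gam n)

lemma norm_innerSL_smulRight_le {M : ℝ} (z : Eu n) {c : E} (hc : ‖c‖ ≤ M) :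
    ‖(innerSL ℝ z).smulRight c‖ ≤ M * ‖z‖ ^ 1 := by
  rw [ContinuousLinearMap.norm_smulRight_apply, innerSL_apply_norm, mul_comm, pow_one]
  gcongr

lemma norm_dS_le {σ M : ℝ} {f : Eu n → E} (hM : ∀ y, ‖f y‖ ≤ M) (x : Eu n) :
    ‖dS n σ f x‖ ≤ 1 / (2 * √σ) * (M * mom n) := by
  unfold dS
  rw [integral_smul, norm_smul, Real.norm_of_nonneg (by positivity), mom, ← integral_const_mul]
  gcongr
  exact norm_integral_le_of_norm_le ((integrable_norm_pow_gam 1).const_mul M)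
    (Eventually.of_forall fun z => norm_innerSL_smulRight_le z (hM _))

lemma hasFDerivAt_heat {σ M : ℝ} (hσ : 0 < σ) {f : Eu n → E} (hf : Continuous f)
    (hM : ∀ y, ‖f y‖ ≤ M) (x : Eu n) :
    HasFDerivAt (fun x => ∫ z, f (x + √σ • z) ∂(gam n)) (dS n σ f x) x := by
  simp only [← integral_heatK_smul hσ]
  have hM0 : 0 ≤ M := (norm_nonneg _).trans (hM 0)
  have hs : 0 < √σ := Real.sqrt_pos.2 hσ
  have hdS : dS n σ f x = ∫ y : Eu n, heatK n σ (‖y - x‖ ^ 2) •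
      ((1 / (2 * σ)) • (innerSL ℝ (y - x)).smulRight (f y)) := by
    rw [integral_heatK_smul hσ, dS]
    congr 1; funext z
    rw [add_sub_cancel_left, map_smul]
    have : (√σ • innerSL ℝ z).smulRight (f (x + √σ • z))
        = √σ • (innerSL ℝ z).smulRight (f (x + √σ • z)) := by
      ext v; simp [mul_smul]
    rw [this, smul_smul]
    congr 1
    rw [show σ = √σ * √σ from (Real.mul_self_sqrt hσ.le).symm, Real.sqrt_mul_self hs.le]
    field_simp
  rw [hdS]
  have hcF : ∀ x' : Eu n, Continuous fun y : Eu n => heatK n σ (‖y - x'‖ ^ 2) • f y := fun x' =>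
    (continuous_heatK_sub σ x').smul hf
  have hi0 := (integrable_pow_mul_exp_sub (n := n) 0 (b := 1 / (16 * σ)) (by positivity) x)
  have hi1 := (integrable_pow_mul_exp_sub (n := n) 1 (b := 1 / (16 * σ)) (by positivity) x)
  refine hasFDerivAt_integral_of_dominated_of_fderiv_le (s := Metric.ball x 1)
    (bound := fun y => domc n σ * (1 / (2 * σ)) * M * (‖y - x‖ ^ 1 *
      Real.exp (-(1 / (16 * σ)) * ‖y - x‖ ^ 2) + ‖y - x‖ ^ 0 *
      Real.exp (-(1 / (16 * σ)) * ‖y - x‖ ^ 2)))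
    (F' := fun x' y => heatK n σ (‖y - x'‖ ^ 2) •
      ((1 / (2 * σ)) • (innerSL ℝ (y - x')).smulRight (f y)))
    (Metric.ball_mem_nhds x one_pos) (Eventually.of_forall fun x' =>
      (hcF x').aestronglyMeasurable) ?_ ?_ ?_ ((hi1.add hi0).const_mul _) ?_
  · refine (hi0.const_mul (domc n σ * M)).mono' (hcF x).aestronglyMeasurable
      (Eventually.of_forall fun y => ?_)
    have h2 := heatK_dom (n := n) (σ' := σ) hσ (by linarith) (by linarith)
        (x := x) (x' := x) (by simp) y
    rw [norm_smul, Real.norm_of_nonneg (heatK_pos hσ _).le, pow_zero, one_mul]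
    calc _ ≤ (domc n σ * Real.exp (-(1 / (16 * σ)) * ‖y - x‖ ^ 2)) * M :=
          mul_le_mul h2 (hM y) (norm_nonneg _) (mul_nonneg (domc_nonneg hσ) (Real.exp_pos _).le)
      _ = _ := by ring
  · have : SecondCountableTopologyEither (Eu n) (Eu n →L[ℝ] E) := ⟨Or.inl inferInstance⟩
    refine Continuous.aestronglyMeasurable ?_
    have h1 : Continuous fun y : Eu n => innerSL ℝ (y - x) :=
      (innerSL ℝ (E := Eu n)).continuous.comp (by fun_prop)
    have h2 : Continuous fun y : Eu n => (innerSL ℝ (y - x)).smulRight (f y) :=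
      (ContinuousLinearMap.smulRightL ℝ (Eu n) E).continuous₂.comp (h1.prodMk hf)
    have h3 : Continuous fun y : Eu n => (1 / (2 * σ)) • (innerSL ℝ (y - x)).smulRight (f y) :=
      (continuous_const_smul (1 / (2 * σ))).comp h2
    exact (continuous_heatK_sub σ x).smul h3
  · refine Eventually.of_forall fun y x' hx' => ?_
    have hx1 : ‖x' - x‖ ≤ 1 := by
      rw [Metric.mem_ball, dist_eq_norm] at hx'; exact hx'.le
    have h2 := heatK_dom (n := n) (σ' := σ) hσ (by linarith) (by linarith) hx1 y
    have h3 : ‖y - x'‖ ≤ ‖y - x‖ + 1 := by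
      rw [show y - x' = (y - x) - (x' - x) by abel]
      exact (norm_sub_le _ _).trans (by linarith)
    have h4 := norm_innerSL_smulRight_le (y - x') (hM y)
    rw [norm_smul, norm_smul, Real.norm_of_nonneg (heatK_pos hσ _).le,
      Real.norm_of_nonneg (by positivity : (0:ℝ) ≤ 1 / (2 * σ)), pow_zero, one_mul, pow_one]
    rw [pow_one] at h4
    have hd := domc_nonneg (n := n) hσ
    calc _ ≤ (domc n σ * Real.exp (-(1 / (16 * σ)) * ‖y - x‖ ^ 2)) *
          (1 / (2 * σ) * (M * (‖y - x‖ + 1))) := by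
          gcongr
          exact h4.trans (by gcongr)
      _ = _ := by ring
  · refine Eventually.of_forall fun y x' _ => ?_
    have h1 : HasFDerivAt (fun x' : Eu n => ‖y - x'‖ ^ 2)
        (2 • (innerSL ℝ (y - x')).comp (-(ContinuousLinearMap.id ℝ (Eu n)))) x' :=
      ((hasFDerivAt_id x').const_sub y).norm_sq
    have h2 := ((hasDerivAt_heatK_right (n := n) σ (‖y - x'‖ ^ 2)).comp_hasFDerivAt x' h1).smul_const
      (f y)
    refine h2.congr_fderiv ?_
    ext v
    simp only [ContinuousLinearMap.smulRight_apply, _root_.smul_apply,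
      ContinuousLinearMap.comp_apply, _root_.neg_apply, ContinuousLinearMap.id_apply,
      map_neg, smul_eq_mul, nsmul_eq_mul, smul_smul]
    congr 1
    push_cast
    field_simp
    ring

end HeatSemigroup

section MildRegularity

variable {n : ℕ} {E : Type*} [NormedAddCommGroup E] [NormedSpace ℝ E]

/-- Duhamel's formula over a unit time interval, with initial data `a` and source `f`. -/
noncomputable def mild (a f : Eu n × ℝ → E) (q : Eu n × ℝ) : E :=
  (∫ z, a (q.1 + √1 • z, q.2 - 1) ∂(gam n)) +
    ∫ σ in (0 : ℝ)..1, ∫ z, f (q.1 + √σ • z, q.2 - σ) ∂(gam n)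

/-- The spatial derivative of `mild a f`. -/
noncomputable def dmild (a f : Eu n × ℝ → E) (q : Eu n × ℝ) : Eu n →L[ℝ] E :=
  dS n 1 (fun y => a (y, q.2 - 1)) q.1 +
    ∫ σ in (0 : ℝ)..1, dS n σ (fun y => f (y, q.2 - σ)) q.1

lemma continuous_innerSL_smulRight {X : Type*} [TopologicalSpace X] {g : X → Eu n} {h : X → E}
    (hg : Continuous g) (hh : Continuous h) :
    Continuous fun x => (innerSL ℝ (g x)).smulRight (h x) :=
  (ContinuousLinearMap.smulRightL ℝ (Eu n) E).continuous₂.comp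
    (((innerSL ℝ (E := Eu n)).continuous.comp hg).prodMk hh)

lemma continuous_dS {X : Type*} [TopologicalSpace X] [FirstCountableTopology X] {σ M : ℝ}
    {f : X → Eu n → E} {g : X → Eu n}
    (hf : Continuous fun q : X × Eu n => f q.1 q.2) (hg : Continuous g)
    (hM : ∀ x y, ‖f x y‖ ≤ M) : Continuous fun x => dS n σ (f x) (g x) := by
  have : SecondCountableTopologyEither (Eu n) (Eu n →L[ℝ] E) := ⟨Or.inl inferInstance⟩
  unfold dS
  refine continuous_of_dominated (bound := fun z => 1 / (2 * √σ) * (M * ‖z‖ ^ 1)) ?_ ?_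
    (((integrable_norm_pow_gam 1).const_mul M).const_mul _) ?_
  · intro x
    have h1 : Continuous fun z : Eu n => f x (g x + √σ • z) :=
      hf.comp (continuous_const.prodMk (by fun_prop))
    have h2 := continuous_innerSL_smulRight (continuous_id (X := Eu n)) h1
    exact ((continuous_const_smul (1 / (2 * √σ))).comp h2).aestronglyMeasurable
  · intro x
    refine Eventually.of_forall fun z => ?_
    rw [norm_smul, Real.norm_of_nonneg (by positivity)]
    gcongr
    exact norm_innerSL_smulRight_le z (hM _ _)
  · refine Eventually.of_forall fun z => ?_
    have h1 : Continuous fun x : X => f x (g x + √σ • z) :=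
      hf.comp (continuous_id.prodMk (by fun_prop))
    have h2 := continuous_innerSL_smulRight (continuous_const (y := z)) h1
    exact (continuous_const_smul (1 / (2 * √σ))).comp h2

lemma stronglyMeasurable_dS {f : Eu n × ℝ → E} (hf : Continuous f) (x : Eu n) (t : ℝ) :
    StronglyMeasurable fun σ => dS n σ (fun y => f (y, t - σ)) x := by
  have : SecondCountableTopologyEither (ℝ × Eu n) (Eu n →L[ℝ] E) := ⟨Or.inl inferInstance⟩
  unfold dS
  refine StronglyMeasurable.integral_prod_right ?_
  have h1 : Continuous fun q : ℝ × Eu n => f (x + √q.1 • q.2, t - q.1) :=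
    hf.comp (by fun_prop)
  have h2 := (continuous_innerSL_smulRight continuous_snd h1).stronglyMeasurable
  have h3 : StronglyMeasurable fun q : ℝ × Eu n => 1 / (2 * √q.1) := by
    refine Measurable.stronglyMeasurable ?_
    fun_prop
  exact h3.smul h2

lemma intervalIntegrable_inv_sqrt (C : ℝ) :
    IntervalIntegrable (fun σ : ℝ => 1 / (2 * √σ) * C) volume 0 1 := by
  have h := (intervalIntegral.intervalIntegrable_rpow' (a := 0) (b := 1)
    (by norm_num : (-1 : ℝ) < -(1 / 2))).const_mul (C / 2)
  refine h.congr fun σ hσ => ?_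
  have h0 : 0 < σ := by rw [uIoc_of_le zero_le_one] at hσ; exact hσ.1
  have h1 : 0 < √σ := Real.sqrt_pos.2 h0
  rw [Real.rpow_neg h0.le, ← Real.sqrt_eq_rpow]
  field_simp

lemma continuous_heat {f : Eu n × ℝ → E} {M : ℝ} (hf : Continuous f) (hM : ∀ q, ‖f q‖ ≤ M) :
    Continuous fun q : (Eu n × ℝ) × ℝ => ∫ z, f (q.1.1 + √q.2 • z, q.1.2 - q.2) ∂(gam n) := by
  refine continuous_of_dominated (bound := fun _ => M) (fun q => ?_)
    (fun q => Eventually.of_forall fun z => hM _) (integrable_const M)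
    (Eventually.of_forall fun z => hf.comp (by fun_prop))
  exact (hf.comp (by fun_prop)).aestronglyMeasurable

lemma hasFDerivAt_mild {a f : Eu n × ℝ → E} {M : ℝ} (ha : Continuous a)
    (hf : Continuous f) (hMa : ∀ q, ‖a q‖ ≤ M) (hMf : ∀ q, ‖f q‖ ≤ M) (q : Eu n × ℝ) :
    HasFDerivAt (fun x => mild a f (x, q.2)) (dmild a f q) q.1 := by
  unfold mild dmild
  have hc := continuous_heat hf hMf
  refine (hasFDerivAt_heat (f := fun y => a (y, q.2 - 1)) one_pos (ha.comp (by fun_prop)) (fun y => hMa _) q.1).add ?_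
  refine (intervalIntegral.hasFDerivAt_integral_of_dominated_of_fderiv_le
    (F := fun x σ => ∫ z, f (x + √σ • z, q.2 - σ) ∂(gam n))
    (F' := fun x σ => dS n σ (fun y => f (y, q.2 - σ)) x)
    (bound := fun σ => 1 / (2 * √σ) * (M * mom n)) (s := univ) univ_mem ?_ ?_ ?_ ?_
    (intervalIntegrable_inv_sqrt _) ?_)
  · exact Eventually.of_forall fun x => (hc.comp
      (f := fun σ : ℝ => ((x, q.2), σ)) (by fun_prop)).aestronglyMeasurable
  · exact (hc.comp (f := fun σ : ℝ => (q, σ)) (by fun_prop)).intervalIntegrable _ _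
  · exact (stronglyMeasurable_dS hf q.1 q.2).aestronglyMeasurable
  · exact Eventually.of_forall fun σ _ x _ => norm_dS_le (fun y => hMf _) x
  · refine Eventually.of_forall fun σ hσ x _ => ?_
    rw [uIoc_of_le zero_le_one] at hσ
    exact hasFDerivAt_heat (f := fun y => f (y, q.2 - σ)) hσ.1 (hf.comp (by fun_prop)) (fun y => hMf _) x

lemma continuous_dmild {a f : Eu n × ℝ → E} {M : ℝ} (ha : Continuous a)
    (hf : Continuous f) (hMa : ∀ q, ‖a q‖ ≤ M) (hMf : ∀ q, ‖f q‖ ≤ M) :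
    Continuous (dmild a f) := by
  unfold dmild
  refine Continuous.add ?_ ?_
  · exact continuous_dS (f := fun (q : Eu n × ℝ) y => a (y, q.2 - 1)) (ha.comp (by fun_prop))
      continuous_fst (fun q y => hMa _)
  · refine intervalIntegral.continuous_of_dominated_interval
      (bound := fun σ => 1 / (2 * √σ) * (M * mom n)) ?_ ?_ (intervalIntegrable_inv_sqrt _) ?_
    · exact fun q => (stronglyMeasurable_dS hf q.1 q.2).aestronglyMeasurable
    · exact fun q => Eventually.of_forall fun σ _ => norm_dS_le (fun y => hMf _) q.1
    · exact Eventually.of_forall fun σ _ =>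
        continuous_dS (f := fun (q : Eu n × ℝ) y => f (y, q.2 - σ)) (hf.comp (by fun_prop))
          continuous_fst (fun q y => hMf _)

lemma exists_bound_dmild {a f : Eu n × ℝ → E} {M : ℝ} (hMa : ∀ q, ‖a q‖ ≤ M)
    (hMf : ∀ q, ‖f q‖ ≤ M) : ∃ C, ∀ q, ‖dmild a f q‖ ≤ C := by
  refine ⟨_, fun q => (norm_add_le _ _).trans (add_le_add (norm_dS_le (fun y => hMa _) q.1)
    (intervalIntegral.norm_integral_le_of_norm_le zero_le_one
      (Eventually.of_forall fun σ _ => norm_dS_le (fun y => hMf _) q.1)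
      (intervalIntegrable_inv_sqrt _)))⟩

lemma hasFDerivAt_heat_of_deriv {f : Eu n → E} {f' : Eu n → Eu n →L[ℝ] E} {M : ℝ} (σ : ℝ)
    (hf : ∀ x, HasFDerivAt f (f' x) x) (hc : Continuous f')
    (hM : ∀ x, ‖f x‖ ≤ M) (hM' : ∀ x, ‖f' x‖ ≤ M) (x : Eu n) :
    HasFDerivAt (fun x => ∫ z, f (x + √σ • z) ∂(gam n))
      (∫ z, f' (x + √σ • z) ∂(gam n)) x := by
  have : SecondCountableTopologyEither (Eu n) (Eu n →L[ℝ] E) := ⟨Or.inl inferInstance⟩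
  have hcf : Continuous f := continuous_iff_continuousAt.2 fun x => (hf x).continuousAt
  refine hasFDerivAt_integral_of_dominated_of_fderiv_le (s := univ) (bound := fun _ => M)
    (F' := fun x z => f' (x + √σ • z)) univ_mem ?_ ?_ ?_ ?_ (integrable_const M) ?_
  · exact Eventually.of_forall fun x => (hcf.comp (by fun_prop)).aestronglyMeasurable
  · exact (integrable_const M).mono' (hcf.comp (by fun_prop)).aestronglyMeasurable
      (Eventually.of_forall fun z => hM _)
  · exact (hc.comp (by fun_prop)).aestronglyMeasurable
  · exact Eventually.of_forall fun z x _ => hM' _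
  · exact Eventually.of_forall fun z x _ =>
      (hasFDerivAt_comp_add_right (√σ • z)).2 (hf _)

lemma hasFDerivAt_mild_of_deriv {a f : Eu n × ℝ → E} {a' f' : Eu n × ℝ → Eu n →L[ℝ] E} {M : ℝ}
    (hf : Continuous f) (ha' : Continuous a') (hf' : Continuous f')
    (hda : ∀ q : Eu n × ℝ, HasFDerivAt (fun x => a (x, q.2)) (a' q) q.1)
    (hdf : ∀ q : Eu n × ℝ, HasFDerivAt (fun x => f (x, q.2)) (f' q) q.1)
    (hMa : ∀ q, ‖a q‖ ≤ M) (hMf : ∀ q, ‖f q‖ ≤ M)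
    (hMa' : ∀ q, ‖a' q‖ ≤ M) (hMf' : ∀ q, ‖f' q‖ ≤ M) (q : Eu n × ℝ) :
    HasFDerivAt (fun x => mild a f (x, q.2)) (mild a' f' q) q.1 := by
  unfold mild
  have hc := continuous_heat hf hMf
  have hc' := continuous_heat hf' hMf'
  refine (hasFDerivAt_heat_of_deriv (f := fun y => a (y, q.2 - 1))
    (f' := fun y => a' (y, q.2 - 1)) 1 (fun x => hda (x, q.2 - 1)) (ha'.comp (by fun_prop))
    (fun x => hMa _) (fun x => hMa' _) q.1).add ?_
  refine (intervalIntegral.hasFDerivAt_integral_of_dominated_of_fderiv_le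
    (F := fun x σ => ∫ z, f (x + √σ • z, q.2 - σ) ∂(gam n))
    (F' := fun x σ => ∫ z, f' (x + √σ • z, q.2 - σ) ∂(gam n))
    (bound := fun _ => M) (s := univ) univ_mem ?_ ?_ ?_ ?_ intervalIntegrable_const ?_)
  · exact Eventually.of_forall fun x => (hc.comp
      (f := fun σ : ℝ => ((x, q.2), σ)) (by fun_prop)).aestronglyMeasurable
  · exact (hc.comp (f := fun σ : ℝ => (q, σ)) (by fun_prop)).intervalIntegrable _ _
  · exact (hc'.comp (f := fun σ : ℝ => (q, σ)) (by fun_prop)).aestronglyMeasurable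
  · refine Eventually.of_forall fun σ _ x _ => ?_
    refine (norm_integral_le_of_norm_le_const (Eventually.of_forall fun z => hMf' _)).trans ?_
    simp
  · exact Eventually.of_forall fun σ _ x _ => hasFDerivAt_heat_of_deriv
      (f := fun y => f (y, q.2 - σ)) (f' := fun y => f' (y, q.2 - σ)) σ
      (fun x => hdf (x, q.2 - σ)) (hf'.comp (by fun_prop)) (fun x => hMf _) (fun x => hMf' _) x

lemma hasFDerivAt_of_mild {v : Eu n × ℝ → ℝ} {p : ℝ} (hp : 1 < p) (hv : Continuous v)
    (h0 : ∀ q, 0 ≤ v q) (h1 : ∀ q, v q ≤ 1) (hmild : ∀ q, v q = mild v (fun q => v q ^ p) q) :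
    ∃ (v' : Eu n × ℝ → Eu n →L[ℝ] ℝ) (v'' : Eu n × ℝ → Eu n →L[ℝ] Eu n →L[ℝ] ℝ),
      Continuous v' ∧ Continuous v'' ∧ (∃ C, ∀ q, ‖v'' q‖ ≤ C) ∧
      (∀ q : Eu n × ℝ, HasFDerivAt (fun x => v (x, q.2)) (v' q) q.1) ∧
      ∀ q : Eu n × ℝ, HasFDerivAt (fun x => v' (x, q.2)) (v'' q) q.1 := by
  have hM : ∀ q, ‖v q‖ ≤ 1 := fun q => by rw [Real.norm_of_nonneg (h0 q)]; exact h1 q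
  have hcp : Continuous fun q => v q ^ p := hv.rpow_const fun q => Or.inr (by linarith)
  have hMp : ∀ q, ‖v q ^ p‖ ≤ 1 := fun q => by
    rw [Real.norm_of_nonneg (Real.rpow_nonneg (h0 q) _)]
    exact Real.rpow_le_one (h0 q) (h1 q) (by linarith)
  set v' := dmild v (fun q => v q ^ p) with hv'
  have hmild' : v = mild v (fun q => v q ^ p) := funext hmild
  have hd : ∀ q : Eu n × ℝ, HasFDerivAt (fun x => v (x, q.2)) (v' q) q.1 := fun q => by
    have := hasFDerivAt_mild hv hcp hM hMp q
    rwa [← hmild'] at this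
  have hc' : Continuous v' := continuous_dmild hv hcp hM hMp
  obtain ⟨C, hC⟩ := exists_bound_dmild (n := n) hM hMp
  have hC0 : 0 ≤ C := (norm_nonneg _).trans (hC 0)
  -- the derivative of the source term
  set g' : Eu n × ℝ → Eu n →L[ℝ] ℝ := fun q => (p * v q ^ (p - 1)) • v' q with hg'
  have hdg : ∀ q : Eu n × ℝ, HasFDerivAt (fun x => v (x, q.2) ^ p) (g' q) q.1 := fun q => by
    have := (Real.hasDerivAt_rpow_const (x := v q) (p := p) (Or.inr hp.le)).comp_hasFDerivAt q.1
      (hd q)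
    exact this
  have hcg : Continuous g' := by
    have : Continuous fun q => p * v q ^ (p - 1) :=
      continuous_const.mul (hv.rpow_const fun q => Or.inr (by linarith))
    exact this.smul hc'
  have hCg : ∀ q, ‖g' q‖ ≤ p * C := fun q => by
    have h2 : 0 ≤ v q ^ (p - 1) := Real.rpow_nonneg (h0 q) _
    have h3 : v q ^ (p - 1) ≤ 1 := Real.rpow_le_one (h0 q) (h1 q) (by linarith)
    rw [hg', norm_smul, Real.norm_of_nonneg (by positivity)]
    calc p * v q ^ (p - 1) * ‖v' q‖ ≤ p * 1 * C := by gcongr; exact hC q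
      _ = _ := by ring
  have hCp : C ≤ p * C := le_mul_of_one_le_left hC0 hp.le
  have hself : v' = mild v' g' := by
    funext q
    have h2 := hasFDerivAt_mild_of_deriv (M := 1 + p * C) hcp hc' hcg hd hdg
      (fun q => (hM q).trans (by linarith)) (fun q => (hMp q).trans (by linarith))
      (fun q => (hC q).trans (by linarith)) (fun q => (hCg q).trans (by linarith)) q
    rw [← hmild'] at h2
    exact (hd q).unique h2
  refine ⟨v', dmild v' g', hc', ?_, ?_, hd, ?_⟩
  · exact continuous_dmild hc' hcg (fun q => (hC q).trans hCp) hCg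
  · exact exists_bound_dmild (fun q => (hC q).trans hCp) hCg
  · intro q
    have := hasFDerivAt_mild hc' hcg (fun q => (hC q).trans hCp) hCg q
    rwa [← hself] at this

lemma contDiff_of_mild {v : Eu n × ℝ → ℝ} {p : ℝ} (hp : 1 < p) (hv : Continuous v)
    (h0 : ∀ q, 0 ≤ v q) (h1 : ∀ q, v q ≤ 1) (hmild : ∀ q, v q = mild v (fun q => v q ^ p) q) :
    (∀ t, ContDiff ℝ 2 fun x => v (x, t)) ∧
      Continuous (fun q : Eu n × ℝ => lap (fun x => v (x, q.2)) q.1) := by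
  obtain ⟨v', v'', hc', hc'', -, hd, hd'⟩ := hasFDerivAt_of_mild hp hv h0 h1 hmild
  constructor
  · intro t
    rw [show (2 : WithTop ℕ∞) = 1 + 1 by norm_num, contDiff_succ_iff_fderiv]
    have e1 : fderiv ℝ (fun x => v (x, t)) = fun x => v' (x, t) :=
      funext fun x => (hd (x, t)).fderiv
    have e2 : fderiv ℝ (fun x => v' (x, t)) = fun x => v'' (x, t) :=
      funext fun x => (hd' (x, t)).fderiv
    refine ⟨fun x => (hd (x, t)).differentiableAt, by simp, ?_⟩
    rw [e1, contDiff_one_iff_fderiv, e2]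
    exact ⟨fun x => (hd' (x, t)).differentiableAt, hc''.comp (by fun_prop)⟩
  · have : (fun q : Eu n × ℝ => lap (fun x => v (x, q.2)) q.1) = fun q =>
        ∑ i : Fin n, v'' q (EuclideanSpace.single i 1) (EuclideanSpace.single i 1) := by
      funext q
      unfold lap
      refine Finset.sum_congr rfl fun i _ => ?_
      have e1 : (fun y => fderiv ℝ (fun x => v (x, q.2)) y (EuclideanSpace.single i 1))
          = fun y => v' (y, q.2) (EuclideanSpace.single i 1) :=
        funext fun x => by rw [(hd (x, q.2)).fderiv]
      rw [e1, ((hd' q).clm_apply (hasFDerivAt_const _ _)).fderiv]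
      simp
    rw [this]
    refine continuous_finsetSum _ fun i _ => ?_
    exact (hc''.clm_apply continuous_const).clm_apply continuous_const

end MildRegularity

section WeakAt

variable {n : ℕ}

/-- The weak form of `∂ₜ w = Δ w + f` at time `t`, tested against functions supported in `S`. -/
def WeakAt (w f : Eu n → ℝ → ℝ) (S : Set (Eu n)) (t : ℝ) : Prop :=
  ∀ φ : Eu n → ℝ, ContDiff ℝ 2 φ → HasCompactSupport φ → tsupport φ ⊆ S →
    HasDerivAt (fun s => ∫ y, w y s * φ y) (∫ y, (w y t * lap φ y + f y t * φ y)) t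

lemma integral_comp_add_smul (g : Eu n → ℝ) (a : Eu n) {c : ℝ} (hc : 0 < c) :
    ∫ y, g (a + c • y) = (c ^ n)⁻¹ * ∫ y, g y := by
  have h := Measure.integral_comp_smul (μ := (volume : Measure (Eu n)))
    (fun y : Eu n => g (a + y)) c
  rw [h, integral_add_left_eq_self g a, smul_eq_mul]
  congr 1
  rw [finrank_euclideanSpace_fin, abs_of_pos (by positivity)]

lemma WeakAt.affine {w f : Eu n → ℝ → ℝ} {S : Set (Eu n)} {t₀ s c κ : ℝ} {x₀ : Eu n}
    (hc : 0 < c) (h : WeakAt w f S (t₀ + c ^ 2 * s)) :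
    WeakAt (fun y r => κ * w (x₀ + c • y) (t₀ + c ^ 2 * r))
      (fun y r => κ * c ^ 2 * f (x₀ + c • y) (t₀ + c ^ 2 * r))
      ((fun y => x₀ + c • y) ⁻¹' S) s := by
  intro φ hφ hcs hS
  set e : Eu n → Eu n := fun y => x₀ + c • y with he
  set ψ : Eu n → ℝ := fun z => φ (-(c⁻¹ • x₀) + c⁻¹ • z) with hψ
  have hce : Continuous e := by fun_prop
  have hinv : ∀ z, e (-(c⁻¹ • x₀) + c⁻¹ • z) = z := fun z => by
    simp only [he, smul_add, smul_neg, smul_smul, mul_inv_cancel₀ hc.ne', one_smul]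
    abel
  have hinv' : ∀ y, -(c⁻¹ • x₀) + c⁻¹ • e y = y := fun y => by
    simp only [he, smul_add, smul_smul, inv_mul_cancel₀ hc.ne', one_smul]
    abel
  have hψe : ∀ y, ψ (e y) = φ y := fun y => by rw [hψ]; simp only [hinv']
  have hψc : ContDiff ℝ 2 ψ := hφ.comp (by fun_prop)
  have hsub : tsupport ψ ⊆ e '' tsupport φ := by
    refine closure_minimal (fun z hz => ⟨_, subset_tsupport φ hz, hinv z⟩)
      (hcs.isCompact.image hce).isClosed
  have hψs : HasCompactSupport ψ :=
    (hcs.isCompact.image hce).of_isClosed_subset (isClosed_tsupport ψ) hsub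
  have hψS : tsupport ψ ⊆ S := hsub.trans (by rintro _ ⟨y, hy, rfl⟩; exact hS hy)
  have hlap : ∀ y, c ^ 2 * lap ψ (e y) = lap φ y := fun y => by
    have h1 := lap_affine hψc x₀ c y
    rw [← h1]
    congr 1
    exact funext hψe
  have h1 := h ψ hψc hψs hψS
  have h2 : HasDerivAt (fun r => t₀ + c ^ 2 * r) (c ^ 2) s := by
    simpa using ((hasDerivAt_id s).const_mul (c ^ 2)).const_add t₀
  have h3 := (h1.comp s h2).const_mul (κ * (c ^ n)⁻¹)
  refine (h3.congr_deriv ?_).congr_of_eventuallyEq (Eventually.of_forall fun r => ?_)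
  · have := integral_comp_add_smul (fun z => w z (t₀ + c ^ 2 * s) * lap ψ z
      + f z (t₀ + c ^ 2 * s) * ψ z) x₀ hc
    rw [show κ * (c ^ n)⁻¹ * ((∫ y, (w y (t₀ + c ^ 2 * s) * lap ψ y
      + f y (t₀ + c ^ 2 * s) * ψ y)) * c ^ 2) = κ * c ^ 2 * ((c ^ n)⁻¹ *
      ∫ y, (w y (t₀ + c ^ 2 * s) * lap ψ y + f y (t₀ + c ^ 2 * s) * ψ y)) by ring, ← this,
      ← integral_const_mul]
    refine integral_congr_ae (Eventually.of_forall fun y => ?_)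
    have e1 := hψe y
    have e2 := hlap y
    simp only [he] at e1 e2 ⊢
    rw [e1, ← e2]
    ring
  · have := integral_comp_add_smul (fun z => w z (t₀ + c ^ 2 * r) * ψ z) x₀ hc
    simp only [Function.comp]
    rw [mul_assoc, ← this, ← integral_const_mul]
    refine integral_congr_ae (Eventually.of_forall fun y => ?_)
    have e1 := hψe y
    simp only [he] at e1 ⊢
    rw [e1]
    ring

lemma WeakAt.mono {w f : Eu n → ℝ → ℝ} {S S' : Set (Eu n)} {t : ℝ} (h : WeakAt w f S t)
    (hS : S' ⊆ S) : WeakAt w f S' t := fun φ h1 h2 h3 => h φ h1 h2 (h3.trans hS)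

lemma WeakAt.congr {w f w' f' : Eu n → ℝ → ℝ} {S : Set (Eu n)} {t : ℝ} (h : WeakAt w f S t)
    (hw : ∀ᶠ s in 𝓝 t, ∀ y ∈ S, w y s = w' y s) (hf : ∀ y ∈ S, f y t = f' y t) :
    WeakAt w' f' S t := by
  intro φ h1 h2 h3
  refine ((h φ h1 h2 h3).congr_of_eventuallyEq ?_).congr_deriv ?_
  · filter_upwards [hw] with s hs
    refine integral_congr_ae (Eventually.of_forall fun y => ?_)
    by_cases hy : y ∈ tsupport φ
    · simp only [hs y (h3 hy)]
    · simp [image_eq_zero_of_notMem_tsupport hy]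
  · refine integral_congr_ae (Eventually.of_forall fun y => ?_)
    by_cases hy : y ∈ tsupport φ
    · simp only [hf y (h3 hy), hw.self_of_nhds y (h3 hy)]
    · simp [image_eq_zero_of_notMem_tsupport hy, lap_eq_zero_of_notMem hy]

lemma hasCompactSupport_of_subset_closedBall {φ : Eu n → ℝ} {x : Eu n} {R : ℝ}
    (h : tsupport φ ⊆ Metric.closedBall x R) : HasCompactSupport φ :=
  (isCompact_closedBall x R).of_isClosed_subset (isClosed_tsupport φ) h

end WeakAt

section ApproxSeq

variable {n : ℕ}

/-- A sequence of functions with values in `[0, 1]` which are weak solutions of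
`∂ₜ w = Δ w + w ^ p` on larger and larger cylinders. -/
structure ApproxSeq (p : ℝ) (w : ℕ → Eu n → ℝ → ℝ) : Prop where
  contx : ∀ k t, Continuous fun y => w k y t
  contt : ∀ k y, Continuous (w k y)
  nonneg : ∀ k y t, 0 ≤ w k y t
  le_one : ∀ k y t, w k y t ≤ 1
  weak : ∀ R, ∀ᶠ k in atTop, ∀ t ∈ Ioo (-R) R,
    WeakAt (w k) (fun y s => w k y s ^ p) (Metric.closedBall 0 R) t

namespace ApproxSeq

variable {p : ℝ} {w : ℕ → Eu n → ℝ → ℝ}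

lemma subseq (h : ApproxSeq p w) {θ : ℕ → ℕ} (hθ : StrictMono θ) :
    ApproxSeq p (fun k => w (θ k)) :=
  ⟨fun _ => h.contx _, fun _ => h.contt _, fun _ => h.nonneg _, fun _ => h.le_one _,
    fun R => hθ.tendsto_atTop.eventually (h.weak R)⟩

lemma rpow_nonneg (h : ApproxSeq p w) (k : ℕ) (y : Eu n) (t : ℝ) : 0 ≤ w k y t ^ p :=
  Real.rpow_nonneg (h.nonneg k y t) p

lemma rpow_le_one (h : ApproxSeq p w) (hp : 1 < p) (k : ℕ) (y : Eu n) (t : ℝ) :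
    w k y t ^ p ≤ 1 :=
  Real.rpow_le_one (h.nonneg k y t) (h.le_one k y t) (by linarith)

lemma abs_le_one (h : ApproxSeq p w) (k : ℕ) (y : Eu n) (t : ℝ) : |w k y t| ≤ 1 := by
  rw [abs_of_nonneg (h.nonneg k y t)]; exact h.le_one k y t

lemma abs_rpow_le_one (h : ApproxSeq p w) (hp : 1 < p) (k : ℕ) (y : Eu n) (t : ℝ) :
    |w k y t ^ p| ≤ 1 := by
  rw [abs_of_nonneg (h.rpow_nonneg k y t)]; exact h.rpow_le_one hp k y t

lemma weakCyl (h : ApproxSeq p w) (hp : 1 < p) (x : Eu n) (R T : ℝ) : ∀ᶠ k in atTop,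
    WeakCyl (fun y s => w k (x + y) s) (fun y s => w k (x + y) s ^ p) R (-T) T := by
  filter_upwards [h.weak (max (‖x‖ + R) T)] with k hk
  refine ⟨fun t => (h.contx k t).comp (by fun_prop), fun y => h.contt k _,
    fun t => ((h.contx k t).comp (by fun_prop)).rpow_const fun y => Or.inr (by linarith),
    ⟨1, fun y _ t _ => h.abs_le_one k _ t⟩, ⟨1, fun y _ t _ => h.abs_rpow_le_one hp k _ t⟩, ?_⟩
  intro t ht φ hφ hs
  have h1 : t ∈ Ioo (-max (‖x‖ + R) T) (max (‖x‖ + R) T) :=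
    ⟨(neg_le_neg (le_max_right _ _)).trans_lt ht.1, ht.2.trans_le (le_max_right _ _)⟩
  have h2 : WeakAt (w k) (fun y s => w k y s ^ p) (Metric.closedBall 0 (max (‖x‖ + R) T))
      (0 + 1 ^ 2 * t) := by simpa using hk t h1
  have h3 := h2.affine (κ := 1) (x₀ := x) one_pos φ hφ
    (hasCompactSupport_of_subset_closedBall hs) (hs.trans ?_)
  · simpa using h3
  · intro y hy
    simp only [mem_closedBall_zero_iff, mem_preimage, one_smul] at hy ⊢
    exact (norm_add_le _ _).trans ((by linarith : ‖x‖ + ‖y‖ ≤ ‖x‖ + R).trans (le_max_left _ _))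

lemma approx_mild (h : ApproxSeq p w) (hp : 1 < p) (x : Eu n) {t₀ t₁ ε : ℝ} (h01 : t₀ ≤ t₁)
    (hτ : t₁ ≤ t₀ + 1) (hε : 0 < ε) : ∀ᶠ k in atTop,
    |w k x t₁ - ∫ z, w k (x + √(t₁ - t₀) • z) t₀ ∂(gam n)
      - ∫ r in t₀..t₁, ∫ z, w k (x + √(t₁ - r) • z) r ^ p ∂(gam n)| ≤ ε := by
  have hE := errc_nonneg (n := n)
  obtain ⟨R, hR0, hR⟩ : ∃ R : ℝ, 0 < R ∧ 2 * ((1 + 1) / R ^ 2 * errc n) ≤ ε := by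
    refine ⟨√((4 * errc n + 1) / ε), by positivity, ?_⟩
    rw [Real.sq_sqrt (by positivity)]
    field_simp
    linarith
  filter_upwards [h.weakCyl hp x R (max (-t₀) t₁)] with k hk
  have hk' := hk.mono le_rfl (s₀ := t₀) (s₁ := t₁) (by
    have := le_max_left (-t₀) t₁
    linarith) (le_max_right _ _)
  have := hk'.approx_mild hR0 h01 hτ (M := 1) (F := 1)
    (fun y => (h.contt k _).rpow_const fun y => Or.inr (by linarith))
    (fun y t => h.abs_le_one k _ t) (fun y t => h.abs_rpow_le_one hp k _ t)
  simp only [add_zero] at this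
  exact this.trans hR

end ApproxSeq
end ApproxSeq

section ApproxSeqLimit

variable {n : ℕ}

namespace ApproxSeq

variable {p : ℝ} {w : ℕ → Eu n → ℝ → ℝ}

lemma exists_equicontinuous (h : ApproxSeq p w) (hp : 1 < p) (P : Eu n × ℝ) {ε : ℝ}
    (hε : 0 < ε) : ∃ U ∈ 𝓝 P, ∀ Q ∈ U, ∀ᶠ k in atTop, |w k P.1 P.2 - w k Q.1 Q.2| ≤ ε := by
  obtain ⟨x, t⟩ := P
  set τ := min (1 / 2) (ε / 8) with hτ
  have hτ0 : 0 < τ := by positivity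
  have hτ1 : τ ≤ 1 / 2 := min_le_left _ _
  have hτ2 : τ ≤ ε / 8 := min_le_right _ _
  have hlim := tendsto_integral_abs_heatK_sub hτ0 x
  have hev := (hlim.eventually_lt_const (show (0 : ℝ) < ε / 8 by positivity))
  have hc : Tendsto (fun Q : Eu n × ℝ => (Q.1, Q.2 - (t - τ))) (𝓝 (x, t)) (𝓝 (x, τ)) := by
    have : Continuous fun Q : Eu n × ℝ => (Q.1, Q.2 - (t - τ)) := by fun_prop
    simpa using this.tendsto (x, t)
  have hnear : ∀ᶠ Q : Eu n × ℝ in 𝓝 (x, t), Q.2 ∈ Ioo (t - τ / 2) (t + τ / 2) :=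
    continuous_snd.tendsto (x, t) (Ioo_mem_nhds (by simp; linarith) (by simp; linarith))
  refine ⟨_, (hc.eventually hev).and hnear, ?_⟩
  rintro ⟨y, s⟩ ⟨hQ1, hQ2⟩
  simp only [mem_Ioo] at hQ1 hQ2
  have hσ0 : 0 < s - (t - τ) := by linarith
  have a1 := h.approx_mild hp x (t₀ := t - τ) (t₁ := t) (ε := ε / 8) (by linarith) (by linarith)
    (by positivity)
  have a2 := h.approx_mild hp y (t₀ := t - τ) (t₁ := s) (ε := ε / 8) (by linarith) (by linarith)
    (by positivity)
  filter_upwards [a1, a2] with k h1 h2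
  have hD : ∀ (x : Eu n) (t₁ : ℝ), t - τ ≤ t₁ →
      |∫ r in (t - τ)..t₁, ∫ z, w k (x + √(t₁ - r) • z) r ^ p ∂(gam n)| ≤ t₁ - (t - τ) := by
    intro x t₁ ht
    have := intervalIntegral.norm_integral_le_of_norm_le_const (C := 1) (a := t - τ) (b := t₁)
      (f := fun r => ∫ z, w k (x + √(t₁ - r) • z) r ^ p ∂(gam n)) fun r _ => by
        refine (norm_integral_le_of_norm_le_const
          (Eventually.of_forall fun z => h.abs_rpow_le_one hp k _ r)).trans ?_
        simp
    rwa [one_mul, abs_of_nonneg (sub_nonneg.2 ht), Real.norm_eq_abs] at this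
  have hS : |∫ z, w k (x + √(t - (t - τ)) • z) (t - τ) ∂(gam n)
      - ∫ z, w k (y + √(s - (t - τ)) • z) (t - τ) ∂(gam n)| ≤ ε / 8 := by
    rw [show t - (t - τ) = τ by ring,
      ← integral_heatK_smul hτ0 (fun y => w k y (t - τ)),
      ← integral_heatK_smul hσ0 (fun y => w k y (t - τ))]
    have hi : ∀ {σ : ℝ} (_ : 0 < σ) (x : Eu n),
        Integrable fun y : Eu n => heatK n σ (‖y - x‖ ^ 2) := fun hσ x =>
      (integrable_heatK hσ).comp_sub_right x
    have hi' : ∀ {σ : ℝ} (_ : 0 < σ) (x : Eu n),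
        Integrable fun y : Eu n => heatK n σ (‖y - x‖ ^ 2) • w k y (t - τ) := fun hσ x => by
      refine (hi hσ x).mono ((continuous_heatK_sub _ x).smul (h.contx k _)).aestronglyMeasurable
        (Eventually.of_forall fun y => ?_)
      rw [norm_smul]
      exact mul_le_of_le_one_right (norm_nonneg _) (h.abs_le_one k _ _)
    rw [← integral_sub (hi' hτ0 x) (hi' hσ0 y), ← Real.norm_eq_abs]
    refine (norm_integral_le_of_norm_le ((hi hσ0 y).sub (hi hτ0 x)).abs
      (Eventually.of_forall fun z => ?_)).trans hQ1.le
    rw [← sub_smul, norm_smul, Real.norm_eq_abs, abs_sub_comm]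
    exact mul_le_of_le_one_right (abs_nonneg _) (h.abs_le_one k _ _)
  have h3 := hD x t (by linarith)
  have h4 := hD y s (by linarith)
  rw [abs_le] at h1 h2 h3 h4 hS ⊢
  constructor <;> linarith [h1.1, h1.2, h2.1, h2.2, h3.1, h3.2, h4.1, h4.2, hS.1, hS.2]

lemma exists_subseq_limit (h : ApproxSeq p w) (hp : 1 < p) :
    ∃ θ : ℕ → ℕ, StrictMono θ ∧ ∃ v : Eu n × ℝ → ℝ, Continuous v ∧
      ∀ q, Tendsto (fun k => w (θ k) q.1 q.2) atTop (𝓝 (v q)) := by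
  set d := TopologicalSpace.denseSeq (Eu n × ℝ) with hd
  have hcomp : IsCompact (univ.pi fun _ : ℕ => Icc (0 : ℝ) 1) :=
    isCompact_univ_pi fun _ => isCompact_Icc
  obtain ⟨a, -, θ, hθ, ha⟩ := hcomp.tendsto_subseq
    (x := fun k j => w k (d j).1 (d j).2) fun k j _ => ⟨h.nonneg k _ _, h.le_one k _ _⟩
  rw [tendsto_pi_nhds] at ha
  have hs := h.subseq hθ
  have hcau : ∀ q : Eu n × ℝ, ∃ l, Tendsto (fun k => w (θ k) q.1 q.2) atTop (𝓝 l) := by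
    intro q
    refine cauchySeq_tendsto_of_complete (Metric.cauchySeq_iff.2 fun ε hε => ?_)
    obtain ⟨U, hU, hUq⟩ := hs.exists_equicontinuous hp q (ε := ε / 4) (by positivity)
    obtain ⟨j, hj⟩ := (TopologicalSpace.denseRange_denseSeq (Eu n × ℝ)).exists_mem_open
      isOpen_interior ⟨q, mem_interior_iff_mem_nhds.2 hU⟩
    obtain ⟨N₁, hN₁⟩ := eventually_atTop.1 (hUq _ (interior_subset hj))
    obtain ⟨N₂, hN₂⟩ := Metric.cauchySeq_iff.1 (ha j).cauchySeq (ε / 4) (by positivity)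
    refine ⟨max N₁ N₂, fun k hk l hl => ?_⟩
    have e1 := hN₁ k ((le_max_left _ _).trans hk)
    have e2 := hN₁ l ((le_max_left _ _).trans hl)
    have e3 := hN₂ k ((le_max_right _ _).trans hk) l ((le_max_right _ _).trans hl)
    simp only [Function.comp, Real.dist_eq, hd] at e3 ⊢
    rw [abs_le] at e1 e2
    rw [abs_lt] at e3 ⊢
    constructor <;> linarith [e1.1, e1.2, e2.1, e2.2, e3.1, e3.2]
  choose v hv using hcau
  refine ⟨θ, hθ, v, continuous_iff_continuousAt.2 fun P => ?_, hv⟩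
  rw [ContinuousAt, Metric.tendsto_nhds]
  intro ε hε
  obtain ⟨U, hU, hUP⟩ := hs.exists_equicontinuous hp P (ε := ε / 2) (by positivity)
  filter_upwards [hU] with Q hQ
  have := le_of_tendsto ((hv P).sub (hv Q)).abs (hUP Q hQ)
  rw [Real.dist_eq, abs_sub_comm]
  linarith

/-- A continuous function with its approximating sequence. -/
structure Limit (p : ℝ) (w : ℕ → Eu n → ℝ → ℝ) (v : Eu n × ℝ → ℝ) : Prop where
  seq : ApproxSeq p w
  hp : 1 < p
  cont : Continuous v
  tends : ∀ q, Tendsto (fun k => w k q.1 q.2) atTop (𝓝 (v q))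

namespace Limit

variable {v : Eu n × ℝ → ℝ}

lemma nonneg (h : Limit p w v) (q : Eu n × ℝ) : 0 ≤ v q :=
  ge_of_tendsto (h.tends q) (Eventually.of_forall fun k => h.seq.nonneg k _ _)

lemma le_one (h : Limit p w v) (q : Eu n × ℝ) : v q ≤ 1 :=
  le_of_tendsto (h.tends q) (Eventually.of_forall fun k => h.seq.le_one k _ _)

lemma rpow_nonneg (h : Limit p w v) (q : Eu n × ℝ) : 0 ≤ v q ^ p := Real.rpow_nonneg (h.nonneg q) p

lemma abs_le_one (h : Limit p w v) (q : Eu n × ℝ) : |v q| ≤ 1 := by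
  rw [abs_of_nonneg (h.nonneg q)]; exact h.le_one q

lemma cont_rpow (h : Limit p w v) : Continuous fun q => v q ^ p :=
  h.cont.rpow_const fun _ => Or.inr (by linarith [h.hp])

lemma tends_rpow (h : Limit p w v) (q : Eu n × ℝ) :
    Tendsto (fun k => w k q.1 q.2 ^ p) atTop (𝓝 (v q ^ p)) :=
  (h.tends q).rpow_const (Or.inr (by linarith [h.hp]))

lemma cont_seq_rpow (h : Limit p w v) (k : ℕ) (t : ℝ) : Continuous fun y => w k y t ^ p :=
  (h.seq.contx k t).rpow_const fun _ => Or.inr (by linarith [h.hp])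

lemma mild (h : Limit p w v) (x : Eu n) (t : ℝ) {τ : ℝ} (h0 : 0 ≤ τ) (h1 : τ ≤ 1) :
    v (x, t) = ∫ z, v (x + √τ • z, t - τ) ∂(gam n) +
      ∫ σ in (0 : ℝ)..τ, ∫ z, v (x + √σ • z, t - σ) ^ p ∂(gam n) := by
  have e1 : Tendsto (fun k => ∫ z, w k (x + √(t - (t - τ)) • z) (t - τ) ∂(gam n)) atTop
      (𝓝 (∫ z, v (x + √(t - (t - τ)) • z, t - τ) ∂(gam n))) := by
    refine tendsto_integral_of_dominated_convergence (fun _ => 1) (fun k => ?_)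
      (integrable_const _) (fun k => Eventually.of_forall fun z => h.seq.abs_le_one k _ _)
      (Eventually.of_forall fun z => h.tends (_, _))
    exact ((h.seq.contx k _).comp (by fun_prop)).aestronglyMeasurable
  have e2 : ∀ r, Tendsto (fun k => ∫ z, w k (x + √(t - r) • z) r ^ p ∂(gam n)) atTop
      (𝓝 (∫ z, v (x + √(t - r) • z, r) ^ p ∂(gam n))) := by
    intro r
    refine tendsto_integral_of_dominated_convergence (fun _ => 1) (fun k => ?_)
      (integrable_const _) (fun k => Eventually.of_forall fun z => h.seq.abs_rpow_le_one h.hp k _ _)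
      (Eventually.of_forall fun z => h.tends_rpow (_, _))
    exact ((h.cont_seq_rpow k _).comp (by fun_prop)).aestronglyMeasurable
  have e3 : Tendsto (fun k => ∫ r in (t - τ)..t, ∫ z, w k (x + √(t - r) • z) r ^ p ∂(gam n)) atTop
      (𝓝 (∫ r in (t - τ)..t, ∫ z, v (x + √(t - r) • z, r) ^ p ∂(gam n))) := by
    refine intervalIntegral.tendsto_integral_filter_of_dominated_convergence (fun _ => 1)
      (Eventually.of_forall fun k => ?_) (Eventually.of_forall fun k =>
      Eventually.of_forall fun r _ => ?_) intervalIntegrable_const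
      (Eventually.of_forall fun r _ => e2 r)
    · exact (measurable_uncurry_gam (f := fun y r => w k (x + y) r ^ p)
        (fun s => (h.cont_seq_rpow k s).comp (by fun_prop))
        (fun y => (h.seq.contt k _).rpow_const fun _ => Or.inr (by linarith [h.hp]))
        t).integral_prod_right.aestronglyMeasurable
    · refine (norm_integral_le_of_norm_le_const
        (Eventually.of_forall fun z => h.seq.abs_rpow_le_one h.hp k _ r)).trans ?_
      simp
  have e4 := ((h.tends (x, t)).sub e1).sub e3
  have e5 : v (x, t) - ∫ z, v (x + √(t - (t - τ)) • z, t - τ) ∂(gam n)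
      - ∫ r in (t - τ)..t, ∫ z, v (x + √(t - r) • z, r) ^ p ∂(gam n) = 0 := by
    have : ∀ ε > 0, |v (x, t) - ∫ z, v (x + √(t - (t - τ)) • z, t - τ) ∂(gam n)
      - ∫ r in (t - τ)..t, ∫ z, v (x + √(t - r) • z, r) ^ p ∂(gam n)| ≤ 0 + ε := fun ε hε => by
      rw [zero_add]
      exact le_of_tendsto e4.abs (h.seq.approx_mild h.hp x (by linarith) (by linarith) hε)
    exact abs_eq_zero.1 (le_antisymm (le_of_forall_pos_le_add this) (abs_nonneg _))
  have e6 := intervalIntegral.integral_comp_sub_left (a := 0) (b := τ)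
    (fun r => ∫ z, v (x + √(t - r) • z, r) ^ p ∂(gam n)) t
  simp only [sub_sub_cancel, sub_zero] at e5 e6
  rw [e6]
  linarith

end Limit
end ApproxSeq
end ApproxSeqLimit

section ApproxSeqSolution

variable {n : ℕ}

namespace ApproxSeq.Limit

variable {p : ℝ} {w : ℕ → Eu n → ℝ → ℝ} {v : Eu n × ℝ → ℝ}

lemma rpow_le_self (h : Limit p w v) (q : Eu n × ℝ) : v q ^ p ≤ v q := by
  have := Real.rpow_le_rpow_of_exponent_ge' (h.nonneg q) (h.le_one q) zero_le_one h.hp.le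
  rwa [Real.rpow_one] at this

lemma eq_zero_before (h : Limit p w v) {x : Eu n} {t τ : ℝ} (h0 : v (x, t) = 0) (hτ : 0 < τ)
    (hτ1 : τ ≤ 1) (y : Eu n) : v (y, t - τ) = 0 := by
  have hm := h.mild x t hτ.le hτ1
  have hD : 0 ≤ ∫ σ in (0 : ℝ)..τ, ∫ z, v (x + √σ • z, t - σ) ^ p ∂(gam n) :=
    intervalIntegral.integral_nonneg hτ.le fun σ _ => integral_nonneg fun z => h.rpow_nonneg _
  have hS : 0 ≤ ∫ z, v (x + √τ • z, t - τ) ∂(gam n) := integral_nonneg fun z => h.nonneg _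
  have hS0 : ∫ z, v (x + √τ • z, t - τ) ∂(gam n) = 0 := by linarith
  rw [← integral_heatK_mul hτ (fun z => v (x + z, t - τ))] at hS0
  have hc : Continuous fun z => heatK n τ (‖z‖ ^ 2) * v (x + z, t - τ) :=
    (continuous_heatK_norm τ).mul (h.cont.comp (by fun_prop))
  have hi : Integrable fun z => heatK n τ (‖z‖ ^ 2) * v (x + z, t - τ) := by
    refine (integrable_heatK hτ).mono hc.aestronglyMeasurable (Eventually.of_forall fun z => ?_)
    rw [norm_mul]
    exact mul_le_of_le_one_right (norm_nonneg _) (h.abs_le_one _)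
  rw [integral_eq_zero_iff_of_nonneg
    (fun z => mul_nonneg (heatK_pos hτ _).le (h.nonneg _)) hi] at hS0
  have := (hc.ae_eq_iff_eq volume continuous_const).1 hS0
  have h2 : heatK n τ (‖y - x‖ ^ 2) * v (x + (y - x), t - τ) = 0 := congrFun this (y - x)
  rw [add_sub_cancel] at h2
  exact (mul_eq_zero.1 h2).resolve_left (heatK_pos hτ _).ne'

lemma eq_zero_after (h : Limit p w v) {s τ : ℝ} (h0 : ∀ y, v (y, s) = 0) (hτ : 0 ≤ τ)
    (hτ1 : τ ≤ 1 / 2) (y : Eu n) : v (y, s + τ) = 0 := by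
  have key : ∀ m : ℕ, ∀ τ : ℝ, 0 ≤ τ → τ ≤ 1 / 2 → ∀ y, v (y, s + τ) ≤ (1 / 2) ^ m := by
    intro m
    induction m with
    | zero => intro τ _ _ y; simpa using h.le_one _
    | succ m ih =>
      intro τ hτ hτ1 y
      rw [h.mild y (s + τ) hτ (by linarith)]
      simp only [add_sub_cancel_right, h0, integral_zero, zero_add]
      have hb : ∀ σ ∈ uIoc 0 τ, ‖∫ z, v (y + √σ • z, s + τ - σ) ^ p ∂(gam n)‖ ≤ (1 / 2) ^ m := by
        intro σ hσ
        rw [uIoc_of_le hτ] at hσ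
        refine (norm_integral_le_of_norm_le_const (C := (1 / 2) ^ m)
          (Eventually.of_forall fun z => ?_)).trans_eq (by simp)
        rw [Real.norm_of_nonneg (h.rpow_nonneg _), add_sub_assoc]
        exact (h.rpow_le_self _).trans (ih _ (by linarith [hσ.2]) (by linarith [hσ.1]) _)
      have h1 := intervalIntegral.norm_integral_le_of_norm_le_const hb
      refine (le_abs_self _).trans (h1.trans ?_)
      rw [sub_zero, abs_of_nonneg hτ, pow_succ]
      gcongr
  refine le_antisymm (ge_of_tendsto' (tendsto_pow_atTop_nhds_zero_of_lt_one (by norm_num)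
    (by norm_num : (1 / 2 : ℝ) < 1)) fun m => key m τ hτ hτ1 y) (h.nonneg _)

lemma pos (h : Limit p w v) (h0 : v (0, 0) ≠ 0) (q : Eu n × ℝ) : 0 < v q := by
  obtain ⟨x, t⟩ := q
  refine (h.nonneg _).lt_of_ne' fun hz => h0 ?_
  have hstep : ∀ s, (∀ y, v (y, s) = 0) → ∀ δ, |δ| ≤ 1 / 2 → ∀ y, v (y, s + δ) = 0 := by
    intro s hs δ hδ y
    rw [abs_le] at hδ
    rcases le_or_gt 0 δ with h1 | h1
    · exact h.eq_zero_after hs h1 hδ.2 y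
    · have := h.eq_zero_before (hs 0) (neg_pos.2 h1) (by linarith) y
      rwa [sub_neg_eq_add] at this
  have hall : ∀ m : ℕ, ∀ s, (∀ y, v (y, s) = 0) → ∀ δ : ℝ, |δ| ≤ m / 2 → ∀ y, v (y, s + δ) = 0 := by
    intro m
    induction m with
    | zero =>
      intro s hs δ hδ y
      have : δ = 0 := by simpa using hδ
      rw [this, add_zero]; exact hs y
    | succ m ih =>
      intro s hs δ hδ y
      have hm : (0 : ℝ) < m + 1 := by positivity
      push_cast at hδ
      have h1 := hstep s hs (δ / (m + 1)) (by
        rw [abs_div, abs_of_pos hm, div_le_iff₀ hm]; linarith)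
      have h2 := ih _ h1 (δ * m / (m + 1)) (by
        rw [abs_div, abs_of_pos hm, abs_mul, Nat.abs_cast, div_le_iff₀ hm]
        nlinarith [Nat.cast_nonneg (α := ℝ) m])  y
      rwa [add_assoc, show δ / (m + 1) + δ * m / (m + 1) = δ by field_simp; ring] at h2
  have h1 := h.eq_zero_before hz one_pos le_rfl
  obtain ⟨m, hm⟩ := exists_nat_ge (2 * |-(t - 1)|)
  have := hall m (t - 1) h1 (-(t - 1)) (by linarith) 0
  rwa [add_neg_cancel] at this

lemma integral_sub_integral (h : Limit p w v) {φ : Eu n → ℝ} (hφ : ContDiff ℝ 2 φ)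
    (hcs : HasCompactSupport φ) (s t : ℝ) :
    (∫ y, v (y, t) * φ y) - ∫ y, v (y, s) * φ y
      = ∫ r in s..t, ∫ y, (v (y, r) * lap φ y + v (y, r) ^ p * φ y) := by
  have hcl : Continuous (lap φ) := continuous_lap hφ
  have hcφ : Continuous φ := hφ.continuous
  have hlz : ∀ y, y ∉ tsupport φ → lap φ y = 0 := fun y hy => lap_eq_zero_of_notMem hy
  have hφz : ∀ y, y ∉ tsupport φ → φ y = 0 := fun y hy => image_eq_zero_of_notMem_tsupport hy
  have hil : Integrable (fun y => |lap φ y| + |φ y|) :=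
    (hcl.abs.add hcφ.abs).integrable_of_hasCompactSupport
      (HasCompactSupport.intro hcs.isCompact fun y hy => by simp [hlz y hy, hφz y hy])
  have hiφ : Integrable φ := hcφ.integrable_of_hasCompactSupport hcs
  have hbd : ∀ a b y, |a| ≤ 1 → |b| ≤ 1 → ‖a * lap φ y + b * φ y‖ ≤ |lap φ y| + |φ y| := by
    intro a b y ha hb
    refine (norm_add_le _ _).trans ?_
    rw [norm_mul, norm_mul]
    exact add_le_add (mul_le_of_le_one_left (abs_nonneg _) ha)
      (mul_le_of_le_one_left (abs_nonneg _) hb)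
  have e1 : ∀ r, Tendsto (fun k => ∫ y, w k y r * φ y) atTop (𝓝 (∫ y, v (y, r) * φ y)) := by
    intro r
    refine tendsto_integral_of_dominated_convergence (fun y => ‖φ y‖)
      (fun k => ((h.seq.contx k r).mul hcφ).aestronglyMeasurable) hiφ.norm
      (fun k => Eventually.of_forall fun y => ?_)
      (Eventually.of_forall fun y => (h.tends (y, r)).mul_const _)
    rw [norm_mul]
    exact mul_le_of_le_one_left (norm_nonneg _) (h.seq.abs_le_one _ _ _)
  have e2 : ∀ r, Tendsto (fun k => ∫ y, (w k y r * lap φ y + w k y r ^ p * φ y)) atTop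
      (𝓝 (∫ y, (v (y, r) * lap φ y + v (y, r) ^ p * φ y))) := by
    intro r
    refine tendsto_integral_of_dominated_convergence _
      (fun k => (((h.seq.contx k r).mul hcl).add
        ((h.cont_seq_rpow k r).mul hcφ)).aestronglyMeasurable) hil
      (fun k => Eventually.of_forall fun y =>
        hbd _ _ _ (h.seq.abs_le_one _ _ _) (h.seq.abs_rpow_le_one h.hp _ _ _))
      (Eventually.of_forall fun y =>
        ((h.tends (y, r)).mul_const _).add ((h.tends_rpow (y, r)).mul_const _))
  have hcG : ∀ k, Continuous fun r => ∫ y, (w k y r * lap φ y + w k y r ^ p * φ y) := by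
    intro k
    refine continuous_of_dominated (bound := fun y => |lap φ y| + |φ y|)
      (fun r => (((h.seq.contx k r).mul hcl).add
        ((h.cont_seq_rpow k r).mul hcφ)).aestronglyMeasurable)
      (fun r => Eventually.of_forall fun y =>
        hbd _ _ _ (h.seq.abs_le_one _ _ _) (h.seq.abs_rpow_le_one h.hp _ _ _)) hil
      (Eventually.of_forall fun y => ?_)
    exact ((h.seq.contt k y).mul continuous_const).add
      (((h.seq.contt k y).rpow_const fun _ => Or.inr (by linarith [h.hp])).mul continuous_const)
  have e3 : Tendsto (fun k => ∫ r in s..t, ∫ y, (w k y r * lap φ y + w k y r ^ p * φ y)) atTop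
      (𝓝 (∫ r in s..t, ∫ y, (v (y, r) * lap φ y + v (y, r) ^ p * φ y))) := by
    refine intervalIntegral.tendsto_integral_filter_of_dominated_convergence
      (fun _ => ∫ y, (|lap φ y| + |φ y|))
      (Eventually.of_forall fun k => (hcG k).aestronglyMeasurable) (Eventually.of_forall fun k =>
      Eventually.of_forall fun r _ => ?_) intervalIntegrable_const
      (Eventually.of_forall fun r _ => e2 r)
    exact norm_integral_le_of_norm_le hil (Eventually.of_forall fun y =>
        hbd _ _ _ (h.seq.abs_le_one _ _ _) (h.seq.abs_rpow_le_one h.hp _ _ _))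
  refine tendsto_nhds_unique ((e1 t).sub (e1 s)) (e3.congr' ?_)
  obtain ⟨R, hR⟩ := hcs.isCompact.isBounded.subset_closedBall (0 : Eu n)
  filter_upwards [h.seq.weak (max R (max |s| |t| + 1))] with k hk
  refine intervalIntegral.integral_eq_sub_of_hasDerivAt
    (f := fun r => ∫ y, w k y r * φ y) (fun r hr => ?_)
    ((hcG k).intervalIntegrable _ _)
  refine hk r ?_ φ hφ hcs (hR.trans (Metric.closedBall_subset_closedBall (le_max_left _ _)))
  have h1 : |r| ≤ max |s| |t| := by
    rw [mem_uIcc] at hr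
    rcases hr with hr | hr
    · exact abs_le_max_abs_abs hr.1 hr.2
    · rw [max_comm]; exact abs_le_max_abs_abs hr.1 hr.2
  have h2 := le_max_right R (max |s| |t| + 1)
  exact abs_lt.1 (by linarith)

lemma hasDerivAt (h : Limit p w v) (x : Eu n) (t : ℝ) :
    Continuous (fun q : Eu n × ℝ => lap (fun y => v (y, q.2)) q.1) ∧
    (∀ t, ContDiff ℝ 2 fun x => v (x, t)) ∧
    HasDerivAt (fun s => v (x, s)) (lap (fun y => v (y, t)) x + v (x, t) ^ p) t := by
  obtain ⟨hC2, hlap⟩ := contDiff_of_mild h.hp h.cont h.nonneg h.le_one fun q => by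
    have := h.mild q.1 q.2 zero_le_one le_rfl
    exact this
  refine ⟨hlap, hC2, ?_⟩
  set H : Eu n × ℝ → ℝ := fun q => lap (fun y => v (y, q.2)) q.1 + v q ^ p with hH
  have hcH : Continuous H := hlap.add h.cont_rpow
  have key : ∀ s t x, v (x, t) - v (x, s) - ∫ r in s..t, H (x, r) = 0 := by
    intro s t
    have hcI : Continuous fun x => v (x, t) - v (x, s) - ∫ r in s..t, H (x, r) :=
      ((h.cont.comp (by fun_prop)).sub (h.cont.comp (by fun_prop))).sub
        (intervalIntegral.continuous_parametric_intervalIntegral_of_continuous'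
          (f := fun x r => H (x, r)) (by simpa [Function.uncurry_def] using hcH) s t)
    have hae := ae_eq_zero_of_integral_contDiff_smul_eq_zero (μ := volume)
      (hcI.locallyIntegrable) fun φ hφ hcs => by
        have hφ2 : ContDiff ℝ 2 φ := contDiff_infty.1 hφ 2
        have h1 := h.integral_sub_integral hφ2 hcs s t
        have hi : ∀ {f : Eu n → ℝ}, Continuous f → Integrable fun y => f y * φ y := fun hf =>
          (hf.mul hφ.continuous).integrable_of_hasCompactSupport hcs.mul_left
        have h2 : ∀ r, ∫ y, (v (y, r) * lap φ y + v (y, r) ^ p * φ y) = ∫ y, H (y, r) * φ y := by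
          intro r
          have hil : Integrable fun y => v (y, r) * lap φ y :=
            ((hC2 r).continuous.mul (continuous_lap hφ2)).integrable_of_hasCompactSupport
              (HasCompactSupport.intro hcs.isCompact fun y hy => by
                simp [lap_eq_zero_of_notMem hy])
          have hcp : Continuous fun y => v (y, r) ^ p := h.cont_rpow.comp (by fun_prop)
          rw [integral_add hil (hi hcp), integral_mul_lap_comm (hC2 r) hφ2 hcs,
            ← integral_add (hi (continuous_lap (hC2 r))) (hi hcp)]
          refine integral_congr_ae (Eventually.of_forall fun y => ?_)
          simp only [hH]; ring
        simp only [h2] at h1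
        have h3 : ∫ r in s..t, ∫ y, H (y, r) * φ y = ∫ y, (∫ r in s..t, H (y, r)) * φ y := by
          rw [intervalIntegral_integral_swap]
          · simp only [intervalIntegral.integral_mul_const]
          · have hc : Continuous (Function.uncurry fun (r : ℝ) (y : Eu n) => H (y, r) * φ y) := by
              exact (hcH.comp continuous_swap).mul (hφ.continuous.comp continuous_snd)
            have hon : IntegrableOn (Function.uncurry fun (r : ℝ) (y : Eu n) => H (y, r) * φ y)
                (uIcc s t ×ˢ tsupport φ) (volume.prod volume) :=
              hc.continuousOn.integrableOn_compact (isCompact_uIcc.prod hcs.isCompact)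
            rw [← Measure.restrict_univ (μ := (volume : Measure (Eu n))), Measure.prod_restrict]
            refine (IntegrableOn.of_forall_sdiff_eq_zero hon
              (measurableSet_uIoc.prod MeasurableSet.univ) fun q hq => ?_)
            have : q.2 ∉ tsupport φ := fun hn => hq.2 ⟨uIoc_subset_uIcc hq.1.1, hn⟩
            simp [Function.uncurry_def, image_eq_zero_of_notMem_tsupport this]
        rw [h3] at h1
        have hcJ : Continuous fun x => ∫ r in s..t, H (x, r) :=
          intervalIntegral.continuous_parametric_intervalIntegral_of_continuous'
          (f := fun x r => H (x, r)) (by simpa [Function.uncurry_def] using hcH) s t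
        have h4 : ∀ y, φ y • (v (y, t) - v (y, s) - ∫ r in s..t, H (y, r))
            = v (y, t) * φ y - v (y, s) * φ y - (∫ r in s..t, H (y, r)) * φ y := fun y => by
          rw [smul_eq_mul]; ring
        simp only [h4]
        have h5 : Integrable fun y => v (y, t) * φ y - v (y, s) * φ y :=
          (hi (hC2 t).continuous).sub (hi (hC2 s).continuous)
        rw [integral_sub h5 (hi hcJ),
          integral_sub (hi (hC2 t).continuous) (hi (hC2 s).continuous), h1, sub_self]
    exact congrFun ((hcI.ae_eq_iff_eq volume continuous_const).1 hae)
  have hcx : Continuous fun r => H (x, r) := hcH.comp (by fun_prop)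
  have h1 := (intervalIntegral.integral_hasDerivAt_right (hcx.intervalIntegrable t t)
    hcx.aestronglyMeasurable.stronglyMeasurableAtFilter hcx.continuousAt).const_add (v (x, t))
  refine h1.congr_of_eventuallyEq (Eventually.of_forall fun s => ?_)
  simp only
  linarith [key t s x]

lemma isPosSol (h : Limit p w v) (h0 : v (0, 0) ≠ 0) : IsPosSol n p v := by
  refine ⟨(h.hasDerivAt 0 0).2.1, fun x => ?_, fun x t => h.pos h0 _,
    fun x t => (h.hasDerivAt x t).2.2.deriv⟩
  rw [contDiff_one_iff_deriv]
  refine ⟨fun t => (h.hasDerivAt x t).2.2.differentiableAt, ?_⟩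
  rw [show deriv (fun t => v (x, t)) = fun t => lap (fun y => v (y, t)) x + v (x, t) ^ p from
    funext fun t => (h.hasDerivAt x t).2.2.deriv]
  have h1 := (h.hasDerivAt 0 0).1
  exact (h1.comp (f := fun t : ℝ => (x, t)) (by fun_prop)).add (h.cont_rpow.comp (by fun_prop))

end ApproxSeq.Limit

lemma ApproxSeq.exists_isPosSol {p c : ℝ} {w : ℕ → Eu n → ℝ → ℝ} (h : ApproxSeq p w)
    (hp : 1 < p) (hc : c ≠ 0) (h0 : ∀ k, w k 0 0 = c) :
    ∃ v : Eu n × ℝ → ℝ, IsPosSol n p v ∧ ∀ x t, v (x, t) ≤ 1 := by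
  obtain ⟨θ, hθ, v, hv, hlim⟩ := h.exists_subseq_limit hp
  have hL : Limit p (fun k => w (θ k)) v := ⟨h.subseq hθ, hp, hv, hlim⟩
  refine ⟨v, hL.isPosSol ?_, fun x t => hL.le_one _⟩
  have := hlim (0, 0)
  simp only [h0] at this
  rwa [← tendsto_nhds_unique tendsto_const_nhds this]

end ApproxSeqSolution

section WeakLocal

variable {n : ℕ}

open scoped Manifold ContDiff in
/-- The weak equation is local: it holds on a compact set once it holds near each point. -/
lemma WeakAt.of_locally {w f : Eu n → ℝ → ℝ} {K : Set (Eu n)} {t : ℝ}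
    (hw : ∀ s, Continuous fun y => w y s) (hf : Continuous fun y => f y t) (hK : IsCompact K)
    (h : ∀ x ∈ K, ∃ B, IsOpen B ∧ x ∈ B ∧ WeakAt w f B t) : WeakAt w f K t := by
  intro φ hφ hcs hsub
  choose! B hBo hxB hB using h
  obtain ⟨T, hTK, hT⟩ := hK.elim_nhds_subcover B fun x hx => (hBo x hx).mem_nhds (hxB x hx)
  obtain ⟨ρ, hρ⟩ := SmoothPartitionOfUnity.exists_isSubordinate 𝓘(ℝ, Eu n) hK.isClosed
    (fun i : T => B i) (fun i => hBo _ (hTK i i.2)) (hT.trans fun x hx => by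
      simp only [mem_iUnion] at hx ⊢
      obtain ⟨i, hi, hx⟩ := hx
      exact ⟨⟨i, hi⟩, hx⟩)
  set ψ : T → Eu n → ℝ := fun i y => ρ i y * φ y with hψ
  have hρc : ∀ i, ContDiff ℝ 2 fun y => ρ i y := fun i =>
    contDiff_infty.1 (ρ i).contMDiff.contDiff 2
  have hψc : ∀ i, ContDiff ℝ 2 (ψ i) := fun i => (hρc i).mul hφ
  have hψs : ∀ i, HasCompactSupport (ψ i) := fun i => hcs.mul_left
  have hψB : ∀ i, tsupport (ψ i) ⊆ B i := fun i => (tsupport_mul_subset_left).trans (hρ i)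
  have hsum : ∀ y, φ y = ∑ i, ψ i y := fun y => by
    by_cases hy : y ∈ tsupport φ
    · have := ρ.sum_eq_one (hsub hy)
      rw [finsum_eq_sum_of_fintype] at this
      simp only [hψ]
      rw [← Finset.sum_mul, this, one_mul]
    · simp [hψ, image_eq_zero_of_notMem_tsupport hy]
  have hlap : ∀ y, lap φ y = ∑ i, lap (ψ i) y := fun y => by
    rw [← lap_finset_sum _ (fun i _ => hψc i), show φ = fun z => ∑ i, ψ i z from funext hsum]
  have h1 : ∀ i, HasDerivAt (fun s => ∫ y, w y s * ψ i y)
      (∫ y, (w y t * lap (ψ i) y + f y t * ψ i y)) t := fun i =>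
    hB i (hTK i i.2) (ψ i) (hψc i) (hψs i) (hψB i)
  refine ((HasDerivAt.fun_sum (u := Finset.univ) fun i _ => h1 i).congr_of_eventuallyEq
    (Eventually.of_forall fun s => ?_)).congr_deriv ?_
  · simp only
    rw [← integral_finsetSum (f := fun i y => w y s * ψ i y) _ fun i _ =>
      ((hw s).mul (hψc i).continuous).integrable_of_hasCompactSupport (hψs i).mul_left]
    refine integral_congr_ae (Eventually.of_forall fun y => ?_)
    simp only
    rw [hsum y, Finset.mul_sum]
  · rw [← integral_finsetSum _ fun i _ => ?_]
    · refine integral_congr_ae (Eventually.of_forall fun y => ?_)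
      simp only
      rw [Finset.sum_add_distrib, ← Finset.mul_sum, ← Finset.mul_sum, ← hsum, ← hlap]
    · refine (((hw t).mul (continuous_lap (hψc i))).add
        (hf.mul (hψc i).continuous)).integrable_of_hasCompactSupport
        (HasCompactSupport.intro (hψs i).isCompact fun y hy => ?_)
      simp [image_eq_zero_of_notMem_tsupport hy, lap_eq_zero_of_notMem hy]

end WeakLocal

section Nice

variable {n : ℕ}

/-- Positive classical solutions, in curried form. -/
structure Sol (p : ℝ) (u : Eu n → ℝ → ℝ) : Prop where
  hp : 1 < p
  cx : ∀ t, ContDiff ℝ 2 fun y => u y t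
  ct : ∀ x, ContDiff ℝ 1 (u x)
  pos : ∀ x t, 0 < u x t
  eq : ∀ x t, deriv (u x) t = lap (fun y => u y t) x + u x t ^ p

/-- The points near which `u` is bounded and satisfies the weak equation. -/
def niceSet (p : ℝ) (u : Eu n → ℝ → ℝ) : Set (Eu n × ℝ) :=
  {q | ∃ B I, IsOpen B ∧ q.1 ∈ B ∧ IsOpen I ∧ q.2 ∈ I ∧
    (∃ M, ∀ y ∈ B, ∀ s ∈ I, u y s ≤ M) ∧ ∀ s ∈ I, WeakAt u (fun y s => u y s ^ p) B s}

lemma isOpen_niceSet {p : ℝ} {u : Eu n → ℝ → ℝ} : IsOpen (niceSet p u) := by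
  rw [isOpen_iff_mem_nhds]
  rintro ⟨x, t⟩ ⟨B, I, hB, hx, hI, ht, hM, hw⟩
  filter_upwards [(hB.prod hI).mem_nhds (mk_mem_prod hx ht)] with q hq
  exact ⟨B, I, hB, hq.1, hI, hq.2, hM, hw⟩

/-- Parabolic rescaling of `u` about `(x₀, t₀)` by the factor `c`. -/
noncomputable def resc (p : ℝ) (u : Eu n → ℝ → ℝ) (x₀ : Eu n) (t₀ c : ℝ) (y : Eu n) (s : ℝ) : ℝ :=
  c ^ (2 / (p - 1)) * u (x₀ + c • y) (t₀ + c ^ 2 * s)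

namespace Sol

variable {p : ℝ} {u : Eu n → ℝ → ℝ}

lemma continuous_x (h : Sol p u) (t : ℝ) : Continuous fun y => u y t := (h.cx t).continuous

lemma continuous_t (h : Sol p u) (x : Eu n) : Continuous (u x) := (h.ct x).continuous

lemma hp1 (h : Sol p u) : 0 < p - 1 := by linarith [h.hp]

lemma continuous_rpow_x (h : Sol p u) (t : ℝ) : Continuous fun y => u y t ^ p :=
  (h.continuous_x t).rpow_const fun _ => Or.inr (by linarith [h.hp])

lemma continuous_rpow_t (h : Sol p u) (x : Eu n) : Continuous fun t => u x t ^ p :=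
  (h.continuous_t x).rpow_const fun _ => Or.inr (by linarith [h.hp])

lemma weakAt (h : Sol p u) {K : Set (Eu n)} {t : ℝ} (hK : IsCompact K)
    (hKt : ∀ x ∈ K, (x, t) ∈ niceSet p u) : WeakAt u (fun y s => u y s ^ p) K t := by
  refine WeakAt.of_locally h.continuous_x (h.continuous_rpow_x t) hK fun x hx => ?_
  obtain ⟨B, I, hB, hx, -, ht, -, hw⟩ := hKt x hx
  exact ⟨B, hB, hx, hw t ht⟩

lemma exists_bound {K : Set (Eu n × ℝ)} (hK : IsCompact K) (hKn : K ⊆ niceSet p u) :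
    ∃ M, ∀ q ∈ K, u q.1 q.2 ≤ M := by
  refine hK.induction_on (p := fun S => ∃ M, ∀ q ∈ S, u q.1 q.2 ≤ M) ⟨0, by simp⟩ ?_ ?_ ?_
  · rintro s t hst ⟨M, hM⟩
    exact ⟨M, fun q hq => hM q (hst hq)⟩
  · rintro s t ⟨M, hM⟩ ⟨M', hM'⟩
    refine ⟨max M M', fun q hq => hq.elim (fun h => (hM q h).trans (le_max_left _ _))
      fun h => (hM' q h).trans (le_max_right _ _)⟩
  · intro q hq
    obtain ⟨B, I, hB, hx, hI, ht, ⟨M, hM⟩, -⟩ := hKn hq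
    exact ⟨B ×ˢ I, mem_nhdsWithin_of_mem_nhds ((hB.prod hI).mem_nhds ⟨hx, ht⟩),
      M, fun q hq => hM _ hq.1 _ hq.2⟩

lemma resc_pos (h : Sol p u) (x₀ : Eu n) (t₀ : ℝ) {c : ℝ} (hc : 0 < c) (y : Eu n) (s : ℝ) :
    0 < resc p u x₀ t₀ c y s := mul_pos (Real.rpow_pos_of_pos hc _) (h.pos _ _)

lemma resc_rpow (h : Sol p u) (x₀ : Eu n) (t₀ : ℝ) {c : ℝ} (hc : 0 < c) (y : Eu n) (s : ℝ) :
    resc p u x₀ t₀ c y s ^ p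
      = c ^ (2 / (p - 1)) * c ^ 2 * u (x₀ + c • y) (t₀ + c ^ 2 * s) ^ p := by
  have hp := h.hp1
  unfold resc
  rw [Real.mul_rpow (Real.rpow_nonneg hc.le _) (h.pos _ _).le, ← Real.rpow_mul hc.le]
  congr 1
  rw [← Real.rpow_natCast, ← Real.rpow_add hc]
  congr 1
  push_cast
  field_simp
  ring

lemma continuous_resc_x (h : Sol p u) (x₀ : Eu n) (t₀ c s : ℝ) :
    Continuous fun y => resc p u x₀ t₀ c y s :=
  continuous_const.mul ((h.continuous_x _).comp (by fun_prop))

lemma continuous_resc_t (h : Sol p u) (x₀ : Eu n) (t₀ c : ℝ) (y : Eu n) :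
    Continuous (resc p u x₀ t₀ c y) :=
  continuous_const.mul ((h.continuous_t _).comp (by fun_prop))

lemma weakAt_resc (h : Sol p u) {x₀ : Eu n} {t₀ c R s : ℝ} (hc : 0 < c)
    (hn : ∀ y ∈ Metric.closedBall (0 : Eu n) R, (x₀ + c • y, t₀ + c ^ 2 * s) ∈ niceSet p u) :
    WeakAt (resc p u x₀ t₀ c) (fun y s => resc p u x₀ t₀ c y s ^ p)
      (Metric.closedBall 0 R) s := by
  have h1 : WeakAt u (fun y s => u y s ^ p) ((fun y => x₀ + c • y) '' Metric.closedBall 0 R)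
      (t₀ + c ^ 2 * s) := by
    refine h.weakAt ((isCompact_closedBall (0 : Eu n) R).image (by fun_prop)) ?_
    rintro _ ⟨y, hy, rfl⟩
    exact hn y hy
  refine ((h1.affine (κ := c ^ (2 / (p - 1))) hc).mono (subset_preimage_image _ _)).congr
    (Eventually.of_forall fun s y _ => rfl) fun y _ => (h.resc_rpow x₀ t₀ hc y s).symm

lemma weakCyl_resc (h : Sol p u) {x₀ : Eu n} {t₀ c R s₀ s₁ : ℝ} (hc : 0 < c)
    (hn : ∀ y ∈ Metric.closedBall (0 : Eu n) R, ∀ s ∈ Icc s₀ s₁,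
      (x₀ + c • y, t₀ + c ^ 2 * s) ∈ niceSet p u) :
    WeakCyl (resc p u x₀ t₀ c) (fun y s => resc p u x₀ t₀ c y s ^ p) R s₀ s₁ := by
  have hp0 : 0 ≤ p := by linarith [h.hp]
  obtain ⟨M, hM⟩ := exists_bound (p := p) (u := u)
    (((isCompact_closedBall (0 : Eu n) R).prod (isCompact_Icc (a := s₀) (b := s₁))).image
      (f := fun q : Eu n × ℝ => (x₀ + c • q.1, t₀ + c ^ 2 * q.2)) (by fun_prop)) (by
      rintro _ ⟨q, hq, rfl⟩
      exact hn _ hq.1 _ hq.2)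
  have hM' : ∀ y ∈ Metric.closedBall (0 : Eu n) R, ∀ s ∈ Icc s₀ s₁,
      resc p u x₀ t₀ c y s ≤ c ^ (2 / (p - 1)) * M := fun y hy s hs =>
    mul_le_mul_of_nonneg_left (hM _ ⟨(y, s), ⟨hy, hs⟩, rfl⟩) (Real.rpow_nonneg hc.le _)
  refine ⟨fun t => h.continuous_resc_x _ _ _ _, fun y => h.continuous_resc_t _ _ _ _,
    fun t => (h.continuous_resc_x _ _ _ _).rpow_const fun _ => Or.inr hp0,
    ⟨c ^ (2 / (p - 1)) * M, fun y hy t ht => ?_⟩,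
    ⟨(c ^ (2 / (p - 1)) * M) ^ p, fun y hy t ht => ?_⟩, fun t ht φ hφ hs => ?_⟩
  · rw [abs_of_pos (h.resc_pos _ _ hc _ _)]
    exact hM' y hy t ht
  · rw [abs_of_nonneg (Real.rpow_nonneg (h.resc_pos _ _ hc _ _).le _)]
    exact Real.rpow_le_rpow (h.resc_pos _ _ hc _ _).le (hM' y hy t ht) hp0
  · exact h.weakAt_resc hc (fun y hy => hn y hy t (Ioo_subset_Icc_self ht)) φ hφ
      (hasCompactSupport_of_subset_closedBall hs) hs

end Sol

end Nice

section Doubling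

variable {n : ℕ}

/-- The parabolic distance. -/
noncomputable def pdist (q z : Eu n × ℝ) : ℝ := max ‖q.1 - z.1‖ (√|q.2 - z.2|)

lemma pdist_nonneg (q z : Eu n × ℝ) : 0 ≤ pdist q z := le_max_of_le_left (norm_nonneg _)

lemma pdist_self (q : Eu n × ℝ) : pdist q q = 0 := by simp [pdist]

lemma pdist_comm (q z : Eu n × ℝ) : pdist q z = pdist z q := by
  simp only [pdist, norm_sub_rev q.1, abs_sub_comm q.2]

lemma pdist_triangle (a b c : Eu n × ℝ) : pdist a c ≤ pdist a b + pdist b c := by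
  refine max_le ?_ ?_
  · refine (norm_sub_le_norm_sub_add_norm_sub a.1 b.1 c.1).trans ?_
    exact add_le_add (le_max_left _ _) (le_max_left _ _)
  · refine (Real.sqrt_le_sqrt (abs_sub_le a.2 b.2 c.2)).trans ?_
    refine le_trans ?_ (add_le_add (le_max_right _ _) (le_max_right _ _))
    rw [Real.sqrt_le_left (by positivity), add_sq, Real.sq_sqrt (abs_nonneg _),
      Real.sq_sqrt (abs_nonneg _)]
    have : 0 ≤ 2 * √|a.2 - b.2| * √|b.2 - c.2| := by positivity
    linarith

lemma continuous_pdist (z : Eu n × ℝ) : Continuous fun q => pdist q z := by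
  unfold pdist
  fun_prop

lemma pdist_le_iff {q z : Eu n × ℝ} {r : ℝ} (hr : 0 ≤ r) :
    pdist q z ≤ r ↔ ‖q.1 - z.1‖ ≤ r ∧ |q.2 - z.2| ≤ r ^ 2 := by
  rw [pdist, max_le_iff, Real.sqrt_le_left hr]

lemma isCompact_pdist_le (z : Eu n × ℝ) (r : ℝ) : IsCompact {q | pdist q z ≤ r} := by
  refine ((isCompact_closedBall z.1 r).prod
    (isCompact_closedBall z.2 (r ^ 2))).of_isClosed_subset
    (isClosed_le (continuous_pdist z) continuous_const) fun q hq => ?_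
  have hr : 0 ≤ r := (pdist_nonneg q z).trans hq
  obtain ⟨h1, h2⟩ := (pdist_le_iff hr).1 hq
  exact ⟨by rwa [mem_closedBall_iff_norm], by rwa [mem_closedBall_iff_norm]⟩

variable {p : ℝ} {u : Eu n → ℝ → ℝ}

/-- The reciprocal of the natural parabolic length scale of a solution at a point. -/
noncomputable def rate (p : ℝ) (u : Eu n → ℝ → ℝ) (q : Eu n × ℝ) : ℝ := u q.1 q.2 ^ ((p - 1) / 2)

lemma Sol.rate_pos (h : Sol p u) (q : Eu n × ℝ) : 0 < rate p u q :=
  Real.rpow_pos_of_pos (h.pos _ _) _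

lemma Sol.resc_eq (h : Sol p u) (x₀ : Eu n) (t₀ : ℝ) {c : ℝ} (hc : 0 < c) (y : Eu n) (s : ℝ) :
    resc p u x₀ t₀ c y s = (c * rate p u (x₀ + c • y, t₀ + c ^ 2 * s)) ^ (2 / (p - 1)) := by
  have hp := h.hp1
  rw [Real.mul_rpow hc.le (h.rate_pos _).le, rate, ← Real.rpow_mul (h.pos _ _).le]
  rw [show (p - 1) / 2 * (2 / (p - 1)) = 1 by field_simp, Real.rpow_one]
  rfl

lemma Sol.exists_doubling (h : Sol p u) {z₀ : Eu n × ℝ} {k : ℝ} (hk : 0 < k)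
    (hn : {q | pdist q z₀ ≤ 2 * k / rate p u z₀} ⊆ niceSet p u) :
    ∃ z ρ, k / (2 * rate p u z) ≤ ρ ∧ ∀ q, pdist q z ≤ ρ →
      q ∈ niceSet p u ∧ rate p u q ≤ 4 * rate p u z := by
  set D := 2 * k / rate p u z₀ with hD
  have hr0 := h.rate_pos z₀
  have hD0 : 0 < D := by positivity
  obtain ⟨M, hM⟩ := Sol.exists_bound (isCompact_pdist_le z₀ D) hn
  have hrM : ∀ q, pdist q z₀ ≤ D → rate p u q ≤ M ^ ((p - 1) / 2) := fun q hq =>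
    Real.rpow_le_rpow (h.pos _ _).le (hM q hq) (by linarith [h.hp1])
  set g : Eu n × ℝ → ℝ := fun q => rate p u q * (D - pdist q z₀) with hg
  set S := sSup (g '' {q | pdist q z₀ ≤ D}) with hS
  have hbdd : BddAbove (g '' {q | pdist q z₀ ≤ D}) := by
    refine ⟨M ^ ((p - 1) / 2) * D, ?_⟩
    rintro _ ⟨q, hq, rfl⟩
    exact mul_le_mul (hrM q hq) (by linarith [pdist_nonneg q z₀]) (sub_nonneg.2 hq)
      ((h.rate_pos q).le.trans (hrM q hq))
  have hz0 : pdist z₀ z₀ ≤ D := by rw [pdist_self]; exact hD0.le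
  have hgz : g z₀ = 2 * k := by
    simp only [hg, pdist_self, sub_zero, hD]
    field_simp
  have hS0 : 2 * k ≤ S := hgz ▸ le_csSup hbdd ⟨z₀, hz0, rfl⟩
  obtain ⟨_, ⟨z, hz, rfl⟩, hzS⟩ := exists_lt_of_lt_csSup (⟨_, z₀, hz0, rfl⟩ :
    (g '' {q | pdist q z₀ ≤ D}).Nonempty) (show S / 2 < S by linarith)
  have hrz := h.rate_pos z
  refine ⟨z, (D - pdist z z₀) / 2, ?_, fun q hq => ?_⟩
  · rw [div_le_iff₀ (by positivity)]
    simp only [hg] at hzS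
    linarith
  · have h1 := pdist_triangle q z z₀
    have hz' : pdist z z₀ ≤ D := hz
    have hq' : pdist q z₀ ≤ D := by linarith
    refine ⟨hn hq', ?_⟩
    have h2 : g q ≤ S := le_csSup hbdd ⟨q, hq', rfl⟩
    have h3 : 0 < D - pdist z z₀ := by
      have : 0 < g z := by linarith
      exact pos_of_mul_pos_right this hrz.le
    have h4 : rate p u q * ((D - pdist z z₀) / 2) ≤ g q :=
      mul_le_mul_of_nonneg_left (by linarith) (h.rate_pos q).le
    have h5 : rate p u q * ((D - pdist z z₀) / 2)
        ≤ 4 * rate p u z * ((D - pdist z z₀) / 2) := by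
      simp only [hg] at hzS h2 h4
      linarith
    exact le_of_mul_le_mul_right h5 (by linarith)

lemma Sol.exists_approx (h : Sol p u) {z₀ : Eu n × ℝ} {k : ℝ} (hk : 1 ≤ k)
    (hn : {q | pdist q z₀ ≤ 2 * k / rate p u z₀} ⊆ niceSet p u) :
    ∃ w : Eu n → ℝ → ℝ, (∀ t, Continuous fun y => w y t) ∧ (∀ y, Continuous (w y)) ∧
      (∀ y t, 0 ≤ w y t) ∧ (∀ y t, w y t ≤ 1) ∧ w 0 0 = (1 / 4 : ℝ) ^ (2 / (p - 1)) ∧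
      ∀ t ∈ Ioo (-k) k, WeakAt w (fun y s => w y s ^ p) (Metric.closedBall 0 k) t := by
  obtain ⟨z, ρ, hρ, hz⟩ := h.exists_doubling (by linarith) hn
  have hr := h.rate_pos z
  have hp := h.hp1
  set c := 1 / (4 * rate p u z) with hc
  have hc0 : 0 < c := by positivity
  have hck : c * k ≤ ρ := by
    refine le_trans ?_ hρ
    rw [hc]
    have : 1 / (4 * rate p u z) * k = k / (2 * rate p u z) / 2 := by field_simp; norm_num
    rw [this]
    have : 0 < k / (2 * rate p u z) := by positivity
    linarith
  have hin : ∀ y ∈ Metric.closedBall (0 : Eu n) k, ∀ s ∈ Ioo (-k) k,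
      (z.1 + c • y, z.2 + c ^ 2 * s) ∈ niceSet p u ∧
        rate p u (z.1 + c • y, z.2 + c ^ 2 * s) ≤ 4 * rate p u z := by
    intro y hy s hs
    refine hz _ (le_trans ?_ hck)
    rw [pdist_le_iff (by positivity)]
    simp only [add_sub_cancel_left]
    rw [mem_closedBall_zero_iff] at hy
    constructor
    · rw [norm_smul, Real.norm_of_nonneg hc0.le]
      gcongr
    · rw [abs_mul, abs_of_pos (by positivity), mul_pow]
      gcongr
      have := abs_lt.2 hs
      nlinarith
  set v := resc p u z.1 z.2 c with hv
  have hv1 : ∀ y ∈ Metric.closedBall (0 : Eu n) k, ∀ s ∈ Ioo (-k) k, v y s ≤ 1 := by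
    intro y hy s hs
    rw [hv, h.resc_eq _ _ hc0]
    refine Real.rpow_le_one (mul_nonneg hc0.le (h.rate_pos _).le) ?_ (by positivity)
    refine (mul_le_mul_of_nonneg_left (hin y hy s hs).2 hc0.le).trans_eq ?_
    rw [hc]; field_simp
  have hvw : ∀ y ∈ Metric.closedBall (0 : Eu n) k, ∀ s ∈ Ioo (-k) k, v y s = min (v y s) 1 :=
    fun y hy s hs => (min_eq_left (hv1 y hy s hs)).symm
  refine ⟨fun y s => min (v y s) 1, fun t => (h.continuous_resc_x _ _ _ _).min continuous_const,
    fun y => (h.continuous_resc_t _ _ _ _).min continuous_const,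
    fun y t => le_min (h.resc_pos _ _ hc0 _ _).le zero_le_one, fun y t => min_le_right _ _, ?_, ?_⟩
  · beta_reduce
    rw [← hvw 0 (by simp; linarith) 0 ⟨by linarith, by linarith⟩, hv, h.resc_eq _ _ hc0]
    congr 1
    simp only [smul_zero, add_zero, mul_zero, hc]
    field_simp
  · intro t ht
    refine (h.weakAt_resc hc0 fun y hy => (hin y hy t ht).1).congr ?_ fun y hy => ?_
    · filter_upwards [Ioo_mem_nhds ht.1 ht.2] with s hs y hy
      exact hvw y hy s hs
    · simp only
      rw [← hvw y hy t ht]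

lemma Sol.exists_isPosSol (h : Sol p u)
    (hn : ∀ k : ℕ, ∃ z, {q | pdist q z ≤ 2 * (k + 1) / rate p u z} ⊆ niceSet p u) :
    ∃ v : Eu n × ℝ → ℝ, IsPosSol n p v ∧ ∀ x t, v (x, t) ≤ 1 := by
  choose z hz using hn
  choose w h1 h2 h3 h4 h5 h6 using fun k : ℕ =>
    h.exists_approx (by linarith [Nat.cast_nonneg (α := ℝ) k]) (hz k)
  have hw : ApproxSeq p w := by
    refine ⟨h1, h2, h3, h4, fun R => ?_⟩
    obtain ⟨N, hN⟩ := exists_nat_ge R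
    filter_upwards [eventually_ge_atTop N] with k hk t ht
    have hk' : R ≤ k + 1 := by
      have : (N : ℝ) ≤ k := by exact_mod_cast hk
      linarith
    exact (h6 k t ⟨by linarith [ht.1], by linarith [ht.2]⟩).mono
      (Metric.closedBall_subset_closedBall hk')
  exact hw.exists_isPosSol h.hp (by positivity) h5

end Doubling

section Baire

variable {n : ℕ} {p : ℝ} {u : Eu n → ℝ → ℝ}

lemma Sol.continuous_deriv_x (h : Sol p u) (t : ℝ) : Continuous fun y => deriv (u y) t := by
  simp only [h.eq]
  exact (continuous_lap (h.cx t)).add (h.continuous_rpow_x t)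

/-- By Baire's theorem, a solution is bounded along time slices and lines through the bad points
close to some bad point. -/
lemma Sol.exists_bound_near_bad (h : Sol p u) (hne : (niceSet p u)ᶜ.Nonempty) :
    ∃ ζ ∉ niceSet p u, ∃ ρ M, 0 < ρ ∧ ρ ≤ 1 ∧ ∀ q ∉ niceSet p u, pdist q ζ ≤ ρ →
      (∀ y, ‖y - q.1‖ ≤ ρ → u y q.2 ≤ M ∧ |deriv (u y) q.2| ≤ M) ∧
      ∀ s, |s - q.2| ≤ ρ ^ 2 → u q.1 s ≤ M := by
  set Γ := (niceSet p u)ᶜ with hΓ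
  have hΓc : IsClosed Γ := isOpen_niceSet.isClosed_compl
  have : CompleteSpace Γ := hΓc.completeSpace_coe
  have : Nonempty Γ := hne.to_subtype
  set A : ℕ → Set (Eu n × ℝ) := fun m => {q | (∀ y, ‖y - q.1‖ < 1 / (m + 1 : ℝ) →
    u y q.2 ≤ m ∧ |deriv (u y) q.2| ≤ m) ∧ ∀ s, |s - q.2| < 1 / (m + 1 : ℝ) → u q.1 s ≤ m} with hA
  have hAc : ∀ m, IsClosed (A m) := fun m => by
    simp only [hA, ofPred_and, ofPred_forall]
    refine IsClosed.inter (isClosed_iInter fun y => isClosed_imp ?_ ?_)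
      (isClosed_iInter fun s => isClosed_imp ?_ ?_)
    · exact isOpen_lt (by fun_prop) continuous_const
    · have h1 : IsClosed {q : Eu n × ℝ | u y q.2 ≤ m} :=
        isClosed_le ((h.continuous_t y).comp continuous_snd) continuous_const
      have h2 : IsClosed {q : Eu n × ℝ | |deriv (u y) q.2| ≤ m} :=
        isClosed_le (((h.ct y).continuous_deriv le_rfl).comp continuous_snd).abs continuous_const
      exact h1.inter h2
    · exact isOpen_lt (by fun_prop) continuous_const
    · exact isClosed_le ((h.continuous_x s).comp continuous_fst) continuous_const
  have hcov : ⋃ m, (Subtype.val ⁻¹' A m : Set Γ) = univ := by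
    refine eq_univ_of_forall fun q => ?_
    obtain ⟨M₁, h1⟩ := (isCompact_closedBall q.1.1 1).bddAbove_image
      (h.continuous_x q.1.2).continuousOn
    obtain ⟨M₂, h2⟩ := (isCompact_closedBall q.1.1 1).bddAbove_image
      (h.continuous_deriv_x q.1.2).abs.continuousOn
    obtain ⟨M₃, h3⟩ := (isCompact_closedBall q.1.2 1).bddAbove_image
      (h.continuous_t q.1.1).continuousOn
    obtain ⟨m, hm⟩ := exists_nat_ge (max M₁ (max M₂ M₃))
    obtain ⟨hm1, hm2, hm3⟩ : M₁ ≤ m ∧ M₂ ≤ m ∧ M₃ ≤ m := by simpa using hm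
    have h1m : 1 / (m + 1 : ℝ) ≤ 1 := by
      rw [div_le_one (by positivity)]
      linarith [Nat.cast_nonneg (α := ℝ) m]
    refine mem_iUnion.2 ⟨m, fun y hy => ?_, fun s hs => ?_⟩
    · have hy' : y ∈ Metric.closedBall q.1.1 1 := by
        rw [mem_closedBall_iff_norm]
        linarith
      exact ⟨(h1 (mem_image_of_mem _ hy')).trans hm1, (h2 (mem_image_of_mem _ hy')).trans hm2⟩
    · have hs' : s ∈ Metric.closedBall q.1.2 1 := by
        rw [mem_closedBall_iff_norm, Real.norm_eq_abs]
        linarith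
      exact (h3 (mem_image_of_mem _ hs')).trans hm3
  obtain ⟨m, ζ, hζ⟩ := nonempty_interior_of_iUnion_of_closed
    (fun m => (hAc m).preimage continuous_subtype_val) hcov
  obtain ⟨ε, hε, hball⟩ := Metric.mem_nhds_iff.1 (mem_interior_iff_mem_nhds.1 hζ)
  have hm0 : (0 : ℝ) < 1 / (m + 1) := by positivity
  have hm1 : 1 / (m + 1 : ℝ) ≤ 1 := by
    rw [div_le_one (by positivity)]
    linarith [Nat.cast_nonneg (α := ℝ) m]
  set ρ := min (ε / 2) (1 / (m + 1 : ℝ) / 2) with hρ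
  have hρ0 : 0 < ρ := lt_min (by positivity) (by positivity)
  have hρε : ρ < ε := (min_le_left _ _).trans_lt (by linarith)
  have hρm : ρ < 1 / (m + 1 : ℝ) := (min_le_right _ _).trans_lt (by linarith)
  have hρsq : ρ ^ 2 ≤ ρ := by nlinarith
  refine ⟨ζ, ζ.2, ρ, m, hρ0, by linarith, fun q hq hqζ => ?_⟩
  obtain ⟨h1, h2⟩ := (pdist_le_iff hρ0.le).1 hqζ
  have hqA : (⟨q, hq⟩ : Γ) ∈ (Subtype.val ⁻¹' A m : Set Γ) := hball <| by
    rw [Metric.mem_ball, Subtype.dist_eq, Prod.dist_eq, dist_eq_norm, Real.dist_eq]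
    exact max_lt (by linarith) (by linarith)
  exact ⟨fun y hy => hqA.1 y (by linarith), fun s hs => hqA.2 s (by linarith)⟩

end Baire

section LocalBound

variable {n : ℕ} {p : ℝ} {u : Eu n → ℝ → ℝ}

lemma pdist_affine_le {x₀ y : Eu n} {t₀ s c a : ℝ} (hc : 0 ≤ c) (hy : ‖y‖ ≤ a)
    (hs : |s| ≤ a ^ 2) : pdist (x₀ + c • y, t₀ + c ^ 2 * s) (x₀, t₀) ≤ c * a := by
  have ha : 0 ≤ a := (norm_nonneg y).trans hy
  rw [pdist_le_iff (by positivity)]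
  constructor
  · simp only [add_sub_cancel_left, norm_smul, Real.norm_of_nonneg hc]
    gcongr
  · simp only [add_sub_cancel_left, abs_mul, abs_of_nonneg (sq_nonneg c), mul_pow]
    gcongr

lemma eq_of_pdist_le_zero {q z : Eu n × ℝ} (h : pdist q z ≤ 0) : q = z := by
  obtain ⟨h1, h2⟩ := (pdist_le_iff le_rfl).1 h
  ext1
  · simpa [sub_eq_zero] using h1
  · simpa [sub_eq_zero] using h2

lemma Sol.mul_rate_lt (h : Sol p u) {κ : ℝ} (hk : ∀ z, ¬ {q | pdist q z ≤ 2 * κ / rate p u z} ⊆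
    niceSet p u) {z : Eu n × ℝ} {e : ℝ} (he : {q | pdist q z ≤ e} ⊆ niceSet p u) :
    e * rate p u z < 2 * κ := by
  by_contra! hcon
  refine hk z fun q hq => he (le_trans (show pdist q z ≤ _ from hq) ?_ : pdist q z ≤ e)
  rwa [div_le_iff₀ (h.rate_pos z)]

lemma Sol.exists_le_slice (n : ℕ) (κ : ℝ) : ∃ C, 0 < C ∧ ∀ (p : ℝ) (u : Eu n → ℝ → ℝ), Sol p u →
    (∀ z, ¬ {q | pdist q z ≤ 2 * κ / rate p u z} ⊆ niceSet p u) →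
    ∀ z d b I, 0 < d → {q | pdist q z ≤ d} ⊆ niceSet p u → 0 ≤ b → b ≤ 1 / 4 →
      ∫ y in Metric.closedBall 0 1, resc p u z.1 z.2 d y b ≤ I →
      d ^ (2 / (p - 1)) * u z.1 z.2 ≤ C * I := by
  obtain ⟨C₂, hC₂, H₂⟩ := exists_integral_le_integral n
  obtain ⟨C₃, hC₃, H₃⟩ := exists_point_le_integral n ((4 * κ) ^ 2) (sq_nonneg _)
  refine ⟨C₃ * C₂, by positivity, fun p u h hk z d b I hd hdn hb0 hb hI => ?_⟩
  have hp := h.hp1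
  set w := resc p u z.1 z.2 d with hw
  have hw0 : ∀ y s, 0 < w y s := fun y s => h.resc_pos _ _ hd y s
  have hf0 : ∀ y s, 0 ≤ w y s ^ p := fun y s => Real.rpow_nonneg (hw0 y s).le _
  have hcyl : WeakCyl w (fun y s => w y s ^ p) 1 (-1 / 4) (1 / 4) := by
    refine h.weakCyl_resc hd fun y hy s hs => hdn ?_
    refine (pdist_affine_le hd.le (mem_closedBall_zero_iff.1 hy) ?_).trans (mul_one d).le
    rw [abs_le]
    constructor <;> linarith [hs.1, hs.2]
  have key : w 0 0 ≤ C₃ * (C₂ * I) := by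
    refine H₃ w _ _ (fun y s => (hw0 y s).le) ?_ (hcyl.mono (by norm_num) (by norm_num)
      (by norm_num)) fun r hr => ?_
    · intro y hy t ht
      have hy := mem_closedBall_zero_iff.1 hy
      have hq : pdist (z.1 + d • y, z.2 + d ^ 2 * t) z ≤ d * (1 / 2) := by
        refine pdist_affine_le hd.le hy ?_
        rw [abs_le]
        constructor <;> linarith [ht.1, ht.2]
      set q : Eu n × ℝ := (z.1 + d • y, z.2 + d ^ 2 * t)
      have hr : d / 2 * rate p u q < 2 * κ := h.mul_rate_lt hk fun q' hq' => hdn <| by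
        have hq' : pdist q' q ≤ d / 2 := hq'
        have := pdist_triangle q' q z
        change pdist q' z ≤ d
        linarith
      have h0 := h.rate_pos q
      have hpow : w y t ^ (p - 1) = (d * rate p u q) ^ 2 := by
        rw [hw, h.resc_eq _ _ hd, ← Real.rpow_mul (mul_pos hd h0).le, div_mul_cancel₀ _ hp.ne']
        exact Real.rpow_two _
      have hsq : w y t ^ (p - 1) ≤ (4 * κ) ^ 2 := by
        rw [hpow]
        exact pow_le_pow_left₀ (mul_pos hd h0).le (by linarith) 2
      calc w y t ^ p = w y t ^ (p - 1) * w y t := by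
            rw [← Real.rpow_add_one (hw0 y t).ne', sub_add_cancel]
        _ ≤ _ := mul_le_mul_of_nonneg_right hsq (hw0 y t).le
    · refine (H₂ w _ r b (by linarith [hr.2]) (by linarith [hr.1]) (fun y s => (hw0 y s).le) hf0
        (hcyl.mono le_rfl (by linarith [hr.1]) hb)).trans ?_
      exact mul_le_mul_of_nonneg_left hI hC₂.le
  rw [mul_assoc]
  refine le_of_eq_of_le ?_ key
  simp [hw, resc]

lemma exists_nearest_bad {ζ : Eu n × ℝ} (hζ : ζ ∉ niceSet p u) (z : Eu n × ℝ) :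
    ∃ q ∉ niceSet p u, pdist q z ≤ pdist ζ z ∧ ∀ q', pdist q' z < pdist q z → q' ∈ niceSet p u := by
  obtain ⟨q, hq, hmin⟩ := ((isCompact_pdist_le z (pdist ζ z)).inter_right
    (isOpen_niceSet (p := p) (u := u)).isClosed_compl).exists_isMinOn ⟨ζ, (le_rfl : pdist ζ z ≤ _), hζ⟩
    (continuous_pdist z).continuousOn
  refine ⟨q, hq.2, hq.1, fun q' hq' => ?_⟩
  by_contra hcon
  exact (hmin ⟨hq'.le.trans hq.1, hcon⟩ : pdist q z ≤ pdist q' z).not_gt hq'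

lemma Sol.setIntegral_resc_le (h : Sol p u) {ξ x : Eu n} {t d s : ℝ} (hd : 0 < d)
    (hx : ‖x - ξ‖ ≤ 2 * d) : ∫ y in Metric.closedBall 0 1, resc p u x t d y s ≤
      ∫ y in Metric.closedBall 0 3, resc p u ξ t d y s := by
  set a := d⁻¹ • (x - ξ) with ha
  have han : ‖a‖ ≤ 2 := by
    rw [ha, norm_smul, norm_inv, Real.norm_of_nonneg hd.le, inv_mul_le_iff₀ hd]
    linarith
  have h1 : ∀ y, resc p u x t d y s = resc p u ξ t d (y + a) s := fun y => by
    have : x + d • y = ξ + d • (y + a) := by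
      rw [ha, smul_add, smul_inv_smul₀ hd.ne']
      abel
    rw [resc, resc, this]
  have h2 : (fun y : Eu n => y + a) ⁻¹' Metric.closedBall a 1 = Metric.closedBall 0 1 := by
    ext y
    simp
  simp only [h1]
  rw [← h2, (measurePreserving_add_right volume a).setIntegral_preimage_emb
    (measurableEmbedding_addRight a) (fun y => resc p u ξ t d y s)]
  refine setIntegral_mono_set (integrableOn_closedBall (h.continuous_resc_x _ _ _ _) 3)
    (Eventually.of_forall fun y => (h.resc_pos _ _ hd _ _).le)
    (Metric.closedBall_subset_closedBall' ?_).eventuallyLE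
  rw [dist_zero_right]
  linarith

lemma Sol.exists_bound_near (h : Sol p u) {κ : ℝ}
    (hk : ∀ z, ¬ {q | pdist q z ≤ 2 * κ / rate p u z} ⊆ niceSet p u) {ζ : Eu n × ℝ}
    (hζ : ζ ∉ niceSet p u) {ρ M : ℝ} (hρ : 0 < ρ)
    (hc : ∀ q ∉ niceSet p u, pdist q ζ ≤ ρ → (∀ y, ‖y - q.1‖ ≤ ρ → u y q.2 ≤ M) ∧
      ∀ s, |s - q.2| ≤ ρ ^ 2 → u q.1 s ≤ M) :
    ∃ C, ∀ z, pdist z ζ ≤ ρ / 100 → u z.1 z.2 ≤ C := by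
  obtain ⟨C₁, hC₁, H₁⟩ := Sol.exists_le_slice n κ
  obtain ⟨C₀, hC₀, H₀⟩ := exists_integral_le_point n
  set V := volume.real (Metric.closedBall (0 : Eu n) 1) with hV
  have hM : 0 < M := (h.pos ζ.1 ζ.2).trans_le
    ((hc ζ hζ (by rw [pdist_self]; exact hρ.le)).1 ζ.1 (by simpa using hρ.le))
  have hV0 : 0 ≤ V := measureReal_nonneg
  refine ⟨max M (C₁ * ((V + C₀) * M)), fun z hz => ?_⟩
  by_cases hzn : z ∉ niceSet p u
  · refine le_max_of_le_left ((hc z hzn (by linarith)).1 z.1 (by simpa using hρ.le))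
  refine le_max_of_le_right ?_
  rw [not_not] at hzn
  obtain ⟨ξ, hξ, hξD, hmin⟩ := exists_nearest_bad hζ z
  set D := pdist ξ z with hD
  have hD0 : 0 < D := by
    by_contra! hcon
    exact hξ (eq_of_pdist_le_zero hcon ▸ hzn)
  rw [pdist_comm ζ] at hξD
  obtain ⟨d, hd⟩ : ∃ d, d = 2 * D / 3 := ⟨_, rfl⟩
  have hd0 : 0 < d := by rw [hd]; positivity
  have hdn : {q | pdist q z ≤ d} ⊆ niceSet p u := fun q hq => hmin q <| by
    have hq : pdist q z ≤ d := hq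
    linarith
  obtain ⟨hξ1, hξ2⟩ := (pdist_le_iff hD0.le).1 hD.ge
  have hβ : 0 < d ^ (2 / (p - 1)) := Real.rpow_pos_of_pos hd0 _
  obtain ⟨hz1, hz2⟩ := (pdist_le_iff (by positivity)).1 hz
  suffices hs : ∃ b I, 0 ≤ b ∧ b ≤ 1 / 4 ∧ I ≤ (V + C₀) * (d ^ (2 / (p - 1)) * M) ∧
      ∫ y in Metric.closedBall 0 1, resc p u z.1 z.2 d y b ≤ I by
    obtain ⟨b, I, hb0, hb1, hI, hinteg⟩ := hs
    have := H₁ p u h hk z d b I hd0 hdn hb0 hb1 hinteg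
    refine le_of_mul_le_mul_left (this.trans ?_) hβ
    calc C₁ * I ≤ C₁ * ((V + C₀) * (d ^ (2 / (p - 1)) * M)) := by gcongr
      _ = _ := by ring
  by_cases hA : ∃ b q, 0 ≤ b ∧ b ≤ 1 / 4 ∧ q ∉ niceSet p u ∧ pdist q ζ ≤ ρ / 4 ∧
      q.2 = z.2 + d ^ 2 * b
  · obtain ⟨b, q, hb0, hb1, hq, hqζ, hqb⟩ := hA
    refine ⟨b, V * (d ^ (2 / (p - 1)) * M), hb0, hb1, ?_, ?_⟩
    · gcongr
      linarith
    · rw [hV, ← smul_eq_mul, ← setIntegral_const]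
      refine setIntegral_mono_on (integrableOn_closedBall (h.continuous_resc_x _ _ _ _) 1)
        (integrableOn_closedBall continuous_const 1) measurableSet_closedBall fun y hy => ?_
      refine mul_le_mul_of_nonneg_left ?_ hβ.le
      rw [← hqb]
      refine (hc q hq (by linarith)).1 _ ?_
      have hy1 := mem_closedBall_zero_iff.1 hy
      have h1 : ‖d • y‖ ≤ d := by
        rw [norm_smul, Real.norm_of_nonneg hd0.le]
        nlinarith
      have h2 := ((pdist_le_iff (by positivity)).1 hqζ).1
      rw [norm_sub_rev] at h2
      rw [show z.1 + d • y - q.1 = d • y + (z.1 - ζ.1) + (ζ.1 - q.1) by abel]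
      refine norm_add₃_le.trans ?_
      linarith
  · push Not at hA
    refine ⟨0, C₀ * (d ^ (2 / (p - 1)) * M), le_rfl, by norm_num, ?_, ?_⟩
    · gcongr
      linarith
    · have hcyl : WeakCyl (resc p u ξ.1 z.2 d) (fun y s => resc p u ξ.1 z.2 d y s ^ p) 10 0
          (1 / 4) := by
        refine h.weakCyl_resc hd0 fun y hy s hs => ?_
        by_contra hq
        refine hA s _ hs.1 hs.2 hq ?_ rfl
        have h1 : pdist (ξ.1 + d • y, z.2 + d ^ 2 * s) (ξ.1, z.2) ≤ d * 10 := by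
          refine pdist_affine_le hd0.le (mem_closedBall_zero_iff.1 hy) ?_
          rw [abs_le]
          constructor <;> linarith [hs.1, hs.2]
        have h2 : pdist (ξ.1, z.2) z ≤ D := by
          rw [pdist_le_iff hD0.le]
          refine ⟨hξ1, ?_⟩
          simpa using sq_nonneg D
        have h3 := pdist_triangle (ξ.1 + d • y, z.2 + d ^ 2 * s) (ξ.1, z.2) ζ
        have h4 := pdist_triangle (ξ.1, z.2) z ζ
        linarith
      refine (h.setIntegral_resc_le (ξ := ξ.1) hd0 ?_).trans ((H₀ _ _
        (fun y s => (h.resc_pos _ _ hd0 y s).le)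
        (fun y s => Real.rpow_nonneg (h.resc_pos _ _ hd0 y s).le _) hcyl).trans ?_)
      · rw [norm_sub_rev]
        linarith
      · refine mul_le_mul_of_nonneg_left (mul_le_mul_of_nonneg_left ?_ hβ.le) hC₀.le
        rw [smul_zero, add_zero]
        refine (hc ξ hξ ((pdist_triangle ξ z ζ).trans (by linarith))).2 _ ?_
        rw [abs_le] at hξ2 ⊢
        have h1 : D ≤ ρ / 100 := hξD.trans hz
        constructor <;> nlinarith
end LocalBound

section OneDim

/-- A Lipschitz-type bound from points of a closed set `T`, given derivative bounds on `T` and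
bounds across the gaps of `T`. -/
lemma abs_sub_le_of_gap {f f' : ℝ → ℝ} {T : Set ℝ} {b C t s : ℝ} (hf : Continuous f)
    (hT : IsClosed T) (hd : ∀ x ∈ T, HasDerivAt f (f' x) x) (hC : ∀ x ∈ T, |f' x| ≤ C)
    (hg : ∀ x ∈ T, ∀ y, x < y → y ≤ b → (∀ r ∈ Ioo x y, r ∉ T) → |f y - f x| ≤ C * (y - x))
    (ht : t ∈ T) (hts : t ≤ s) (hs : s ≤ b) : |f s - f t| ≤ C * (s - t) := by
  suffices key : ∀ ε > 0, |f s - f t| ≤ (C + ε) * (s - t) by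
    have h1 : Tendsto (fun ε : ℝ => (C + ε) * (s - t)) (𝓝[>] 0) (𝓝 ((C + 0) * (s - t))) :=
      ((continuous_const.add continuous_id).mul continuous_const).continuousWithinAt
    rw [add_zero] at h1
    exact ge_of_tendsto h1 (eventually_nhdsWithin_of_forall fun ε hε => key ε hε)
  intro ε hε
  set T' := T ∪ {s} with hT'
  have hT'c : IsClosed T' := hT.union isClosed_singleton
  set S := T' ∩ {x | |f x - f t| ≤ (C + ε) * (x - t)} with hS
  have hcl : IsClosed (S ∩ Icc t s) := by
    refine (hT'c.inter (isClosed_le ?_ ?_)).inter isClosed_Icc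
    · exact (hf.sub continuous_const).abs
    · fun_prop
  refine (hcl.mem_of_ge_of_forall_exists_gt ⟨Or.inl ht, by simp⟩ hts ?_).2
  rintro x ⟨⟨hxT', hx⟩, hx1, hx2⟩
  have hxT : x ∈ T := hxT'.resolve_right hx2.ne
  have hstep : ∀ y, x < y → |f y - f x| ≤ (C + ε) * (y - x) →
      |f y - f t| ≤ (C + ε) * (y - t) := fun y hy h1 => by
    have hx : |f x - f t| ≤ (C + ε) * (x - t) := hx
    have h2 := abs_sub_le (f y) (f x) (f t)
    linarith
  have hev : ∀ᶠ y in 𝓝 x, |f y - f x - (y - x) * f' x| ≤ ε * |y - x| := by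
    simpa using (hasDerivAt_iff_isLittleO.1 (hd x hxT)).def hε
  obtain ⟨δ, hδ, hδb⟩ := Metric.eventually_nhds_iff.1 hev
  by_cases hA : ∃ y ∈ T', x < y ∧ y ≤ s ∧ y < x + δ
  · obtain ⟨y, hy, hxy, hys, hyδ⟩ := hA
    refine ⟨y, ⟨hy, hstep y hxy ?_⟩, hxy, hys⟩
    have h1 := hδb (y := y) (by rw [Real.dist_eq, abs_of_pos (by linarith)]; linarith)
    have h2 : |(y - x) * f' x| ≤ C * (y - x) := by
      rw [abs_mul, abs_of_pos (sub_pos.2 hxy), mul_comm]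
      exact mul_le_mul_of_nonneg_right (hC x hxT) (sub_pos.2 hxy).le
    have h3 := abs_sub_abs_le_abs_sub (f y - f x) ((y - x) * f' x)
    rw [abs_of_pos (sub_pos.2 hxy)] at h1
    linarith
  · push Not at hA
    have hne : (T' ∩ Icc (x + δ) s).Nonempty := ⟨s, Or.inr rfl, hA s (Or.inr rfl) hx2 le_rfl, le_rfl⟩
    obtain ⟨y, ⟨hyT, hy1, hy2⟩, hmin⟩ :=
      ((isCompact_Icc (a := x + δ) (b := s)).inter_left hT'c).exists_isLeast hne
    have hxy : x < y := by linarith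
    refine ⟨y, ⟨hyT, hstep y hxy ((hg x hxT y hxy (hy2.trans hs) fun r hr hrT => ?_).trans ?_)⟩,
      hxy, hy2⟩
    · have hrs : r ≤ s := hr.2.le.trans hy2
      exact hr.2.not_ge (hmin ⟨Or.inl hrT, hA r (Or.inl hrT) hr.1 hrs, hrs⟩)
    · nlinarith

/-- A continuous function on an interval with a continuous right derivative is differentiable. -/
lemma hasDerivAt_of_right {h H : ℝ → ℝ} {a b t : ℝ} (hh : ContinuousOn h (Icc a b))
    (hH : ContinuousOn H (Icc a b))
    (hd : ∀ x ∈ Ioo a b, HasDerivWithinAt h (H x) (Ioi x) x) (ht : t ∈ Ioo a b) :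
    HasDerivAt h (H t) t := by
  have hinteg : ∀ x ∈ Icc a b, IntervalIntegrable H volume a x := fun x hx => by
    refine ContinuousOn.intervalIntegrable (hH.mono ?_)
    rw [uIcc_of_le hx.1]
    exact Icc_subset_Icc_right hx.2
  have hFTC : ∀ x ∈ Icc a b, h x = h a + ∫ r in a..x, H r := fun x hx => by
    rw [intervalIntegral.integral_eq_sub_of_hasDeriv_right (hh.mono ?_) ?_ (hinteg x hx)]
    · ring
    · rw [uIcc_of_le hx.1]
      exact Icc_subset_Icc_right hx.2
    · rw [min_eq_left hx.1, max_eq_right hx.1]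
      exact fun y hy => hd y ⟨hy.1, hy.2.trans_le hx.2⟩
  have hH' : ContinuousOn H (Ioo a b) := hH.mono Ioo_subset_Icc_self
  have h1 := (intervalIntegral.integral_hasDerivAt_right (hinteg t (Ioo_subset_Icc_self ht))
    (hH'.stronglyMeasurableAtFilter isOpen_Ioo t ht)
    (hH'.continuousAt (isOpen_Ioo.mem_nhds ht))).const_add (h a)
  refine h1.congr_of_eventuallyEq ?_
  filter_upwards [isOpen_Ioo.mem_nhds ht] with x hx
  exact hFTC x (Ioo_subset_Icc_self hx)

end OneDim

section BadTimes

variable {n : ℕ} {p : ℝ} {u : Eu n → ℝ → ℝ}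

/-- The times of the bad points in a parabolic cylinder. -/
def badTimes (p : ℝ) (u : Eu n → ℝ → ℝ) (ζ : Eu n × ℝ) (r : ℝ) : Set ℝ :=
  Prod.snd '' ({q | pdist q ζ ≤ r} ∩ (niceSet p u)ᶜ)

lemma isClosed_badTimes (ζ : Eu n × ℝ) (r : ℝ) : IsClosed (badTimes p u ζ r) :=
  (((isCompact_pdist_le ζ r).inter_right isOpen_niceSet.isClosed_compl).image
    continuous_snd).isClosed

lemma Sol.gap_bound (h : Sol p u) {ζ : Eu n × ℝ} {r K M a s : ℝ} {x : Eu n} (hr : 0 < r)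
    (hK : ∀ q, pdist q ζ ≤ r → u q.1 q.2 ≤ K)
    (hM : ∀ t ∈ badTimes p u ζ r, ∀ y, ‖y - ζ.1‖ ≤ r → |deriv (u y) t| ≤ M)
    (hx : ‖x - ζ.1‖ ≤ r / 2) (ha : a ∈ badTimes p u ζ r) (has : a < s) (hs : s ≤ ζ.2 + r ^ 2)
    (hgap : ∀ t ∈ Ioo a s, t ∉ badTimes p u ζ r) :
    |u x s - u x a| ≤ (K / (r / 2) ^ 2 * errc n + (M + 2 * K ^ p)) * (s - a) := by
  have hp0 : 0 ≤ p := by linarith [h.hp]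
  have haζ : ζ.2 - r ^ 2 ≤ a := by
    obtain ⟨q, ⟨hq, -⟩, rfl⟩ := ha
    have := (abs_le.1 ((pdist_le_iff hr.le).1 hq).2).1
    linarith
  have hin : ∀ y t, ‖y - ζ.1‖ ≤ r → t ∈ Icc a s → pdist (y, t) ζ ≤ r := fun y t hy ht => by
    rw [pdist_le_iff hr.le, abs_le]
    exact ⟨hy, by linarith [ht.1], by linarith [ht.2]⟩
  have hball : ∀ y ∈ Metric.closedBall (0 : Eu n) (r / 2), ‖x + y - ζ.1‖ ≤ r := fun y hy => by
    rw [show x + y - ζ.1 = (x - ζ.1) + y by abel]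
    refine (norm_add_le _ _).trans ?_
    linarith [mem_closedBall_zero_iff.1 hy]
  have hKb : ∀ y ∈ Metric.closedBall (0 : Eu n) (r / 2), ∀ t ∈ Icc a s, u (x + y) t ≤ K :=
    fun y hy t ht => hK _ (hin _ _ (hball y hy) ht)
  have haa : a ∈ Icc a s := ⟨le_rfl, has.le⟩
  set v : Eu n → ℝ := fun y => u (x + y) a with hv
  have hvc : ContDiff ℝ 2 v := (h.cx a).comp (by fun_prop)
  have hlapv : ∀ y, lap v y = deriv (u (x + y)) a - u (x + y) a ^ p := fun y => by
    have := lap_affine (h.cx a) x 1 y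
    simp only [one_smul, one_pow, one_mul] at this
    rw [hv, this, h.eq]
    ring
  set w : Eu n → ℝ → ℝ := fun y t => u (x + y) t - v y with hw
  set f : Eu n → ℝ → ℝ := fun y t => u (x + y) t ^ p + lap v y with hf
  have hwb : ∀ y ∈ Metric.closedBall (0 : Eu n) (r / 2), ∀ t ∈ Icc a s, |w y t| ≤ K :=
    fun y hy t ht => by
      have h1 := hKb y hy t ht
      have h2 := hKb y hy a haa
      have h3 := h.pos (x + y) t
      have h4 := h.pos (x + y) a
      simp only [hw, hv]
      rw [abs_le]
      constructor <;> linarith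
  have hpow : ∀ y ∈ Metric.closedBall (0 : Eu n) (r / 2), ∀ t ∈ Icc a s,
      |u (x + y) t ^ p| ≤ K ^ p := fun y hy t ht => by
    rw [abs_of_nonneg (Real.rpow_nonneg (h.pos _ _).le _)]
    exact Real.rpow_le_rpow (h.pos _ _).le (hKb y hy t ht) hp0
  have hfb : ∀ y ∈ Metric.closedBall (0 : Eu n) (r / 2), ∀ t ∈ Icc a s,
      |f y t| ≤ M + 2 * K ^ p := fun y hy t ht => by
    simp only [hf]
    rw [hlapv]
    have h1 := abs_add_le (u (x + y) t ^ p) (deriv (u (x + y)) a - u (x + y) a ^ p)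
    have h2 := abs_sub (deriv (u (x + y)) a) (u (x + y) a ^ p)
    linarith [hpow y hy t ht, hpow y hy a haa, hM a ha _ (hball y hy)]
  have hcu : ∀ t, Continuous fun y => u (x + y) t := fun t =>
    (h.continuous_x t).comp (by fun_prop)
  have hcyl : WeakCyl w f (r / 2) a s := by
    refine ⟨fun t => (hcu t).sub hvc.continuous, fun y => (h.continuous_t _).sub continuous_const,
      fun t => ((hcu t).rpow_const fun _ => Or.inr hp0).add (continuous_lap hvc), ⟨K, hwb⟩,
      ⟨_, hfb⟩, fun t ht φ hφ hsub => ?_⟩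
    have hcs := hasCompactSupport_of_subset_closedBall hsub
    have h1 : WeakAt (fun y t => u (x + y) t) (fun y t => u (x + y) t ^ p)
        (Metric.closedBall 0 (r / 2)) t := by
      refine (h.weakAt_resc (x₀ := x) (t₀ := 0) one_pos fun y hy => ?_).congr
        (Eventually.of_forall fun s y _ => by simp [resc]) (fun y _ => by simp [resc])
      rw [one_smul, one_pow, one_mul, zero_add]
      by_contra hcon
      exact hgap t ht ⟨_, ⟨hin _ t (hball y hy) (Ioo_subset_Icc_self ht), hcon⟩, rfl⟩
    have hi : ∀ {g : Eu n → ℝ}, Continuous g → Integrable fun y => g y * φ y := fun hg =>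
      (hg.mul hφ.continuous).integrable_of_hasCompactSupport hcs.mul_left
    have hl : ∀ {g : Eu n → ℝ}, Continuous g → Integrable fun y => g y * lap φ y := fun hg =>
      (hg.mul (continuous_lap hφ)).integrable_of_hasCompactSupport
        (HasCompactSupport.intro hcs.isCompact fun y hy => by
          simp [lap_eq_zero_of_notMem hy])
    refine (((h1 φ hφ hcs hsub).sub_const (∫ y, v y * φ y)).congr_of_eventuallyEq
      (Eventually.of_forall fun τ => ?_)).congr_deriv ?_
    · simp only [hw, sub_mul]
      exact integral_sub (f := fun y => u (x + y) τ * φ y) (hi (hcu τ)) (hi hvc.continuous)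
    · have hP := hi ((hcu t).rpow_const fun _ => Or.inr hp0 : Continuous fun y => u (x + y) t ^ p)
      have e1 := integral_add (f := fun y => u (x + y) t * lap φ y) (hl (hcu t)) hP
      have e2 := integral_sub (f := fun y => u (x + y) t * lap φ y) (hl (hcu t))
        (hl hvc.continuous)
      have e3 := integral_add (f := fun y => u (x + y) t ^ p * φ y) hP (hi (continuous_lap hvc))
      have e4 := integral_add (f := fun y => u (x + y) t * lap φ y - v y * lap φ y)
        ((hl (hcu t)).sub (hl hvc.continuous)) (hP.add (hi (continuous_lap hvc)))
      have e5 := integral_mul_lap_comm hvc hφ hcs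
      simp only [Pi.add_apply] at e4
      simp only [hw, hf, sub_mul, add_mul]
      linarith
  have := hcyl.abs_le_of_initial_zero (half_pos hr) has.le hwb hfb fun y _ => by simp [hw, hv]
  simpa [hw, hv] using this

end BadTimes

section Extension

variable {n : ℕ} {p : ℝ} {u : Eu n → ℝ → ℝ}

lemma continuousOn_integral_of_bdd {F : Eu n → ℝ → ℝ} {ψ : Eu n → ℝ} {J : Set ℝ} {K : ℝ}
    (hx : ∀ t, Continuous fun y => F y t) (ht : ∀ y, Continuous (F y)) (hψ : Continuous ψ)
    (hc : HasCompactSupport ψ) (hK : ∀ y, ψ y ≠ 0 → ∀ t ∈ J, |F y t| ≤ K) :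
    ContinuousOn (fun t => ∫ y, F y t * ψ y) J := by
  refine continuousOn_of_dominated (bound := fun y => K * |ψ y|) (fun t _ =>
    ((hx t).mul hψ).aestronglyMeasurable) (fun t h => Eventually.of_forall fun y => ?_)
    ((hψ.integrable_of_hasCompactSupport hc).abs.const_mul K)
    (Eventually.of_forall fun y => ((ht y).mul continuous_const).continuousOn)
  rw [Real.norm_eq_abs, abs_mul]
  by_cases hy : ψ y = 0
  · simp [hy]
  · exact mul_le_mul_of_nonneg_right (hK y hy t h) (abs_nonneg _)

/-- Boundedness near a point, together with bounds on the time derivative at bad times, makes the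
point nice. -/
lemma Sol.mem_niceSet (h : Sol p u) {ζ : Eu n × ℝ} {r K M : ℝ} (hr : 0 < r)
    (hK : ∀ q, pdist q ζ ≤ r → u q.1 q.2 ≤ K)
    (hM : ∀ t ∈ badTimes p u ζ r, ∀ y, ‖y - ζ.1‖ ≤ r → |deriv (u y) t| ≤ M) :
    ζ ∈ niceSet p u := by
  have hp0 : 0 ≤ p := by linarith [h.hp]
  set a := ζ.2 - r ^ 2 with ha
  set b := ζ.2 + r ^ 2 with hb
  set B := Metric.ball ζ.1 (r / 2) with hB
  have hBr : ∀ y ∈ B, ‖y - ζ.1‖ ≤ r / 2 := fun y hy => (mem_ball_iff_norm.1 hy).le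
  have hBt : ∀ y ∈ B, ∀ t ∈ Icc a b, pdist (y, t) ζ ≤ r := fun y hy t ht => by
    rw [pdist_le_iff hr.le, abs_le]
    exact ⟨by linarith [hBr y hy], by linarith [ht.1], by linarith [ht.2]⟩
  have hKB : ∀ y ∈ B, ∀ t ∈ Icc a b, u y t ≤ K := fun y hy t ht => hK _ (hBt y hy t ht)
  have hr2 : 0 < r ^ 2 := by positivity
  refine ⟨B, Ioo a b, Metric.isOpen_ball, Metric.mem_ball_self (by positivity), isOpen_Ioo,
    ⟨by linarith, by linarith⟩, ⟨K, fun y hy t ht => hKB y hy t (Ioo_subset_Icc_self ht)⟩,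
    fun t ht φ hφ hcs hsub => ?_⟩
  have hK0 : 0 ≤ K := (h.pos ζ.1 ζ.2).le.trans (hK ζ (by rw [pdist_self]; exact hr.le))
  have hφB : ∀ y, φ y ≠ 0 → y ∈ B := fun y hy => hsub (subset_tsupport _ hy)
  have hlB : ∀ y, lap φ y ≠ 0 → y ∈ B := fun y hy => hsub <| by
    by_contra hcon
    exact hy (lap_eq_zero_of_notMem hcon)
  have hlc : HasCompactSupport (lap φ) := HasCompactSupport.intro hcs.isCompact fun y hy =>
    lap_eq_zero_of_notMem hy
  have hub : ∀ y ∈ B, ∀ t ∈ Icc a b, |u y t| ≤ K := fun y hy t ht => by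
    rw [abs_of_pos (h.pos _ _)]
    exact hKB y hy t ht
  have hpb : ∀ y ∈ B, ∀ t ∈ Icc a b, |u y t ^ p| ≤ K ^ p := fun y hy t ht => by
    rw [abs_of_nonneg (Real.rpow_nonneg (h.pos _ _).le _)]
    exact Real.rpow_le_rpow (h.pos _ _).le (hKB y hy t ht) hp0
  have hi : ∀ {g : Eu n → ℝ}, Continuous g → Integrable fun y => g y * φ y := fun hg =>
    (hg.mul hφ.continuous).integrable_of_hasCompactSupport hcs.mul_left
  have hl : ∀ t, Integrable fun y => u y t * lap φ y := fun t =>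
    ((h.continuous_x t).mul (continuous_lap hφ)).integrable_of_hasCompactSupport hlc.mul_left
  refine hasDerivAt_of_right (h := fun s => ∫ y, u y s * φ y)
    (H := fun s => ∫ y, (u y s * lap φ y + u y s ^ p * φ y)) (a := a) (b := b)
    (continuousOn_integral_of_bdd h.continuous_x h.continuous_t hφ.continuous hcs
      fun y hy => hub y (hφB y hy)) ?_ ?_ ht
  · have h1 : ∀ s, ∫ y, (u y s * lap φ y + u y s ^ p * φ y) =
        (∫ y, u y s * lap φ y) + ∫ y, u y s ^ p * φ y := fun s =>
      integral_add (hl s) (hi (h.continuous_rpow_x s))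
    simp only [h1]
    exact (continuousOn_integral_of_bdd h.continuous_x h.continuous_t (continuous_lap hφ) hlc
      fun y hy => hub y (hlB y hy)).add (continuousOn_integral_of_bdd (F := fun y s => u y s ^ p)
        h.continuous_rpow_x h.continuous_rpow_t hφ.continuous hcs fun y hy => hpb y (hφB y hy))
  · intro t ht
    have htI := Ioo_subset_Icc_self ht
    by_cases htT : t ∈ badTimes p u ζ r
    · set C := K / (r / 2) ^ 2 * errc n + (M + 2 * K ^ p) with hC
      have hMC : M ≤ C := by
        have h1 : 0 ≤ K / (r / 2) ^ 2 * errc n := mul_nonneg (by positivity) errc_nonneg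
        have h2 : 0 ≤ K ^ p := Real.rpow_nonneg hK0 p
        linarith
      have hderiv : ∀ y s, HasDerivAt (u y) (deriv (u y) s) s := fun y s =>
        ((h.ct y).differentiable one_ne_zero s).hasDerivAt
      have hlip : ∀ y ∈ B, ∀ s ∈ Ioc t b, |u y s - u y t| ≤ C * (s - t) := fun y hy s hs =>
        abs_sub_le_of_gap (f' := deriv (u y)) (b := b) (h.continuous_t y)
          (isClosed_badTimes ζ r) (fun x _ => hderiv y x)
          (fun x hx => (hM x hx y (by linarith [hBr y hy])).trans hMC)
          (fun x hx z hxz hz hgap => h.gap_bound hr hK hM (hBr y hy) hx hxz hz hgap)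
          htT hs.1.le hs.2
      have e : ∫ y, (u y t * lap φ y + u y t ^ p * φ y) = ∫ y, deriv (u y) t * φ y := by
        rw [integral_add (hl t) (hi (h.continuous_rpow_x t)),
          integral_mul_lap_comm (h.cx t) hφ hcs,
          ← integral_add (hi (continuous_lap (h.cx t))) (hi (h.continuous_rpow_x t))]
        simp only [h.eq, add_mul]
      rw [e, hasDerivWithinAt_iff_tendsto_slope' self_notMem_Ioi]
      have hs : ∀ s, slope (fun s => ∫ y, u y s * φ y) t s =
          ∫ y, slope (u y) t s * φ y := fun s => by
        simp only [slope_def_field]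
        rw [← integral_sub (hi (h.continuous_x s)) (hi (h.continuous_x t)), ← integral_div]
        refine integral_congr_ae (Eventually.of_forall fun y => ?_)
        simp only
        ring
      refine Tendsto.congr (fun s => (hs s).symm) ?_
      refine tendsto_integral_filter_of_dominated_convergence (fun y => C * |φ y|)
        (Eventually.of_forall fun s => ?_) ?_
        ((hφ.continuous.integrable_of_hasCompactSupport hcs).abs.const_mul C)
        (Eventually.of_forall fun y => ?_)
      · simp only [slope_def_field]
        exact ((((h.continuous_x s).sub (h.continuous_x t)).div_const _).mul
          hφ.continuous).aestronglyMeasurable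
      · filter_upwards [Ioc_mem_nhdsGT ht.2] with s hs
        refine Eventually.of_forall fun y => ?_
        rw [Real.norm_eq_abs, abs_mul]
        by_cases hy : φ y = 0
        · simp [hy]
        · refine mul_le_mul_of_nonneg_right ?_ (abs_nonneg _)
          rw [slope_def_field, abs_div, abs_of_pos (sub_pos.2 hs.1), div_le_iff₀ (sub_pos.2 hs.1)]
          exact hlip y (hφB y hy) s hs
      · exact ((hasDerivWithinAt_iff_tendsto_slope' self_notMem_Ioi).1
          (hderiv y t).hasDerivWithinAt).mul_const _
    · refine (h.weakAt (K := tsupport φ) hcs.isCompact (fun y hy => ?_) φ hφ hcs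
        subset_rfl).hasDerivWithinAt
      by_contra hcon
      exact htT ⟨_, ⟨hBt y (hsub hy) t htI, hcon⟩, rfl⟩

lemma Sol.exists_isPosSol_le_one (h : Sol p u) :
    ∃ v, IsPosSol n p v ∧ ∀ x t, v (x, t) ≤ 1 := by
  by_cases hA : ∀ k : ℕ, ∃ z, {q | pdist q z ≤ 2 * (k + 1) / rate p u z} ⊆ niceSet p u
  · exact h.exists_isPosSol hA
  exfalso
  push Not at hA
  obtain ⟨k, hk⟩ := hA
  obtain ⟨q, -, hq⟩ := not_subset.1 (hk 0)
  obtain ⟨ζ, hζ, ρ, M, hρ, -, hc⟩ := h.exists_bound_near_bad ⟨q, hq⟩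
  obtain ⟨K, hK⟩ := h.exists_bound_near hk hζ hρ fun q hq hqζ =>
    ⟨fun y hy => ((hc q hq hqζ).1 y hy).1, (hc q hq hqζ).2⟩
  refine hζ (h.mem_niceSet (r := ρ / 100) (by positivity) hK ?_ (M := M))
  rintro _ ⟨q, ⟨hq, hqn⟩, rfl⟩ y hy
  have hq : pdist q ζ ≤ ρ / 100 := hq
  refine ((hc q hqn (by linarith)).1 y ?_).2
  have h1 := ((pdist_le_iff (by positivity)).1 hq).1
  rw [norm_sub_rev] at h1
  have h2 := norm_sub_le_norm_sub_add_norm_sub y ζ.1 q.1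
  linarith

end Extension

end BoundedSolutions

/-- If `∂ₜ u = Δu + u^p` has a positive classical solution on `ℝⁿ × ℝ`, then it has
a positive classical solution bounded by `1`. -/
theorem exists_bounded_positive_solution
    (n : ℕ) (hn : 1 ≤ n) (p : ℝ) (hp : 1 < p)
    (hex : ∃ u : EuclideanSpace ℝ (Fin n) × ℝ → ℝ, IsPosSol n p u) :
    ∃ v : EuclideanSpace ℝ (Fin n) × ℝ → ℝ, IsPosSol n p v ∧
      ∀ x t, v (x, t) ≤ 1 := by
  obtain ⟨u, h1, h2, h3, h4⟩ := hex
  exact Sol.exists_isPosSol_le_one (u := fun x t => u (x, t))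
    ⟨hp, h1, h2, h3, fun x t => h4 x t⟩
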